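/- If a GCMP instance admits a schedule, then it admits a schedule whose total traveled length is O(|V(G)|³), i.e., there is a universal constant c > 0 such that every feasible GCMP instance on a graph G admits a schedule of total traveled length at most c·|V(G)|³. -/

import Mathlib

open SimpleGraph

/-- A GCMP instance on a graph `G` with `k` robots: `isM i` holds iff robot `i` belongs
to the set `M` of robots with destinations (otherwise it is a free robot of `F`);
`start` gives the starting vertices (pairwise distinct), and `dest` gives the
destination vertices of the robots in `M` (pairwise distinct on `M`). -/
structure Inst (V : Type) (G : SimpleGraph V) (k : ℕ) where
  isM : Fin k → Prop
  start : Fin k → V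
  dest : Fin k → V
  start_inj : Function.Injective start
  dest_injOn : Set.InjOn dest {i | isM i}

/-- A schedule for a GCMP instance: positions `pos j i` of robot `i` at time `j ∈ [0,T]`,
each robot follows a route (stay or move along an edge), starting at its starting vertex,
robots of `M` ending at their destinations, and the routes are pairwise non-conflicting
(no two robots on the same vertex at the same time, and no edge swap). -/
structure Sched {V : Type} {G : SimpleGraph V} {k : ℕ} (I : Inst V G k) where
  T : ℕ
  pos : ℕ → Fin k → V
  init : ∀ i, pos 0 i = I.start i
  final : ∀ i, I.isM i → pos T i = I.dest i
  step : ∀ j, j < T → ∀ i, pos (j + 1) i = pos j i ∨ G.Adj (pos j i) (pos (j + 1) i)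
  noVertexConflict : ∀ j, j ≤ T → Function.Injective fun i => pos j i
  noSwap : ∀ j, j < T → ∀ i i', i ≠ i' →
      ¬(pos (j + 1) i = pos j i' ∧ pos (j + 1) i' = pos j i)

/-- The (traveled) length of the route of robot `i` in schedule `S`:
the number of time steps at which robot `i` moves. -/
noncomputable def routeLength {V : Type} {G : SimpleGraph V} {k : ℕ} {I : Inst V G k}
    (S : Sched I) (i : Fin k) : ℕ :=
  {j : ℕ | j < S.T ∧ S.pos j i ≠ S.pos (j + 1) i}.ncard

/-- The total traveled length (energy) of a schedule. -/
noncomputable def totalLength {V : Type} {G : SimpleGraph V} {k : ℕ} {I : Inst V G k}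
    (S : Sched I) : ℕ :=
  ∑ i : Fin k, routeLength S i

/-- A schedule is optimal if it has minimum total traveled length. -/
def Optimal {V : Type} {G : SimpleGraph V} {k : ℕ} {I : Inst V G k}
    (S : Sched I) : Prop :=
  ∀ S' : Sched I, totalLength S ≤ totalLength S'

open SimpleGraph
namespace CM
open Equiv Equiv.Perm
set_option linter.unusedSectionVars false

section basics
variable {V : Type} [Fintype V] [DecidableEq V] {G : SimpleGraph V}

def Rot (G : SimpleGraph V) (g : Perm V) : Prop :=
  ∀ v, g v ≠ v → G.Adj v (g v) ∧ g (g v) ≠ v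

inductive E (G : SimpleGraph V) (S : Finset V) : Perm V → ℕ → Prop
  | sw (p q : V) : q ∈ S → G.Adj p q → E G S (swap p q) 1
  | rot (g : Perm V) : Rot G g → E G S g g.support.card

inductive M (G : SimpleGraph V) (S : Finset V) : Perm V → ℕ → Prop
  | nil (c : ℕ) : M G S 1 c
  | cons {γ δ : Perm V} {c d : ℕ} : M G S γ c → E G (S.image γ) δ d → M G S (δ * γ) (c + d)

lemma image_mul (S : Finset V) (a b : Perm V) : S.image (a * b : Perm V) = (S.image b).image a := by
  rw [Finset.image_image]; rfl

lemma M.mono {S : Finset V} {γ : Perm V} {c d : ℕ} (h : M G S γ c) (hc : c ≤ d) : M G S γ d := by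
  induction h generalizing d with
  | nil c => exact M.nil d
  | @cons γ δ c e h1 h2 ih =>
    have := M.cons (ih (d := d - e) (by omega)) h2
    rwa [Nat.sub_add_cancel (by omega)] at this

lemma M.trans {S : Finset V} {γ δ : Perm V} {c d : ℕ} (h : M G S γ c)
    (h' : M G (S.image γ) δ d) : M G S (δ * γ) (c + d) := by
  induction h' with
  | nil d => simpa using h.mono (Nat.le_add_right c d)
  | @cons δ ε d e h1 h2 ih =>
    rw [mul_assoc, ← add_assoc]
    exact M.cons ih (by rwa [image_mul])

lemma M.of {S : Finset V} {γ : Perm V} {c : ℕ} (h : E G S γ c) : M G S γ c := by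
  have := M.cons (M.nil (G := G) (S := S) 0) (δ := γ) (d := c) (by simpa using h)
  simpa using this

lemma M.sw {S : Finset V} {p q : V} (hq : q ∈ S) (h : G.Adj p q) : M G S (swap p q) 1 :=
  M.of (E.sw p q hq h)

lemma M.rot {S : Finset V} {g : Perm V} (h : Rot G g) : M G S g g.support.card := M.of (E.rot g h)

lemma Rot.inv {g : Perm V} (h : Rot G g) : Rot G g⁻¹ := by
  intro v hv
  have h1 : g (g⁻¹ v) = v := by simp
  have h2 := h (g⁻¹ v) (by rw [h1]; exact fun e => hv e.symm)
  rw [h1] at h2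
  refine ⟨h2.1.symm, fun e => h2.2 ?_⟩
  have : g (g (g⁻¹ (g⁻¹ v))) = v := by simp
  rw [e] at this
  have h5 := congrArg (fun z => g⁻¹ z) this
  simpa using h5

lemma E.symm {S : Finset V} {γ : Perm V} {c : ℕ} (h : E G S γ c) : E G (S.image γ) γ⁻¹ c := by
  cases h with
  | sw p q hq h =>
    rw [swap_inv, swap_comm]
    exact E.sw q p (Finset.mem_image.2 ⟨q, hq, by simp⟩) h.symm
  | rot g h => rw [← support_inv]; exact E.rot _ h.inv

lemma M.symm {S : Finset V} {γ : Perm V} {c : ℕ} (h : M G S γ c) : M G (S.image γ) γ⁻¹ c := by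
  induction h with
  | nil c => simpa using M.nil c
  | @cons γ δ c e h1 h2 ih =>
    rw [mul_inv_rev, add_comm, image_mul]
    refine M.trans (M.of h2.symm) ?_
    rw [← image_mul]; simpa using ih

lemma M.symm' {S T : Finset V} {γ : Perm V} {c : ℕ} (h : M G S γ c) (hT : S.image γ = T) :
    M G T γ⁻¹ c := hT ▸ h.symm

lemma image_inv_of {S T : Finset V} {γ : Perm V} (hT : S.image γ = T) : T.image (γ⁻¹ : Perm V) = S := by
  rw [← hT, ← image_mul]; simp

lemma mem_image_perm {S : Finset V} {γ : Perm V} {v : V} : γ v ∈ S.image γ ↔ v ∈ S := by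
  simp

lemma image_swap_notMem {S : Finset V} {a b : V} (ha : a ∉ S) (hb : b ∉ S) :
    S.image (swap a b) = S := by
  conv_rhs => rw [← Finset.image_id (s := S)]
  refine Finset.image_congr fun x hx => ?_
  have hx : x ∈ S := hx
  exact swap_apply_of_ne_of_ne (fun e => ha (e ▸ hx)) (fun e => hb (e ▸ hx))

lemma M.conj {S : Finset V} {γ : Perm V} {a b : V} {c d : ℕ} (h : M G S γ c) (ha : a ∉ S) (hb : b ∉ S)
    (h' : M G (S.image γ) (swap (γ a) (γ b)) d) : M G S (swap a b) (2 * c + d) := by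
  have h3 : M G ((S.image γ).image (swap (γ a) (γ b))) γ⁻¹ c := by
    rw [image_swap_notMem (by simpa) (by simpa)]; exact h.symm
  rw [← image_mul] at h3
  have h4 := (h.trans h').trans h3
  have : γ⁻¹ * (swap (γ a) (γ b) * γ) = swap a b := by
    have := Equiv.mul_swap_eq_swap_mul γ a b
    rw [← this]; simp
  rw [this] at h4
  exact h4.mono (by omega)

end basics

section sched
variable {V : Type} [Fintype V] [DecidableEq V] {G : SimpleGraph V} {ι : Type} [Fintype ι] [DecidableEq ι]

def Stp (G : SimpleGraph V) (x y : ι → V) : Prop :=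
  (∀ i, y i = x i ∨ G.Adj (x i) (y i)) ∧ Function.Injective y ∧
    ∀ i i', i ≠ i' → ¬(y i = x i' ∧ y i' = x i)

def holes (x : ι → V) : Finset V := Finset.univ \ Finset.univ.image x

lemma mem_holes {x : ι → V} {v : V} : v ∈ holes x ↔ ∀ i, x i ≠ v := by simp [holes]

lemma image_holes (x : ι → V) (γ : Perm V) : (holes x).image γ = holes (γ ∘ x) := by
  ext v
  rw [mem_holes, Finset.mem_image]
  constructor
  · rintro ⟨w, hw, rfl⟩ i e
    exact mem_holes.1 hw i (γ.injective e)
  · intro h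
    refine ⟨γ⁻¹ v, mem_holes.2 fun i e => h i ?_, by simp⟩
    simp [e]

lemma step_M (m : ℕ) : ∀ (x y : ι → V), Function.Injective x → Stp G x y →
    (Finset.univ.filter fun i => x i ≠ y i).card = m →
    ∃ γ c, M G (holes x) γ c ∧ y = γ ∘ x := by
  induction m with
  | zero =>
    intro x y hx h hm
    refine ⟨1, 0, M.nil 0, ?_⟩
    rw [Finset.card_eq_zero, Finset.filter_eq_empty_iff] at hm
    ext i
    have := @hm i (Finset.mem_univ i)
    simpa using (not_not.1 this).symm
  | succ m ih =>
    intro x y hx h hm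
    obtain ⟨h1, h2, h3⟩ := h
    by_cases hc : ∃ i, x i ≠ y i ∧ ∀ j, x j ≠ y i
    · obtain ⟨i, hi, hj⟩ := hc
      have hE : M G (holes x) (swap (x i) (y i)) 1 :=
        M.sw (mem_holes.2 hj) ((h1 i).resolve_left (Ne.symm hi))
      have hx' : (swap (x i) (y i)) ∘ x = Function.update x i (y i) := by
        ext j
        by_cases hji : j = i
        · subst hji; simp
        · simp only [Function.comp, Function.update_of_ne hji]
          exact swap_apply_of_ne_of_ne (fun e => hji (hx e)) (hj j)
      obtain ⟨γ, c, hγ, hy⟩ := ih (Function.update x i (y i)) y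
        (by rw [← hx']; exact (Equiv.injective _).comp hx)
        ⟨fun j => by
          by_cases hji : j = i
          · subst hji; simp
          · simpa [Function.update_of_ne hji] using h1 j, h2, fun a b hab e => by
          by_cases ha : a = i
          · subst ha
            rw [Function.update_self, Function.update_of_ne (Ne.symm hab)] at e
            exact hab (h2 e.2.symm)
          · by_cases hb : b = i
            · subst hb
              rw [Function.update_self, Function.update_of_ne ha] at e
              exact hab (h2 e.1)
            · rw [Function.update_of_ne ha, Function.update_of_ne hb] at e
              exact h3 a b hab e⟩
        (by
          have : (Finset.univ.filter fun j => Function.update x i (y i) j ≠ y j)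
              = (Finset.univ.filter fun j => x j ≠ y j).erase i := by
            ext j
            by_cases hji : j = i
            · subst hji; simp
            · simp [hji]
          rw [this, Finset.card_erase_of_mem (by simp [hi]), hm]; rfl)
      refine ⟨γ * swap (x i) (y i), _, hE.trans (d := c) ?_, ?_⟩
      · rw [image_holes, hx']; exact hγ
      · rw [← hx'] at hy; exact hy
    · push Not at hc
      have hc' : ∀ i, ∃ j, x j = y i := fun i => by
        by_cases hi : x i = y i
        · exact ⟨i, hi⟩
        · exact hc i hi
      classical
      let f : V → V := fun v => if h : ∃ i, x i = v then y h.choose else v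
      have fx : ∀ i, f (x i) = y i := fun i => by
        have h : ∃ j, x j = x i := ⟨i, rfl⟩
        simp only [f, dif_pos h]
        rw [hx h.choose_spec]
      have fn : ∀ v, (¬ ∃ i, x i = v) → f v = v := fun v h => by simp only [f, dif_neg h]
      have finj : Function.Injective f := by
        intro v w e
        by_cases hv : ∃ i, x i = v <;> by_cases hw : ∃ i, x i = w
        · obtain ⟨i, rfl⟩ := hv; obtain ⟨j, rfl⟩ := hw
          rw [fx, fx] at e; rw [h2 e]
        · obtain ⟨i, rfl⟩ := hv
          rw [fx, fn w hw] at e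
          exact absurd (e ▸ hc' i) hw
        · obtain ⟨i, rfl⟩ := hw
          rw [fx, fn v hv] at e
          exact absurd (e ▸ hc' i) hv
        · rwa [fn v hv, fn w hw] at e
      let g : Perm V := Equiv.ofBijective f (Finite.injective_iff_bijective.1 finj)
      have hg : ∀ v, g v = f v := fun v => rfl
      refine ⟨g, _, M.rot (g := g) ?_, ?_⟩
      · intro v hv
        simp only [hg] at hv ⊢
        by_cases hv' : ∃ i, x i = v
        · obtain ⟨i, rfl⟩ := hv'
          rw [fx] at hv ⊢
          refine ⟨(h1 i).resolve_left hv, ?_⟩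
          obtain ⟨j, hj⟩ := hc' i
          rw [← hj, fx]
          intro e
          refine h3 i j ?_ ⟨hj.symm, e⟩
          rintro rfl; exact hv e
        · exact absurd (fn v hv') hv
      · ext i; simp [hg, fx]

def Sc (G : SimpleGraph V) (x y : ι → V) (c : ℕ) : Prop :=
  ∃ (T : ℕ) (p : ℕ → ι → V), p 0 = x ∧ p T = y ∧ (∀ j < T, Stp G (p j) (p (j+1))) ∧
    ∑ j ∈ Finset.range T, (Finset.univ.filter fun i => p j i ≠ p (j+1) i).card ≤ c

lemma Sc.snoc {x y z : ι → V} {c d : ℕ} (h : Sc G x y c) (h' : Stp G y z)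
    (hd : (Finset.univ.filter fun i => y i ≠ z i).card ≤ d) : Sc G x z (c + d) := by
  obtain ⟨T, p, h0, hT, hs, hc⟩ := h
  have e1 : ∀ j ≤ T, Function.update p (T+1) z j = p j := fun j hj =>
    Function.update_of_ne (by omega) _ _
  refine ⟨T+1, Function.update p (T+1) z, ?_, by simp, ?_, ?_⟩
  · rw [e1 0 (by omega), h0]
  · intro j hj
    rw [e1 j (by omega)]
    by_cases hjT : j = T
    · subst hjT; rw [Function.update_self, hT]; exact h'
    · rw [e1 (j+1) (by omega)]; exact hs j (by omega)
  · rw [Finset.sum_range_succ, Function.update_self, e1 T le_rfl, hT]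
    refine add_le_add (le_trans (le_of_eq (Finset.sum_congr rfl fun j hj => ?_)) hc) hd
    have := Finset.mem_range.1 hj
    rw [e1 j (by omega), e1 (j+1) (by omega)]

lemma M.sc {x : ι → V} (hx : Function.Injective x) {γ : Perm V} {c : ℕ}
    (h : M G (holes x) γ c) : Sc G x (γ ∘ x) c := by
  induction h with
  | nil c => exact ⟨0, fun _ => x, rfl, rfl, by simp, by simp⟩
  | @cons γ δ c d h1 h2 ih =>
    have inj : Function.Injective (γ ∘ x) := γ.injective.comp hx
    rw [image_holes] at h2
    have ecomp : (δ * γ : Perm V) ∘ x = δ ∘ (γ ∘ x) := rfl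
    rw [ecomp]
    generalize γ ∘ x = y at *
    refine ih.snoc ?_ ?_
    · refine ⟨fun i => ?_, δ.injective.comp inj, fun i i' hii e => ?_⟩
      · cases h2 with
        | sw p q hq h =>
          simp only [Function.comp]
          by_cases hi : y i = p
          · right; rw [hi, swap_apply_left]; exact h
          · left; exact swap_apply_of_ne_of_ne hi (mem_holes.1 hq i)
        | rot g h =>
          by_cases hi : δ (y i) = y i
          · left; exact hi
          · right; exact (h _ hi).1
      · simp only [Function.comp] at e
        cases h2 with
        | sw p q hq h =>
          have : ∀ i, y i ≠ p → swap p q (y i) = y i := fun i hi =>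
            swap_apply_of_ne_of_ne hi (mem_holes.1 hq i)
          by_cases hi : y i = p
          · rw [hi, swap_apply_left] at e
            exact mem_holes.1 hq i' e.1.symm
          · rw [this i hi] at e; exact hii (inj e.1)
        | rot g h =>
          have h3 : δ (y i) ≠ y i := fun e' => hii (inj (e'.symm.trans e.1))
          apply (h _ h3).2
          rw [e.1, e.2]
    · have key : (Finset.univ.filter fun i => y i ≠ (δ ∘ y) i).image y ⊆
          Finset.univ.filter fun v => δ v ≠ v ∧ v ∉ holes y := by
        intro v hv
        obtain ⟨i, hi, rfl⟩ := Finset.mem_image.1 hv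
        have := (Finset.mem_filter.1 hi).2
        simp only [Finset.mem_filter, Finset.mem_univ, true_and]
        exact ⟨fun e => this e.symm, fun e => mem_holes.1 e i rfl⟩
      rw [← Finset.card_image_of_injective _ inj]
      refine le_trans (Finset.card_le_card key) ?_
      cases h2 with
      | sw p q hq h =>
        refine Finset.card_le_one.2 fun a ha b hb => ?_
        have : ∀ a, (a ∈ Finset.univ.filter fun v => swap p q v ≠ v ∧ v ∉ holes y) → a = p := by
          intro a ha
          obtain ⟨-, h1, h2⟩ := Finset.mem_filter.1 ha
          by_contra hne
          exact h1 (swap_apply_of_ne_of_ne hne (fun e => h2 (e ▸ hq)))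
        rw [this a ha, this b hb]
      | rot g h =>
        refine Finset.card_le_card fun v hv => ?_
        rw [Equiv.Perm.mem_support]; exact ((Finset.mem_filter.1 hv).2).1

end sched

lemma final_reduction (C : ℕ) (hC : 0 < C)
    (main : ∀ (V : Type) [Fintype V] [DecidableEq V] (G : SimpleGraph V) (S : Finset V) (γ : Perm V) (c : ℕ),
      M G S γ c → ∃ γ' : Perm V, (∀ v, v ∉ S → γ' v = γ v) ∧ M G S γ' (C * Fintype.card V ^ 3)) :
    ∃ c : ℕ, 0 < c ∧
      ∀ (V : Type) [Fintype V] (G : SimpleGraph V) (k : ℕ) (I : Inst V G k),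
        Nonempty (Sched I) →
        ∃ S : Sched I, totalLength S ≤ c * (Fintype.card V) ^ 3 := by
  refine ⟨C, hC, fun V _ G k I ⟨S⟩ => ?_⟩
  classical
  have h1 : ∀ j ≤ S.T, ∃ γ c, M G (holes I.start) γ c ∧ S.pos j = γ ∘ I.start := by
    intro j
    induction j with
    | zero => exact fun _ => ⟨1, 0, M.nil 0, by ext i; simp [S.init]⟩
    | succ j ih =>
      intro hj
      obtain ⟨γ, c, h, e⟩ := ih (by omega)
      obtain ⟨δ, d, h', e'⟩ := step_M (G := G) _ (S.pos j) (S.pos (j+1)) (S.noVertexConflict j (by omega))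
        ⟨S.step j (by omega), S.noVertexConflict (j+1) hj, S.noSwap j (by omega)⟩ rfl
      refine ⟨δ * γ, _, h.trans (d := d) ?_, ?_⟩
      · rw [image_holes, ← e]; exact h'
      · rw [e', e]; rfl
  obtain ⟨γ, c, h, e⟩ := h1 S.T le_rfl
  obtain ⟨γ', h2, h3⟩ := main V G _ γ c h
  obtain ⟨T, p, h0, hT, hs, hc⟩ := h3.sc I.start_inj
  have e2 : γ' ∘ I.start = S.pos S.T := by
    rw [e]; ext i
    exact h2 _ (fun hh => mem_holes.1 hh i rfl)
  refine ⟨⟨T, p, fun i => by rw [h0], fun i hi => ?_, fun j hj => (hs j hj).1, fun j hj => ?_,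
    fun j hj => (hs j hj).2.2⟩, ?_⟩
  · rw [hT, e2]; exact S.final i hi
  · cases j with
    | zero => rw [h0]; exact I.start_inj
    | succ j => exact (hs j (by omega)).2.1
  · refine le_trans (le_of_eq ?_) hc
    unfold totalLength routeLength
    simp only [Finset.card_filter]
    rw [Finset.sum_comm]
    refine Finset.sum_congr rfl fun i _ => ?_
    rw [← Finset.card_filter, ← Set.ncard_coe_finset]
    congr 1
    ext j; simp

end CM

open SimpleGraph
namespace CM
open Equiv Equiv.Perm
set_option linter.unusedSectionVars false
section P2
variable {V : Type} [Fintype V] [DecidableEq V] {G : SimpleGraph V}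

def kp (G : SimpleGraph V) (D : Set V) : SimpleGraph V where
  Adj u v := G.Adj u v ∧ u ∈ D ∧ v ∈ D
  symm := ⟨fun _ _ h => ⟨h.1.symm, h.2.2, h.2.1⟩⟩
  loopless := ⟨fun _ h => G.irrefl h.1⟩

lemma kp_mono {D D' : Set V} (h : D ⊆ D') : kp G D ≤ kp G D' :=
  fun _ _ a => ⟨a.1, h a.2.1, h a.2.2⟩

lemma kp_le {D : Set V} : kp G D ≤ G := fun _ _ a => a.1

lemma kp_mem {D : Set V} {u v : V} (h : (kp G D).Reachable u v) (hne : u ≠ v) : u ∈ D ∧ v ∈ D := by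
  obtain ⟨w⟩ := h
  cases w with
  | nil => exact absurd rfl hne
  | cons h w =>
    refine ⟨h.2.1, ?_⟩
    have key : ∀ {a b : V} (w : (kp G D).Walk a b), a ∈ D → b ∈ D := by
      intro a b w
      induction w with
      | nil => exact id
      | cons h w ih => exact fun _ => ih h.2.2
    exact key w h.2.2

lemma kp_mem_right {D : Set V} {u v : V} (h : (kp G D).Reachable u v) (hu : u ∈ D) : v ∈ D := by
  by_cases e : u = v
  · exact e ▸ hu
  · exact (kp_mem h e).2

lemma kp_mem_left {D : Set V} {u v : V} (h : (kp G D).Reachable u v) (hv : v ∈ D) : u ∈ D :=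
  kp_mem_right h.symm hv

lemma walk_supp {D : Set V} {a b : V} (w : (kp G D).Walk a b) (ha : a ∈ D) :
    ∀ v ∈ w.support, v ∈ D := by
  intro v hv
  exact kp_mem_right ⟨w.takeUntil v hv⟩ ha

lemma walk_kp {D : Set V} {a b : V} (w : G.Walk a b) (h : ∀ v ∈ w.support, v ∈ D) :
    (kp G D).Reachable a b := by
  induction w with
  | nil => exact Reachable.refl _
  | cons hh w ih =>
    refine Reachable.trans (Adj.reachable ?_) (ih fun v hv => h v (by simp [hv]))
    exact ⟨hh, h _ (by simp), h _ (by simp)⟩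

def Cyc (G : SimpleGraph V) (g : Perm V) : Prop := Rot G g ∧ g.IsCycle

lemma Cyc.inv {g : Perm V} (h : Cyc G g) : Cyc G g⁻¹ := ⟨h.1.inv, h.2.inv⟩

lemma LC {a : V} {l : List V} (hn : (a :: l).Nodup) (h2 : 2 ≤ l.length)
    (hc : List.IsChain G.Adj (a :: l ++ [a])) :
    Cyc G (a :: l).formPerm ∧ (∀ v, v ∈ (a :: l).formPerm.support ↔ v ∈ a :: l) := by
  have hs : (a :: l).formPerm.support = (a :: l).toFinset :=
    List.support_formPerm_of_nodup _ hn (by rintro x e; have := congrArg List.length e; simp at this; subst this; simp at h2)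
  have hs' : ∀ v, v ∈ (a :: l).formPerm.support ↔ v ∈ a :: l := fun v => by rw [hs, List.mem_toFinset]
  refine ⟨⟨?_, List.isCycle_formPerm hn (by simp; omega)⟩, hs'⟩
  intro v hv
  have hv' : v ∈ a :: l := (hs' v).1 (Equiv.Perm.mem_support.2 hv)
  obtain ⟨i, hi, rfl⟩ := List.getElem_of_mem hv'
  rw [List.formPerm_apply_getElem _ hn, List.formPerm_apply_getElem _ hn]
  constructor
  · have hi' : i < l.length + 1 := hi
    have := List.isChain_iff_getElem.1 hc i (by simp; omega)
    rw [List.getElem_append_left hi] at this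
    convert this using 1
    by_cases h : i + 1 < (a :: l).length
    · rw [List.getElem_append_left h]
      congr 1; exact Nat.mod_eq_of_lt h
    · have e : i + 1 = (a :: l).length := by simp at h ⊢; omega
      rw [List.getElem_append_right (by omega)]
      simp [e]
  · intro e
    rw [List.Nodup.getElem_inj_iff hn] at e
    have hi' : i < l.length + 1 := hi
    simp only [List.length_cons] at e
    by_cases h : i + 1 < l.length + 1
    · rw [Nat.mod_eq_of_lt h] at e
      by_cases h' : i + 1 + 1 < l.length + 1
      · rw [Nat.mod_eq_of_lt h'] at e; omega
      · have : i + 1 + 1 = l.length + 1 := by omega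
        rw [this, Nat.mod_self] at e; omega
    · have : i + 1 = l.length + 1 := by omega
      rw [this, Nat.mod_self, Nat.mod_eq_of_lt (by omega)] at e; omega

lemma CYC {p p' u : V} (h1 : G.Adj p p') (h2 : G.Adj p u) (hne : p' ≠ u)
    {D : Set V} (hD : p ∉ D) (hr : (kp G D).Reachable p' u) :
    ∃ g, Cyc G g ∧ g p = p' ∧ g u = p ∧ p ∈ g.support ∧ p' ∈ g.support ∧ u ∈ g.support ∧
      ∀ v ∈ g.support, v = p ∨ v ∈ D := by
  obtain ⟨w, hw⟩ := hr.exists_isPath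
  have hm := (kp_mem hr hne).1
  have hsup := walk_supp w hm
  have hn : (p :: w.support).Nodup := List.nodup_cons.2 ⟨fun h => hD (hsup p h), hw.support_nodup⟩
  have hl : 2 ≤ w.support.length := by
    rw [Walk.length_support]
    cases w with
    | nil => exact absurd rfl hne
    | cons h w => simp
  have hc : List.IsChain G.Adj (p :: w.support ++ [p]) := by
    rw [List.isChain_append]
    refine ⟨?_, by simp, ?_⟩
    · have := (w.mapLe kp_le).isChain_adj_support
      rw [Walk.support_mapLe_eq_support] at this
      rw [← Walk.cons_tail_support] at this ⊢
      exact List.isChain_cons_cons.2 ⟨h1, this⟩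
    · intro x hx y hy
      simp at hy; subst hy
      rw [List.getLast?_cons] at hx
      simp [List.getLast?_eq_some_getLast, Walk.support_ne_nil] at hx
      rw [← hx]; exact h2.symm
  obtain ⟨hC, hs⟩ := LC hn hl hc
  refine ⟨_, hC, ?_, ?_, (hs _).2 (by simp), (hs _).2 (by simp), (hs _).2 (by simp), fun v hv => ?_⟩
  · rw [← Walk.cons_tail_support w] at hn ⊢
    exact List.formPerm_apply_head _ _ _ hn
  · have := List.formPerm_apply_getLast p w.support
    rwa [List.getLast_cons (Walk.support_ne_nil w), Walk.getLast_support] at this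
  · rcases List.mem_cons.1 ((hs v).1 hv) with h | h
    · exact Or.inl h
    · exact Or.inr (hsup v h)

lemma Rot.adj_or {g : Perm V} (h : Rot G g) (v : V) : g v = v ∨ G.Adj v (g v) := by
  by_cases e : g v = v
  · exact Or.inl e
  · exact Or.inr (h v e).1

lemma cyc_reach_aux {g : Perm V} (h : Cyc G g) {p q : V} (hp : p ∈ g.support) (hq : q ∈ g.support)
    (hne : q ≠ p) : (kp G {v | v ∈ g.support ∧ v ≠ p}).Reachable (g p) q := by
  have hs : SameCycle g p q := h.2.sameCycle (Equiv.Perm.mem_support.1 hp) (Equiv.Perm.mem_support.1 hq)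
  have hex : ∃ i : ℕ, (g ^ i) p = q := by
    obtain ⟨i, -, hi⟩ := hs.exists_pow_eq'
    exact ⟨i, hi⟩
  classical
  have hmin : ∀ j, 0 < j → j ≤ Nat.find hex → (g ^ j) p ≠ p := by
    intro j hj hjl e
    rcases Nat.lt_or_ge j (Nat.find hex) with h1 | h1
    · apply Nat.find_min hex (m := Nat.find hex - j) (by omega)
      have := Nat.find_spec hex
      rw [show Nat.find hex = (Nat.find hex - j) + j by omega, pow_add, Perm.mul_apply, e] at this
      exact this
    · have : j = Nat.find hex := by omega
      rw [this, Nat.find_spec hex] at e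
      exact hne e
  have key : ∀ j, j + 1 ≤ Nat.find hex → (kp G {v | v ∈ g.support ∧ v ≠ p}).Reachable (g p) ((g ^ (j+1)) p) := by
    intro j
    induction j with
    | zero => intro _; simp
    | succ j ih =>
      intro hj
      refine (ih (by omega)).trans (Adj.reachable ⟨?_, ⟨?_, ?_⟩, ?_, ?_⟩)
      · rw [pow_succ' g (j+1), Perm.mul_apply]
        refine (h.1 _ ?_).1
        rw [← Equiv.Perm.mem_support, pow_apply_mem_support]; exact hp
      · rw [pow_apply_mem_support]; exact hp
      · exact hmin _ (by omega) (by omega)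
      · rw [pow_apply_mem_support]; exact hp
      · exact hmin _ (by omega) (by omega)
  have h0 : 0 < Nat.find hex := by
    rcases Nat.eq_zero_or_pos (Nat.find hex) with h0 | h0
    · have := Nat.find_spec hex
      rw [h0] at this; exact absurd this.symm hne
    · exact h0
  have := key (Nat.find hex - 1) (by omega)
  rw [Nat.sub_add_cancel h0, Nat.find_spec hex] at this
  exact this

lemma cyc_reach {g : Perm V} (h : Cyc G g) {p q q' : V} (hq : q ∈ g.support) (hq' : q' ∈ g.support)
    (hqp : q ≠ p) (hqp' : q' ≠ p) : (kp G {v | v ∈ g.support ∧ v ≠ p}).Reachable q q' := by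
  by_cases hp : p ∈ g.support
  · exact (cyc_reach_aux h hp hq hqp).symm.trans (cyc_reach_aux h hp hq' hqp')
  · by_cases e : q = q'
    · subst e; exact Reachable.refl _
    · have h1 := cyc_reach_aux h hq hq' (Ne.symm e)
      have hm : g q ∈ g.support := Equiv.Perm.apply_mem_support.2 hq
      refine Reachable.trans (Adj.reachable ⟨(h.1 q (Equiv.Perm.mem_support.1 hq)).1, ⟨hq, hqp⟩, hm, ?_⟩)
        (h1.mono (kp_mono ?_))
      · rintro rfl; exact hp hm
      · rintro v ⟨hv, -⟩; exact ⟨hv, fun e => hp (e ▸ hv)⟩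

lemma cyc_conn {g : Perm V} (h : Cyc G g) {q q' : V} (hq : q ∈ g.support) (hq' : q' ∈ g.support) :
    (kp G {v | v ∈ g.support}).Reachable q q' := by
  by_cases e : q = q'
  · subst e; exact Reachable.refl _
  · have h1 := cyc_reach_aux h hq hq' (Ne.symm e)
    have hm : g q ∈ g.support := Equiv.Perm.apply_mem_support.2 hq
    exact Reachable.trans (Adj.reachable ⟨(h.1 q (Equiv.Perm.mem_support.1 hq)).1, hq, hm⟩)
      (h1.mono (kp_mono fun v hv => hv.1))

lemma image_swap_mem {S : Finset V} {p q : V} (hq : q ∈ S) (hp : p ∉ S) :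
    S.image (swap p q) = insert p (S.erase q) := by
  ext v
  have : v ∈ S.image (swap p q) ↔ swap p q v ∈ S := by
    conv_lhs => rw [← swap_apply_self p q v]
    exact mem_image_perm
  rw [this]
  by_cases h1 : v = p
  · subst h1; simp [hq]
  · by_cases h2 : v = q
    · subst h2; simp [hp, h1]
    · simp [swap_apply_of_ne_of_ne h1 h2, h1, h2]

lemma ULs_walk {D : Set V} {s t : V} (w : (kp G D).Walk s t) : ∀ (S : Finset V), s ∈ S → t ∉ S →
    ∃ γ, M G S γ w.length ∧ S.image γ = insert t (S.erase s) ∧ ∀ v, v ∉ D → γ v = v := by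
  induction w with
  | nil => intro S h1 h2; exact absurd h1 h2
  | @cons s s1 t h w ih =>
    intro S h1 h2
    have sw_fix : ∀ v, v ∉ D → swap s1 s v = v := fun v hv =>
      swap_apply_of_ne_of_ne (fun e => hv (e ▸ h.2.2)) (fun e => hv (e ▸ h.2.1))
    have hne : s1 ≠ s := h.1.ne'
    by_cases hs1 : s1 ∈ S
    · obtain ⟨γ, hM, hS, hf⟩ := ih S hs1 h2
      have ht : s1 ≠ t := fun e => h2 (e ▸ hs1)
      have hsS : s ∈ S.image γ := by rw [hS]; simp [h1, hne.symm]
      refine ⟨swap s1 s * γ, hM.trans (M.sw hsS h.1.symm), ?_, fun v hv => ?_⟩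
      · rw [image_mul, image_swap_mem hsS (by rw [hS]; simp [ht]), hS]
        ext v; grind
      · rw [Perm.mul_apply, hf v hv, sw_fix v hv]
    · have hM := M.sw (G := G) h1 h.1.symm
      have hS := image_swap_mem h1 hs1
      by_cases ht : s1 = t
      · subst ht
        exact ⟨swap s1 s, hM.mono (by simp), hS, sw_fix⟩
      · obtain ⟨γ, hM', hS', hf⟩ := ih (S.image (swap s1 s)) (by rw [hS]; simp) (by
          rw [hS]; simp [h2, Ne.symm ht])
        refine ⟨γ * swap s1 s, (hM.trans hM').mono (by simp; omega), ?_, fun v hv => ?_⟩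
        · rw [image_mul, hS', hS]; ext v; grind
        · rw [Perm.mul_apply, sw_fix v hv, hf v hv]

lemma ULs {D : Set V} {s t : V} {S : Finset V} (h : (kp G D).Reachable s t) (hs : s ∈ S) (ht : t ∉ S) :
    ∃ γ, M G S γ (Fintype.card V) ∧ S.image γ = insert t (S.erase s) ∧ ∀ v, v ∉ D → γ v = v := by
  obtain ⟨w, hw⟩ := h.exists_isPath
  obtain ⟨γ, h1, h2⟩ := ULs_walk w S hs ht
  exact ⟨γ, h1.mono hw.length_lt.le, h2⟩

def CSet (G : SimpleGraph V) (D : Finset V) : Prop := ∀ u ∈ D, ∀ v ∈ D, (kp G (D : Set V)).Reachable u v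

lemma fix_out {S : Finset V} {D : Set V} {γ : Perm V} (hf : ∀ v, v ∉ D → γ v = v) {v : V} (hv : v ∉ D) :
    v ∈ S.image γ ↔ v ∈ S := by
  conv_lhs => rw [← hf v hv]
  exact mem_image_perm

lemma fix_in {D : Set V} {γ : Perm V} (hf : ∀ v, v ∉ D → γ v = v) {v : V} (hv : v ∈ D) :
    γ v ∈ D := by
  by_contra h
  have := γ.injective (hf _ h)
  rw [this] at h; exact h hv

lemma card_inter {S D : Finset V} {γ : Perm V} (hf : ∀ v, v ∉ (D : Set V) → γ v = v) :
    (S.image γ ∩ D).card = (S ∩ D).card := by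
  have : S.image γ ∩ D = (S ∩ D).image γ := by
    ext v
    simp only [Finset.mem_inter, Finset.mem_image]
    constructor
    · rintro ⟨⟨w, hw, rfl⟩, hD⟩
      refine ⟨w, ⟨hw, ?_⟩, rfl⟩
      by_contra h
      rw [hf w (by simpa using h)] at hD
      exact h hD
    · rintro ⟨w, ⟨hw, hD⟩, rfl⟩
      exact ⟨⟨w, hw, rfl⟩, by simpa using fix_in hf (v := w) (by simpa using hD)⟩
  rw [this, Finset.card_image_of_injective _ γ.injective]

lemma UL {D B : Finset V} {S : Finset V} (hD : CSet G D) (hB : B ⊆ D) (hc : B.card ≤ (S ∩ D).card) :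
    ∃ γ, M G S γ (B.card * Fintype.card V) ∧ B ⊆ S.image γ ∧ ∀ v, v ∉ (D : Set V) → γ v = v := by
  suffices H : ∀ m (S : Finset V), (B \ S).card = m → B.card ≤ (S ∩ D).card →
      ∃ γ, M G S γ (m * Fintype.card V) ∧ B ⊆ S.image γ ∧ ∀ v, v ∉ (D : Set V) → γ v = v by
    obtain ⟨γ, h1, h2⟩ := H _ S rfl hc
    exact ⟨γ, h1.mono (Nat.mul_le_mul_right _ (Finset.card_le_card Finset.sdiff_subset)), h2⟩
  intro m
  induction m with
  | zero =>
    intro S h0 _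
    exact ⟨1, M.nil _, by simpa [Finset.sdiff_eq_empty_iff_subset] using h0, by simp⟩
  | succ m ih =>
    intro S hm hc
    obtain ⟨t, ht⟩ : (B \ S).Nonempty := Finset.card_pos.1 (by omega)
    obtain ⟨htB, htS⟩ := Finset.mem_sdiff.1 ht
    obtain ⟨s, hs, hsB⟩ : ∃ s ∈ S ∩ D, s ∉ B := by
      by_contra hcon
      push Not at hcon
      have : S ∩ D ⊆ B.erase t := fun x hx => Finset.mem_erase.2
        ⟨fun e => htS (e ▸ (Finset.mem_inter.1 hx).1), hcon x hx⟩
      have := Finset.card_le_card this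
      rw [Finset.card_erase_of_mem htB] at this
      have := Finset.card_pos.2 ⟨t, htB⟩
      omega
    obtain ⟨hsS, hsD⟩ := Finset.mem_inter.1 hs
    obtain ⟨γ, h1, h2, h3⟩ := ULs (hD s hsD t (hB htB)) hsS htS
    obtain ⟨δ, h4, h5, h6⟩ := ih (S.image γ) (by
      have : B \ S.image γ = (B \ S).erase t := by
        rw [h2]; ext v; grind
      rw [this, Finset.card_erase_of_mem ht, hm]; rfl) (by rw [card_inter h3]; exact hc)
    refine ⟨δ * γ, (h1.trans h4).mono (by rw [Nat.succ_mul]; omega), by rwa [image_mul], fun v hv => ?_⟩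
    rw [Perm.mul_apply, h3 v hv, h6 v hv]

lemma Wk {a b : V} (w : G.Walk a b) : ∀ (S : Finset V), w.IsPath → (∀ v ∈ w.support, v ≠ a → v ∈ S) → a ∉ S →
    ∃ γ, M G S γ w.length ∧ γ a = b ∧ (a ≠ b → S.image γ = insert a (S.erase b)) ∧ ∀ v, v ∉ w.support → γ v = v := by
  induction w with
  | nil => intro S _ _ h; exact ⟨1, M.nil _, rfl, fun h => absurd rfl h, by simp⟩
  | @cons a a1 b h w ih =>
    intro S hp hS ha
    rw [Walk.cons_isPath_iff] at hp
    have h1 : a1 ∈ S := hS a1 (by simp) h.ne'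
    have hS1 := image_swap_mem h1 ha
    obtain ⟨γ, hM, hγ, hi, hf⟩ := ih (S.image (swap a a1)) hp.1 (fun v hv hne => by
      have hva : v ≠ a := fun e => hp.2 (e ▸ hv)
      rw [hS1]; simp [hva, hne, hS v (by simp [hv]) hva]) (by rw [hS1]; simp [h.ne'])
    refine ⟨γ * swap a a1, ((M.sw h1 h).trans hM).mono (by simp; omega), by simp [hγ], fun hab => ?_, fun v hv => ?_⟩
    · rw [image_mul]
      by_cases e : a1 = b
      · subst e
        have hγ1 : γ = 1 := by
          ext v
          by_cases hv : v = a1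
          · subst hv; exact hγ
          · refine hf v fun hh => hv ?_
            rw [Walk.nil_iff_support_eq.1 (Walk.isPath_iff_nil.1 hp.1)] at hh
            simpa using hh
        rw [hγ1, hS1]; simp
      · rw [hi e, hS1]; ext v; grind
    · simp only [Walk.support_cons, List.mem_cons, not_or] at hv
      rw [Perm.mul_apply, swap_apply_of_ne_of_ne hv.1 (fun e => hv.2 (by rw [e]; simp)), hf v hv.2]

end P2
end CM

open SimpleGraph
namespace CM
open Equiv Equiv.Perm
set_option linter.unusedSectionVars false
section P3
variable {V : Type} [Fintype V] [DecidableEq V] {G : SimpleGraph V}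

abbrev dl (G : SimpleGraph V) (p : V) : SimpleGraph V := kp G ({p}ᶜ : Set V)

lemma last_step {D : Set V} {v p : V} (h : (kp G D).Reachable v p) (hne : v ≠ p) :
    ∃ u, (kp G D).Adj u p ∧ (kp G (D \ {p})).Reachable v u := by
  obtain ⟨w⟩ := h
  induction w with
  | nil => exact absurd rfl hne
  | @cons v v1 p h w ih =>
    by_cases e : v1 = p
    · subst e; exact ⟨v, h, Reachable.refl _⟩
    · obtain ⟨u, h1, h2⟩ := ih e
      exact ⟨u, h1, Reachable.trans (Adj.reachable ⟨h.1, ⟨h.2.1, hne⟩, h.2.2, e⟩) h2⟩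

lemma kp_univ : kp G Set.univ = G := by ext; simp [kp]

lemma last_step' (hG : G.Connected) {v p : V} (hne : v ≠ p) :
    ∃ u, G.Adj p u ∧ (dl G p).Reachable v u := by
  have h : (kp G Set.univ).Reachable v p := by rw [kp_univ]; exact hG.preconnected v p
  obtain ⟨u, h1, h2⟩ := last_step h hne
  exact ⟨u, h1.1.symm, h2.mono (kp_mono fun x hx => hx.2)⟩

lemma dl_ne {p u v : V} (h : (dl G p).Reachable u v) (hu : u ≠ p) : v ≠ p :=
  kp_mem_right (D := {p}ᶜ) h hu

lemma dl_step {p u v : V} (h : G.Adj u v) (hu : u ≠ p) (hv : v ≠ p) : (dl G p).Reachable u v :=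
  Adj.reachable ⟨h, hu, hv⟩

structure Site (V : Type) where
  X : Finset V
  e : ℕ

def OnCyc (G : SimpleGraph V) (p : V) : Prop := ∃ g, Cyc G g ∧ p ∈ g.support

def Core (G : SimpleGraph V) (c : V) : Prop :=
  ¬ OnCyc G c ∧ ∃ u v w, G.Adj c u ∧ G.Adj c v ∧ G.Adj c w ∧ u ≠ v ∧ u ≠ w ∧ v ≠ w

def Site.Valid (G : SimpleGraph V) (Q : Site V) : Prop :=
  (∃ g, Cyc G g ∧ Q.X = g.support ∧ Q.e = 0) ∨ (∃ c, Core G c ∧ Q.X = {c} ∧ Q.e = 1)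

open Classical in
noncomputable def hc (G : SimpleGraph V) (S : Finset V) (p q : V) : Finset V :=
  S.filter fun v => (dl G p).Reachable q v

lemma mem_hc {S : Finset V} {p q v : V} : v ∈ hc G S p q ↔ v ∈ S ∧ (dl G p).Reachable q v := by
  simp [hc]

def Att (G : SimpleGraph V) (S : Finset V) (p : V) (Q : Site V) : Prop :=
  (p ∉ Q.X ∧ ∃ q ∈ Q.X, G.dist p q + Q.e ≤ (hc G S p q).card) ∨
  (p ∈ Q.X ∧ (Q.e = 0 ∨ ∃ s ∈ S, ∃ s' ∈ S, s ≠ p ∧ s' ≠ p ∧ ¬ (dl G p).Reachable s s'))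

def Lnk (G : SimpleGraph V) (h : ℕ) (Q Q' : Site V) : Prop :=
  ∃ q ∈ Q.X, ∃ q' ∈ Q'.X, G.dist q q' + Q.e + Q'.e ≤ h

lemma core_sep {c u v : V} (h : Core G c) (hu : G.Adj c u) (hv : G.Adj c v) (hne : u ≠ v) :
    ¬ (dl G c).Reachable u v := fun hr => by
  obtain ⟨g, hg, -, -, hc, -⟩ := CYC hu hv hne (D := {c}ᶜ) (by simp) hr
  exact h.1 ⟨g, hg, hc⟩

lemma E_fix {S : Finset V} {δ : Perm V} {d : ℕ} {p v : V} (hE : E G S δ d) (hp : δ p = p)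
    (hv : v ≠ p) : (dl G p).Reachable v (δ v) := by
  by_cases e : δ v = v
  · rw [e]
  · refine dl_step ?_ hv (fun e' => hv (δ.injective (e'.trans hp.symm)))
    cases hE with
    | sw a b hb h =>
      by_cases h1 : v = a
      · subst h1; simpa using h
      · by_cases h2 : v = b
        · subst h2; simpa using h.symm
        · exact absurd (swap_apply_of_ne_of_ne h1 h2) e
    | rot g h => exact (h v e).1

lemma hc_image {S : Finset V} {δ : Perm V} {d : ℕ} {p q : V} (hE : E G S δ d) (hp : δ p = p)
    (hpS : p ∉ S) : (hc G (S.image δ) p q).card = (hc G S p q).card := by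
  have : hc G (S.image δ) p q = (hc G S p q).image δ := by
    ext v
    simp only [mem_hc, Finset.mem_image]
    constructor
    · rintro ⟨⟨w, hw, rfl⟩, h⟩
      exact ⟨w, ⟨hw, h.trans (E_fix hE hp fun e => hpS (e ▸ hw)).symm⟩, rfl⟩
    · rintro ⟨w, ⟨hw, h⟩, rfl⟩
      exact ⟨⟨w, hw, rfl⟩, h.trans (E_fix hE hp fun e => hpS (e ▸ hw))⟩
  rw [this, Finset.card_image_of_injective _ δ.injective]

lemma att_link {S : Finset V} {p : V} {Q : Site V} (hQ : Q.Valid G) (h : Att G S p Q)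
    {g : Perm V} (hg : Cyc G g) (hp : p ∈ g.support) : Lnk G S.card Q ⟨g.support, 0⟩ := by
  rcases h with ⟨-, q, hq, hd⟩ | ⟨hp', -⟩
  · refine ⟨q, hq, p, hp, ?_⟩
    have := Finset.card_le_card (Finset.filter_subset (fun v => v ∈ hc G S p q) S)
    have h2 : (hc G S p q).card ≤ S.card := Finset.card_le_card fun v hv => (mem_hc.1 hv).1
    rw [SimpleGraph.dist_comm]; simpa using hd.trans h2
  · rcases hQ with ⟨g', -, -, he⟩ | ⟨c, hc, hX, -⟩
    · exact ⟨p, hp', p, hp, by simp [he]⟩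
    · rw [hX, Finset.mem_singleton] at hp'
      exact absurd ⟨g, hg, hp' ▸ hp⟩ hc.1

lemma cyc_valid {g : Perm V} (hg : Cyc G g) : Site.Valid G ⟨g.support, 0⟩ := Or.inl ⟨g, hg, rfl, rfl⟩

lemma rot_cyc {g : Perm V} (hg : Rot G g) {p : V} (hp : g p ≠ p) :
    Cyc G (g.cycleOf p) ∧ p ∈ (g.cycleOf p).support ∧ g p ∈ (g.cycleOf p).support := by
  have h0 : p ∈ (g.cycleOf p).support := by
    rw [Equiv.Perm.mem_support, cycleOf_apply_self]; exact hp
  refine ⟨⟨fun v hv => ?_, isCycle_cycleOf g hp⟩, h0, ?_⟩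
  · have h1 : SameCycle g p v := by
      by_contra h; exact hv (cycleOf_apply_of_not_sameCycle h)
    have e1 : g.cycleOf p v = g v := h1.cycleOf_apply
    have h2 : SameCycle g p (g v) := sameCycle_apply_right.2 h1
    rw [e1, h2.cycleOf_apply]
    rw [e1] at hv
    exact hg v hv
  · have := Equiv.Perm.apply_mem_support.2 h0
    rwa [cycleOf_apply_self] at this

lemma bridge (hG : G.Connected) {p p' : V} (h : G.Adj p p')
    (hp : ¬ ∃ g, Cyc G g ∧ p ∈ g.support ∧ p' ∈ g.support) (v : V) :
    (dl G p').Reachable p v ↔ ¬ (dl G p).Reachable p' v := by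
  have Hp : ∀ u, G.Adj p u → (dl G p).Reachable p' u → u = p' := by
    intro u hu hr
    by_contra hne
    obtain ⟨g, hg, -, -, h1, h2, -⟩ := CYC h hu (Ne.symm hne) (D := {p}ᶜ) (by simp) hr
    exact hp ⟨g, hg, h1, h2⟩
  constructor
  · intro hA hB
    have hvp : v ≠ p := dl_ne hB h.ne'
    obtain ⟨u, h1, h2⟩ := last_step hA.symm hvp
    have := Hp u h1.1.symm (hB.trans (h2.mono (kp_mono fun x hx => hx.2)))
    exact h1.2.1 this
  · intro hB
    by_cases hvp : v = p
    · subst hvp; exact Reachable.refl _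
    obtain ⟨u, h1, ⟨w⟩⟩ := last_step' hG hvp
    have hw : ∀ x ∈ w.support, (dl G p).Reachable v x := fun x hx => ⟨w.takeUntil x hx⟩
    have hup : u ≠ p := h1.ne'
    have hu' : ∀ x ∈ w.support, x ≠ p' := fun x hx e => hB (e ▸ (hw x hx)).symm
    have h3 : (dl G p').Reachable v u :=
      walk_kp (w.mapLe kp_le) (by rw [Walk.support_mapLe_eq_support]; exact hu')
    exact ((h3.trans (dl_step h1.symm (hu' u (by simp)) h.ne)).symm)

lemma dist_step (hG : G.Connected) {p p' q : V}
    (Hp : ∀ u, G.Adj p u → (dl G p).Reachable p' u → u = p') (hq : (dl G p).Reachable p' q) (hqp : q ≠ p) :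
    G.dist p' q + 1 ≤ G.dist p q := by
  obtain ⟨w, hw, hl⟩ := hG.exists_path_of_dist p q
  cases w with
  | nil => exact absurd rfl hqp
  | @cons _ u _ h w =>
    rw [Walk.cons_isPath_iff] at hw
    have h3 : (dl G p).Reachable u q :=
      walk_kp w (fun x hx (e : x = p) => hw.2 (e ▸ hx))
    have := Hp u h (hq.trans h3.symm)
    subst this
    rw [← hl, Walk.length_cons]
    exact Nat.add_le_add_right (dist_le w) 1

lemma site_conn {Q : Site V} (hQ : Q.Valid G) {p q q' : V} (hq : q ∈ Q.X) (hq' : q' ∈ Q.X)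
    (h : q ≠ p) (h' : q' ≠ p) : (dl G p).Reachable q q' := by
  rcases hQ with ⟨g, hg, hX, -⟩ | ⟨c, hc, hX, -⟩
  · rw [hX] at hq hq'
    exact (cyc_reach hg hq hq' h h').mono (kp_mono fun v hv => hv.2)
  · rw [hX, Finset.mem_singleton] at hq hq'
    rw [hq, hq']

lemma core_of (hG : G.Connected) {p x y z : V} (hp : ¬ OnCyc G p) (hx : x ≠ p) (hy : y ≠ p) (hz : z ≠ p)
    (h1 : ¬ (dl G p).Reachable x y) (h2 : ¬ (dl G p).Reachable x z) (h3 : ¬ (dl G p).Reachable y z) :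
    Core G p := by
  obtain ⟨u, hu, hxu⟩ := last_step' hG hx
  obtain ⟨v, hv, hyv⟩ := last_step' hG hy
  obtain ⟨w, hw, hzw⟩ := last_step' hG hz
  refine ⟨hp, u, v, w, hu, hv, hw, ?_, ?_, ?_⟩
  · rintro rfl; exact h1 (hxu.trans hyv.symm)
  · rintro rfl; exact h2 (hxu.trans hzw.symm)
  · rintro rfl; exact h3 (hyv.trans hzw.symm)

lemma INV1 (hG : G.Connected) {S : Finset V} {p : V} {δ : Perm V} {d : ℕ} {Q : Site V} (hQ : Q.Valid G)
    (hpS : p ∉ S) (hA : Att G S p Q) (hE : E G S δ d) :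
    ∃ Q', Site.Valid G Q' ∧ Att G (S.image δ) (δ p) Q' ∧ (Q' = Q ∨ Lnk G S.card Q Q') := by
  by_cases hδ : δ p = p
  · refine ⟨Q, hQ, ?_, Or.inl rfl⟩
    rw [hδ]
    rcases hA with ⟨h1, q, hq, h2⟩ | ⟨h1, h2⟩
    · exact Or.inl ⟨h1, q, hq, by rwa [hc_image hE hδ hpS]⟩
    · refine Or.inr ⟨h1, h2.imp_right ?_⟩
      rintro ⟨s, hs, s', hs', hsp, hsp', hr⟩
      have e1 := E_fix hE hδ hsp
      have e2 := E_fix hE hδ hsp'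
      exact ⟨δ s, Finset.mem_image_of_mem _ hs, δ s', Finset.mem_image_of_mem _ hs', dl_ne e1 hsp,
        dl_ne e2 hsp', fun h => hr ((e1.trans h).trans e2.symm)⟩
  cases hE with
  | rot g hg =>
    obtain ⟨h1, h2, h3⟩ := rot_cyc hg hδ
    exact ⟨⟨_, 0⟩, cyc_valid h1, Or.inr ⟨h3, Or.inl rfl⟩, Or.inr (att_link hQ hA h1 h2)⟩
  | sw a p' hb h =>
    have hpp : p ≠ p' := fun e => hpS (e ▸ hb)
    have : p = a := by
      by_contra h1; exact hδ (swap_apply_of_ne_of_ne h1 hpp)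
    subst this
    rw [swap_apply_left]
    rw [image_swap_mem hb hpS]
    by_cases hcyc : ∃ g, Cyc G g ∧ p ∈ g.support ∧ p' ∈ g.support
    · obtain ⟨g, hg, h1, h2⟩ := hcyc
      exact ⟨⟨_, 0⟩, cyc_valid hg, Or.inr ⟨h2, Or.inl rfl⟩, Or.inr (att_link hQ hA hg h1)⟩
    have hbr := bridge hG h hcyc
    have Hp : ∀ u, G.Adj p u → (dl G p).Reachable p' u → u = p' := by
      intro u hu hr
      by_contra hne
      obtain ⟨g, hg, -, -, h1, h2, -⟩ := CYC h hu (Ne.symm hne) (D := {p}ᶜ) (by simp) hr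
      exact hcyc ⟨g, hg, h1, h2⟩
    have hpS' : p ∈ insert p (S.erase p') := by simp
    rcases hA with ⟨hpQ, q, hq, hd⟩ | ⟨hpQ, hA⟩
    · have hqp : q ≠ p := fun e => hpQ (e ▸ hq)
      by_cases hqB : (dl G p).Reachable p' q
      · have hds := dist_step hG Hp hqB hqp
        have hB : ∀ s, s ∈ hc G S p q ↔ s ∈ S ∧ (dl G p).Reachable p' s := fun s => by
          rw [mem_hc]; exact and_congr_right fun _ => ⟨fun h => hqB.trans h, fun h => hqB.symm.trans h⟩
        by_cases hp'Q : p' ∈ Q.X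
        · refine ⟨Q, hQ, Or.inr ⟨hp'Q, ?_⟩, Or.inl rfl⟩
          rcases hQ with ⟨g', -, -, he⟩ | ⟨c, hcc, hX, he⟩
          · exact Or.inl he
          · right
            rw [he] at hd
            obtain ⟨s, hs, hsp⟩ := Finset.exists_mem_ne (s := hc G S p q) (by omega) p'
            rw [hB] at hs
            refine ⟨p, hpS', s, by simp [hs.1, hsp], hpp, hsp, ?_⟩
            rw [hbr]; simpa using hs.2
        · by_cases hall : ∀ s ∈ S, (dl G p).Reachable p' s → s ≠ p' → (dl G p').Reachable q s
          · refine ⟨Q, hQ, Or.inl ⟨hp'Q, q, hq, ?_⟩, Or.inl rfl⟩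
            have hsub : (hc G S p q).erase p' ⊆ hc G (insert p (S.erase p')) p' q := by
              intro s hs
              obtain ⟨h1, h2⟩ := Finset.mem_erase.1 hs
              rw [hB] at h2
              rw [mem_hc]
              exact ⟨by simp [h1, h2.1], hall s h2.1 h2.2 h1⟩
            have h1 := Finset.card_le_card hsub
            have h2 := Finset.pred_card_le_card_erase (s := hc G S p q) (a := p')
            omega
          · push Not at hall
            obtain ⟨s, hs, hsB, hsp, hsq⟩ := hall
            have h2 : (hc G S p q).card ≤ S.card := Finset.card_le_card fun v hv => (mem_hc.1 hv).1
            by_cases hon : OnCyc G p'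
            · obtain ⟨g, hg, hgp⟩ := hon
              refine ⟨⟨g.support, 0⟩, cyc_valid hg, Or.inr ⟨hgp, Or.inl rfl⟩, Or.inr ⟨q, hq, p', hgp, ?_⟩⟩
              rw [SimpleGraph.dist_comm]; simp only; omega
            · have hqp' : q ≠ p' := fun e => hp'Q (e ▸ hq)
              have r1 : ¬ (dl G p').Reachable p q := by rw [hbr]; simpa using hqB
              have r2 : ¬ (dl G p').Reachable p s := by rw [hbr]; simpa using hsB
              have hco := core_of hG hon hpp hqp' hsp r1 r2 hsq
              refine ⟨⟨{p'}, 1⟩, Or.inr ⟨p', hco, rfl, rfl⟩, Or.inr ⟨by simp, Or.inr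
                ⟨p, hpS', s, by simp [hs, hsp], hpp, hsp, r2⟩⟩, Or.inr ⟨q, hq, p', by simp, ?_⟩⟩
              rw [SimpleGraph.dist_comm]; simp only; omega
      · have hp'Q : p' ∉ Q.X := fun hp'Q => hqB (site_conn hQ hp'Q hq hpp.symm hqp)
        refine ⟨Q, hQ, Or.inl ⟨hp'Q, q, hq, ?_⟩, Or.inl rfl⟩
        have hqA := (hbr q).2 hqB
        have hsub : insert p (hc G S p q) ⊆ hc G (insert p (S.erase p')) p' q := by
          intro s hs
          rw [mem_hc]
          rcases Finset.mem_insert.1 hs with rfl | hs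
          · exact ⟨by simp, hqA.symm⟩
          · rw [mem_hc] at hs
            have hsB : ¬ (dl G p).Reachable p' s := fun hh => hqB (hh.trans hs.2.symm)
            have hsp : s ≠ p' := fun e => hsB (e ▸ Reachable.refl _)
            exact ⟨by simp [hs.1, hsp], hqA.symm.trans ((hbr s).2 hsB)⟩
        have h1 := Finset.card_le_card hsub
        rw [Finset.card_insert_of_notMem (fun hh => hpS (mem_hc.1 hh).1)] at h1
        have h3 : G.dist p' q ≤ G.dist p' p + G.dist p q := hG.dist_triangle
        have h4 : G.dist p' p = 1 := SimpleGraph.dist_eq_one_iff_adj.2 h.symm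
        omega
    · have h4 : G.dist p' p = 1 := SimpleGraph.dist_eq_one_iff_adj.2 h.symm
      have hpm : p ∈ hc G (insert p (S.erase p')) p' p := by rw [mem_hc]; exact ⟨hpS', Reachable.refl _⟩
      have hp'Q : p' ∉ Q.X := by
        intro hh
        rcases hQ with ⟨g, hg, hX, he⟩ | ⟨c, hcc, hX, he⟩
        · exact hcyc ⟨g, hg, hX ▸ hpQ, hX ▸ hh⟩
        · rw [hX, Finset.mem_singleton] at hpQ hh; exact hpp (hpQ.trans hh.symm)
      refine ⟨Q, hQ, Or.inl ⟨hp'Q, p, hpQ, ?_⟩, Or.inl rfl⟩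
      rw [h4]
      rcases hA with he | ⟨s, hs, s', hs', hsp, hsp', hr⟩
      · rw [he]; exact Finset.card_pos.2 ⟨p, hpm⟩
      · have he : Q.e ≤ 1 := by
          rcases hQ with ⟨g, hg, hX, he⟩ | ⟨c, hcc, hX, he⟩ <;> omega
        have key : ∀ s ∈ S, s ≠ p → ¬ (dl G p).Reachable p' s →
            1 + Q.e ≤ (hc G (insert p (S.erase p')) p' p).card := by
          intro s hs hsp hsB
          have hsp' : s ≠ p' := fun e => hsB (e ▸ Reachable.refl _)
          have : s ∈ hc G (insert p (S.erase p')) p' p := by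
            rw [mem_hc]; exact ⟨by simp [hs, hsp'], (hbr s).2 hsB⟩
          have := Finset.one_lt_card.2 ⟨p, hpm, s, this, hsp.symm⟩
          omega
        by_cases h5 : (dl G p).Reachable p' s
        · exact key s' hs' hsp' fun h6 => hr (h5.symm.trans h6)
        · exact key s hs hsp h5

end P3
end CM

open SimpleGraph
namespace CM
open Equiv Equiv.Perm
set_option linter.unusedSectionVars false
section P3b
variable {V : Type} [Fintype V] [DecidableEq V] {G : SimpleGraph V}

open Classical in
noncomputable def fl (P : V → Prop) : Finset V := Finset.univ.filter P

lemma mem_fl {P : V → Prop} {v : V} : v ∈ fl P ↔ P v := by simp [fl]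

def Rigid (G : SimpleGraph V) (S : Finset V) (p : V) : Prop := ∀ Q, Site.Valid G Q → ¬ Att G S p Q

lemma rigid_step (hG : G.Connected) {S : Finset V} {p : V} {δ : Perm V} {d : ℕ} (hpS : p ∉ S)
    (h : Rigid G S p) (hE : E G S δ d) : Rigid G (S.image δ) (δ p) := by
  intro Q hQ hA
  obtain ⟨Q', h1, h2, -⟩ := INV1 hG hQ (by rwa [mem_image_perm]) hA hE.symm
  rw [← image_mul] at h2
  simp at h2
  exact h Q' h1 h2

lemma rigid_cyc {S : Finset V} {p : V} (h : Rigid G S p) : ¬ OnCyc G p := fun ⟨_, hg, hp⟩ =>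
  h _ (cyc_valid hg) (Or.inr ⟨hp, Or.inl rfl⟩)

lemma rigid_two (hG : G.Connected) {S : Finset V} {p s s' x : V} (h : Rigid G S p) (hs : s ∈ S) (hs' : s' ∈ S)
    (hsp : s ≠ p) (hsp' : s' ≠ p) (hr : ¬ (dl G p).Reachable s s') (hx : x ≠ p) :
    (dl G p).Reachable s x ∨ (dl G p).Reachable s' x := by
  by_contra hcon
  push Not at hcon
  have := core_of hG (rigid_cyc h) hsp hsp' hx hr hcon.1 hcon.2
  exact h ⟨{p}, 1⟩ (Or.inr ⟨p, this, rfl, rfl⟩)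
    (Or.inr ⟨by simp, Or.inr ⟨s, hs, s', hs', hsp, hsp', hr⟩⟩)

def Inv (G : SimpleGraph V) (S : Finset V) (p : V) (γ : Perm V) : Prop :=
  (γ p = p → ∀ s ∈ S, ∀ v, v ∉ S → v ≠ p → ((dl G p).Reachable s v ↔ (dl G p).Reachable s (γ v))) ∧
  (γ p ≠ p → ∀ v, v ∉ S → v ≠ p → ((dl G p).Reachable (γ p) v ↔ ¬ (dl G (γ p)).Reachable p (γ v)))

lemma out_sub (hG : G.Connected) {p p' v : V} (hne : p' ≠ p) (hB : ¬ (dl G p).Reachable p' v) :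
    (dl G p').Reachable p v := by
  by_cases hvp : v = p
  · subst hvp; exact Reachable.refl _
  obtain ⟨u, h1, ⟨w⟩⟩ := last_step' hG hvp
  have hw : ∀ x ∈ w.support, (dl G p).Reachable v x := fun x hx => ⟨w.takeUntil x hx⟩
  have hu' : ∀ x ∈ w.support, x ≠ p' := fun x hx e => hB (e ▸ (hw x hx)).symm
  have h3 : (dl G p').Reachable v u :=
    walk_kp (w.mapLe kp_le) (by rw [Walk.support_mapLe_eq_support]; exact hu')
  exact ((h3.trans (dl_step h1.symm (hu' u (by simp)) hne.symm)).symm)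

lemma inv_count {S : Finset V} {p : V} {γ : Perm V} (hpS : p ∉ S)
    (h : Inv G S p γ) (hne : γ p ≠ p) :
    (fl fun x => x ∉ S.image γ ∧ (dl G (γ p)).Reachable p x).card + 1 =
      (fl fun v => v ∉ S ∧ ¬ (dl G p).Reachable (γ p) v).card := by
  have hpm : p ∈ (fl fun v => v ∉ S ∧ ¬ (dl G p).Reachable (γ p) v) := by
    simp only [mem_fl]
    exact ⟨hpS, fun h => dl_ne h hne rfl⟩
  rw [← Finset.card_erase_add_one hpm, ← Finset.card_image_of_injective ((fl _).erase p) γ.injective]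
  congr 2
  ext x
  obtain ⟨v, rfl⟩ := γ.surjective x
  rw [mem_fl, mem_image_perm, mem_image_perm, Finset.mem_erase, mem_fl]
  constructor
  · rintro ⟨h1, h2⟩
    have hvp : v ≠ p := by rintro rfl; exact dl_ne h2 hne.symm rfl
    exact ⟨hvp, h1, fun h3 => ((h.2 hne v h1 hvp).1 h3) h2⟩
  · rintro ⟨h1, h2, h3⟩
    refine ⟨h2, ?_⟩
    by_contra h4
    exact h3 ((h.2 hne v h2 h1).2 h4)

lemma filt_split (T : Finset V) (P : V → Prop) : (fl P).card =
    (fl fun x => x ∉ T ∧ P x).card + (fl fun x => x ∈ T ∧ P x).card := by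
  classical
  rw [← Finset.card_filter_add_card_filter_not (s := fl P) (fun x => x ∉ T)]
  congr 2 <;> (ext x; simp [mem_fl]; try tauto)

lemma holes_A (hG : G.Connected) {S : Finset V} {p : V} {γ : Perm V} (hpS : p ∉ S)
    (h : Inv G S p γ) (hne : γ p ≠ p) {b : V} (hb : (dl G (γ p)).Reachable p b) :
    ∃ s ∈ S.image γ, (dl G (γ p)).Reachable p s ∧ ((dl G p).Reachable (γ p) b → s ≠ b) := by
  have h1 := inv_count hpS h hne
  have h2 := filt_split (S.image γ) (fun x => (dl G (γ p)).Reachable p x)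
  have h3 : (fl fun v => v ∉ S ∧ ¬ (dl G p).Reachable (γ p) v).card ≤
      (fl fun v => ¬ (dl G p).Reachable (γ p) v).card :=
    Finset.card_le_card fun v hv => mem_fl.2 (mem_fl.1 hv).2
  have h4 : (fl fun v => ¬ (dl G p).Reachable (γ p) v) ⊆
      (fl fun x => (dl G (γ p)).Reachable p x) := fun v => by
    simp only [mem_fl]
    exact fun hv => out_sub hG hne hv
  have h4' := Finset.card_le_card h4
  by_cases hbB : (dl G p).Reachable (γ p) b
  · have h5 : (fl fun v => ¬ (dl G p).Reachable (γ p) v) ⊆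
      (fl fun x => (dl G (γ p)).Reachable p x).erase b := fun v hv =>
      Finset.mem_erase.2 ⟨by rintro rfl; simp [hbB, mem_fl] at hv, h4 hv⟩
    have h6 := Finset.card_le_card h5
    have h8 := Finset.card_le_card h4
    rw [Finset.card_erase_of_mem (mem_fl.2 hb : b ∈ fl fun x => (dl G (γ p)).Reachable p x)] at h6
    have h7 : 0 < (fl fun x => (dl G (γ p)).Reachable p x).card :=
      Finset.card_pos.2 ⟨b, mem_fl.2 hb⟩
    obtain ⟨s, hs, hsb⟩ := Finset.exists_mem_ne
      (s := fl fun x => x ∈ S.image γ ∧ (dl G (γ p)).Reachable p x) (by omega) b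
    rw [mem_fl] at hs
    exact ⟨s, hs.1, hs.2, fun _ => hsb⟩
  · obtain ⟨s, hs⟩ := Finset.card_pos (s := fl fun x => x ∈ S.image γ ∧ (dl G (γ p)).Reachable p x).1 (by omega)
    rw [mem_fl] at hs
    exact ⟨s, hs.1, hs.2, fun h => absurd h hbB⟩

lemma hole_comp {S : Finset V} {p : V} {γ : Perm V} (hpS : p ∉ S) (h : Inv G S p γ)
    (he : γ p = p) {x : V} (hx : x ∈ S.image γ) : ∃ s ∈ S, (dl G p).Reachable s x := by
  let U : V → Prop := fun v => ∃ s ∈ S, (dl G p).Reachable s v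
  have hpU : ¬ U p := fun ⟨s, hs, hr⟩ => dl_ne hr (fun e => hpS (e ▸ hs)) rfl
  have h1 := filt_split (S.image γ) U
  have h2 := filt_split S U
  have h3 : (fl fun x => x ∉ S.image γ ∧ U x) =
      (fl fun x => x ∉ S ∧ U x).image γ := by
    ext x
    obtain ⟨v, rfl⟩ := γ.surjective x
    rw [mem_fl, mem_image_perm, mem_image_perm, mem_fl]
    refine and_congr_right fun hv => ?_
    by_cases hvp : v = p
    · subst hvp; rw [he]
    · exact exists_congr fun s => and_congr_right fun hs => (h.1 he s hs v hv hvp).symm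
  rw [h3, Finset.card_image_of_injective _ γ.injective] at h1
  have h4 : fl (fun x => x ∈ S ∧ U x) = S := by
    ext s; rw [mem_fl]; exact ⟨fun h => h.1, fun hs => ⟨hs, s, hs, Reachable.refl _⟩⟩
  have h5 : fl (fun x => x ∈ S.image γ ∧ U x) = S.image γ := by
    refine Finset.eq_of_subset_of_card_le (fun s hs => (mem_fl.1 hs).1) ?_
    rw [Finset.card_image_of_injective _ γ.injective]
    rw [h4] at h2
    omega
  have := h5.symm ▸ hx
  exact (mem_fl.1 this).2

lemma inv_step (hG : G.Connected) {S : Finset V} {p : V} {γ δ : Perm V} {d : ℕ} (hpS : p ∉ S)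
    (hR : Rigid G (S.image γ) (γ p)) (hI : Inv G S p γ) (hE : E G (S.image γ) δ d) :
    Inv G S p (δ * γ) := by
  have hpS' : γ p ∉ S.image γ := by rwa [mem_image_perm]
  have hR' := rigid_step hG hpS' hR hE
  by_cases hδ : δ (γ p) = γ p
  · have hm : ∀ v, v ≠ p → (dl G (γ p)).Reachable (γ v) (δ (γ v)) := fun v hv =>
      E_fix hE hδ fun e => hv (γ.injective e)
    unfold Inv
    simp only [Perm.mul_apply, hδ]
    refine ⟨fun he s hs v hv hvp => ?_, fun he v hv hvp => ?_⟩
    · rw [hI.1 he s hs v hv hvp]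
      have := hm v hvp; rw [he] at this
      exact ⟨fun h => h.trans this, fun h => h.trans this.symm⟩
    · rw [hI.2 he v hv hvp]
      have := hm v hvp
      exact not_congr ⟨fun h => h.trans this, fun h => h.trans this.symm⟩
  cases hE with
  | rot g hg =>
    obtain ⟨h1, h2, h3⟩ := rot_cyc hg hδ
    exact absurd ⟨_, h1, h2⟩ (rigid_cyc hR)
  | sw a r hb h =>
    have hne : γ p ≠ r := fun e => hpS' (e ▸ hb)
    have : γ p = a := by
      by_contra h1; exact hδ (swap_apply_of_ne_of_ne h1 hne)
    subst this
    have hcyc : ¬ ∃ g, Cyc G g ∧ γ p ∈ g.support ∧ r ∈ g.support :=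
      fun ⟨g, hg, h1, _⟩ => rigid_cyc hR ⟨g, hg, h1⟩
    have hbr := bridge hG h hcyc
    have hS' := image_swap_mem hb hpS'
    have hfix : ∀ v, v ∉ S → v ≠ p → swap (γ p) r (γ v) = γ v := fun v hv hvp =>
      swap_apply_of_ne_of_ne (fun e => hvp (γ.injective e))
        (fun e => hv (by rw [← e, mem_image_perm] at hb; exact hb))
    simp only [swap_apply_left] at hR'
    rw [hS'] at hR'
    have hpm : γ p ∈ insert (γ p) ((S.image γ).erase r) := by simp
    unfold Inv
    simp only [Perm.mul_apply, swap_apply_left]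
    by_cases he : γ p = p
    · refine ⟨fun e => absurd (he.trans e.symm) hne, fun _ v hv hvp => ?_⟩
      rw [hfix v hv hvp]
      rw [he] at hbr
      rw [hbr, not_not]
      obtain ⟨s, hs, hr⟩ := hole_comp hpS hI he hb
      have := hI.1 he s hs v hv hvp
      exact ⟨fun h => hr.symm.trans (this.1 (hr.trans h)), fun h => hr.symm.trans (this.2 (hr.trans h))⟩
    have hI2 := hI.2 he
    by_cases hrp : r = p
    · subst hrp
      refine ⟨fun _ s hs v hv hvp => ?_, fun e => absurd rfl e⟩
      rw [hfix v hv hvp]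
      have hsr : s ≠ r := fun e => hpS (e ▸ hs)
      have hbr' : ∀ v, (dl G (γ r)).Reachable r v ↔ ¬ (dl G r).Reachable (γ r) v := fun v => by
        rw [hbr v, not_not]
      have hvB : (dl G r).Reachable (γ r) v ↔ (dl G r).Reachable (γ r) (γ v) := by
        rw [hI2 v hv hvp, hbr', not_not]
      by_cases hsB : (dl G r).Reachable (γ r) s
      · exact ⟨fun h => hsB.symm.trans (hvB.1 (hsB.trans h)), fun h => hsB.symm.trans (hvB.2 (hsB.trans h))⟩
      · classical
        have key : ∃ t ∈ S.image γ, t ≠ r ∧ ¬ (dl G r).Reachable (γ r) t := by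
          have h1 := inv_count hpS hI he
          have h2 := filt_split (S.image γ) (fun x => (dl G (γ r)).Reachable r x)
          have h3 := filt_split S (fun v => ¬ (dl G r).Reachable (γ r) v)
          have h4 : (fl fun x => (dl G (γ r)).Reachable r x) =
            (fl fun v => ¬ (dl G r).Reachable (γ r) v) := by
            ext x; simp [mem_fl, hbr']
          have h5 : 0 < (fl fun v => v ∈ S ∧ ¬ (dl G r).Reachable (γ r) v).card :=
            Finset.card_pos.2 ⟨s, mem_fl.2 ⟨hs, hsB⟩⟩
          rw [h4] at h2
          obtain ⟨t, ht, htr⟩ := Finset.exists_mem_ne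
            (s := fl fun x => x ∈ S.image γ ∧ (dl G (γ r)).Reachable r x) (by omega) r
          rw [mem_fl] at ht
          exact ⟨t, ht.1, htr, (hbr' t).1 ht.2⟩
        obtain ⟨t, ht, htr, htB⟩ := key
        have two : ∀ x, x ≠ r → (dl G r).Reachable (γ r) x ∨ (dl G r).Reachable t x := fun x hx =>
          rigid_two hG hR' hpm (by simp [ht, htr]) he htr htB hx
        have hst : (dl G r).Reachable t s := (two s hsr).resolve_left hsB
        have hiff : ∀ x, x ≠ r → ((dl G r).Reachable s x ↔ ¬ (dl G r).Reachable (γ r) x) := fun x hx =>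
          ⟨fun h1 h2 => hsB (h2.trans h1.symm), fun h1 => hst.symm.trans ((two x hx).resolve_left h1)⟩
        rw [hiff v hvp, hiff (γ v) (fun e => hv (by rw [← e, mem_image_perm] at hb; exact hb)), hvB]
    · refine ⟨fun e => absurd e hrp, fun _ v hv hvp => ?_⟩
      rw [hfix v hv hvp]
      have hBB : (dl G p).Reachable r v ↔ (dl G p).Reachable (γ p) v :=
        ⟨fun h' => (dl_step h he hrp).trans h', fun h' => (dl_step h he hrp).symm.trans h'⟩
      rw [hBB, hI2 v hv hvp]
      apply not_congr
      have hxr : γ v ≠ r := fun e => hv (by rw [← e, mem_image_perm] at hb; exact hb)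
      have hxp : γ v ≠ γ p := fun e => hvp (γ.injective e)
      generalize γ v = x at hxr hxp
      have hrB : (dl G p).Reachable (γ p) r := dl_step h he hrp
      by_cases hrA : (dl G (γ p)).Reachable p r
      · have hpA : (dl G (γ p)).Reachable r p := hrA.symm
        constructor
        · intro hx
          by_contra hx2
          have hxq : ¬ (dl G r).Reachable (γ p) x := by
            rw [hbr, not_not]; exact hpA.trans hx
          have hpq : ¬ (dl G r).Reachable (γ p) p := by rw [hbr, not_not]; exact hpA
          obtain ⟨s, hs, hsA, hsr⟩ := holes_A hG hpS hI he hrA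
          have hsr := hsr hrB
          have hsq : ¬ (dl G r).Reachable (γ p) s := by rw [hbr, not_not]; exact hpA.trans hsA
          have two : ∀ x, x ≠ r → (dl G r).Reachable (γ p) x ∨ (dl G r).Reachable s x := fun x hx =>
            rigid_two hG hR' hpm (by simp [hs, hsr]) hne hsr hsq hx
          exact hx2 (((two p (Ne.symm hrp)).resolve_left hpq).symm.trans ((two x hxr).resolve_left hxq))
        · intro hx
          by_contra hx2
          have : (dl G r).Reachable (γ p) x := by
            rw [hbr]; intro h3; exact hx2 (hrA.trans h3)
          have h4 := this.trans hx.symm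
          rw [hbr] at h4
          exact h4 hpA
      · have hpq : (dl G r).Reachable (γ p) p := by rw [hbr]; exact fun h3 => hrA h3.symm
        obtain ⟨s, hs, hsA, -⟩ := holes_A hG hpS hI he (Reachable.refl p)
        have hsp : s ≠ γ p := fun e => hpS' (e ▸ hs)
        have hrs : ¬ (dl G (γ p)).Reachable r s := fun h3 => hrA (hsA.trans h3.symm)
        have two := rigid_two hG hR hb hs hne.symm hsp hrs hxp
        constructor
        · intro hx
          refine hpq.symm.trans ?_
          rw [hbr]; exact fun h3 => hrA (hx.trans h3.symm)
        · intro hx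
          have := hpq.trans hx
          rw [hbr] at this
          exact hsA.trans (two.resolve_left this)

lemma INV2 (hG : G.Connected) {S : Finset V} {p : V} {γ : Perm V} {c : ℕ} (hpS : p ∉ S)
    (hR : Rigid G S p) (hM : M G S γ c) (hS : S.image γ = S) : γ p = p := by
  have key : Rigid G (S.image γ) (γ p) ∧ Inv G S p γ := by
    clear hS
    induction hM with
    | nil c => refine ⟨by simpa using hR, ?_, ?_⟩ <;> simp
    | @cons γ δ c d h1 h2 ih =>
      have hpS' : γ p ∉ S.image γ := by rwa [mem_image_perm]
      refine ⟨?_, inv_step hG hpS ih.1 ih.2 h2⟩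
      rw [image_mul]; exact rigid_step hG hpS' ih.1 h2
  by_contra hne
  classical
  have h1 := inv_count hpS key.2 hne
  rw [hS] at h1
  have h2 : (fl fun v => v ∉ S ∧ ¬ (dl G p).Reachable (γ p) v).card ≤
    (fl fun x => x ∉ S ∧ (dl G (γ p)).Reachable p x).card := by
    apply Finset.card_le_card
    intro v
    simp only [mem_fl]
    exact fun hv => ⟨hv.1, out_sub hG hne hv.2⟩
  omega

end P3b
end CM

open SimpleGraph
namespace CM
open Equiv Equiv.Perm
set_option linter.unusedSectionVars false
section P4a
variable {V : Type} [Fintype V] [DecidableEq V] {G : SimpleGraph V}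

lemma CSet.dl {Z : Finset V} (hZ : CSet G Z) {p x y : V} (hp : p ∉ Z) (hx : x ∈ Z) (hy : y ∈ Z) :
    (dl G p).Reachable x y :=
  (hZ x hx y hy).mono (kp_mono fun v hv (e : v = p) => hp (e ▸ hv))

lemma hc_full {Z : Finset V} (hZ : CSet G Z) {p z q : V} (hp : p ∉ Z) (hz : z ∈ Z)
    (h : (dl G p).Reachable q z) : hc G Z p q = Z := by
  ext v; rw [mem_hc]
  exact ⟨fun h => h.1, fun hv => ⟨hv, h.trans (hZ.dl hp hz hv)⟩⟩

lemma att_of {Z : Finset V} (hZ : CSet G Z) {p z q : V} {Q : Site V} (hQ : Q.Valid G) (hp : p ∉ Z) (hz : z ∈ Z)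
    (hq : q ∈ Q.X) (h1 : q ≠ p → (dl G p).Reachable q z)
    (h2 : Q.e = 1 → q = p → ∀ u, G.Adj q u → (dl G p).Reachable u z)
    (h3 : p ∉ Q.X → G.dist p q + Q.e ≤ Z.card) : Att G Z p Q := by
  by_cases hpQ : p ∈ Q.X
  · right
    refine ⟨hpQ, Or.inl ?_⟩
    rcases hQ with ⟨g, -, -, he⟩ | ⟨c, hc, hX, he⟩
    · exact he
    · exfalso
      rw [hX, Finset.mem_singleton] at hpQ hq
      subst hpQ; subst hq
      have hco := hc
      obtain ⟨-, u, v, w, hu, hv, -, huv, -⟩ := hc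
      exact core_sep hco hu hv huv ((h2 he rfl u hu).trans (h2 he rfl v hv).symm)
  · left
    refine ⟨hpQ, q, hq, ?_⟩
    rw [hc_full hZ hp hz (h1 fun e => hpQ (e ▸ hq))]
    exact h3 hpQ

lemma geo_avoid (hG : G.Connected) {m p z : V} (hne : m ≠ p) (hd : G.dist m z ≤ G.dist p z) :
    (dl G p).Reachable m z := by
  obtain ⟨w, hl⟩ := hG.exists_walk_length_eq_dist m z
  refine walk_kp w fun v hv (e : v = p) => ?_
  subst e
  have h1 := dist_le (w.takeUntil v hv)
  have h2 := dist_le (w.dropUntil v hv)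
  have h3 := congrArg Walk.length (w.take_spec hv)
  rw [Walk.length_append] at h3
  have h4 := hG.pos_dist_of_ne hne
  omega

lemma site_e (hQ : Site.Valid G Q) : Q.e = 0 ∨ Q.e = 1 := by
  rcases hQ with ⟨g, -, -, he⟩ | ⟨c, hc, hX, he⟩
  · exact Or.inl he
  · exact Or.inr he

lemma site_core {Q : Site V} (hQ : Site.Valid G Q) (he : Q.e = 1) {q : V} (hq : q ∈ Q.X) : Core G q ∧ Q = ⟨{q}, 1⟩ := by
  rcases hQ with ⟨g, -, -, he'⟩ | ⟨c, hc, hX, he'⟩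
  · omega
  · rw [hX, Finset.mem_singleton] at hq; subst hq
    refine ⟨hc, ?_⟩
    cases Q; simp_all

lemma dist_in {Z : Finset V} (hZ : CSet G Z) {z c u : V} (hz : z ∈ Z) (hc : c ∈ Z) (hu : u ∈ Z)
    (huc : u ≠ c) (hr : ¬ (dl G c).Reachable z u) : G.dist z c + 2 ≤ Z.card := by
  obtain ⟨w, hw⟩ := (hZ z hz c hc).exists_isPath
  have h1 : ∀ v ∈ w.support, v ∈ Z := walk_supp (D := (Z : Set V)) w hz
  have h2 : u ∉ w.support := by
    intro hus
    apply hr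
    refine walk_kp ((w.takeUntil u hus).mapLe kp_le) fun v hv (e : v = c) => ?_
    rw [Walk.support_mapLe_eq_support] at hv
    subst e
    exact Walk.endpoint_notMem_support_takeUntil hw hus huc.symm hv
  have h3 : w.support.toFinset ⊆ Z.erase u := fun v hv => by
    rw [List.mem_toFinset] at hv
    exact Finset.mem_erase.2 ⟨fun e => h2 (e ▸ hv), h1 v hv⟩
  have h4 := Finset.card_le_card h3
  rw [List.toFinset_card_of_nodup hw.support_nodup, Walk.length_support, Finset.card_erase_of_mem hu] at h4
  have h5 := dist_le (w.mapLe (kp_le (G := G)))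
  rw [Walk.length_mapLe] at h5
  have := Finset.card_pos.2 ⟨z, hz⟩
  omega

lemma dist_in' {Z : Finset V} (hZ : CSet G Z) {z c : V} (hz : z ∈ Z) (hc : c ∈ Z) :
    G.dist z c + 1 ≤ Z.card := by
  obtain ⟨w, hw⟩ := (hZ z hz c hc).exists_isPath
  have h1 : ∀ v ∈ w.support, v ∈ Z := walk_supp (D := (Z : Set V)) w hz
  have h3 : w.support.toFinset ⊆ Z := fun v hv => h1 v (by simpa using hv)
  have h4 := Finset.card_le_card h3
  rw [List.toFinset_card_of_nodup hw.support_nodup, Walk.length_support] at h4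
  have h5 := dist_le (w.mapLe (kp_le (G := G)))
  rw [Walk.length_mapLe] at h5
  omega

lemma exists_bd (hG : G.Connected) {Z : Finset V} {z x : V} (hz : z ∈ Z) (hx : x ∉ Z) :
    ∃ a ∈ Z, ∃ b, b ∉ Z ∧ G.Adj a b := by
  obtain ⟨w⟩ := hG.preconnected z x
  obtain ⟨d, -, h1, h2⟩ := w.exists_boundary_dart (Z : Set V) (by simpa) (by simpa)
  exact ⟨d.fst, by simpa using h1, d.snd, by simpa using h2, d.adj⟩

lemma BL (hG : G.Connected) {Z : Finset V} (hZ : CSet G Z) {z0 x0 : V} (hz0 : z0 ∈ Z) (hx0 : x0 ∉ Z)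
    {Q Q' : Site V} (hQ : Q.Valid G) (hQ' : Q'.Valid G) (hne : Q ≠ Q') (hL : Lnk G Z.card Q Q') :
    ∃ p, p ∉ Z ∧ Att G Z p Q ∧ Att G Z p Q' := by
  obtain ⟨q, hq, q', hq', hd⟩ := hL
  have hcore : ∀ {Q Q' : Site V} {q q' : V}, Q.Valid G → Q'.Valid G → Q ≠ Q' → q ∈ Q.X → q' ∈ Q'.X → Q.e = 1 →
      0 < G.dist q q' := by
    intro Q Q' q q' hQ hQ' hne hq hq' he
    apply hG.pos_dist_of_ne
    rintro rfl
    obtain ⟨h1, h2⟩ := site_core hQ he hq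
    rcases hQ' with ⟨g, hg, hX, -⟩ | ⟨c, hc, hX, he'⟩
    · exact h1.1 ⟨g, hg, hX ▸ hq'⟩
    · rw [hX, Finset.mem_singleton] at hq'
      subst hq'
      apply hne; rw [h2]; cases Q'; simp_all
  obtain ⟨w, hl⟩ := hG.exists_walk_length_eq_dist q q'
  have hwq : ∀ v ∈ w.support, G.dist v q ≤ G.dist q q' ∧ G.dist v q' ≤ G.dist q q' := by
    intro v hv
    have h1 := dist_le (w.takeUntil v hv)
    have h2 := dist_le (w.dropUntil v hv)
    have h3 := congrArg Walk.length (w.take_spec hv)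
    rw [Walk.length_append] at h3
    rw [SimpleGraph.dist_comm]; omega
  let P : V → Prop := fun v => v ∈ w.support ∨ (Q.e = 1 ∧ G.Adj q v) ∨ (Q'.e = 1 ∧ G.Adj q' v)
  have hPq : P q := Or.inl (by simp)
  have hPq' : P q' := Or.inl (by simp)
  have e1 := site_e hQ
  have e2 := site_e hQ'
  by_cases hM : ∃ v, P v ∧ v ∉ Z
  · obtain ⟨v, hv⟩ := hM
    obtain ⟨p, hp, hmax⟩ := Finset.exists_max_image (fl fun v => P v ∧ v ∉ Z) (fun v => G.dist v z0)
      ⟨v, mem_fl.2 hv⟩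
    rw [mem_fl] at hp
    have hr : ∀ m, P m → m ≠ p → (dl G p).Reachable m z0 := by
      intro m hm hmp
      by_cases hmZ : m ∈ Z
      · exact hZ.dl hp.2 hmZ hz0
      · exact geo_avoid hG hmp (hmax m (mem_fl.2 ⟨hm, hmZ⟩))
    refine ⟨p, hp.2, ?_, ?_⟩
    · refine att_of hZ hQ hp.2 hz0 hq (hr q hPq) (fun he hqp u hu => hr u (Or.inr (Or.inl ⟨he, hu⟩)) ?_) ?_
      · rintro rfl; exact hu.ne hqp
      · intro _
        rcases hp.1 with h | ⟨he, h⟩ | ⟨he, h⟩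
        · have := (hwq p h).1; omega
        · have h1 := hcore hQ hQ' hne hq hq' he
          have : G.dist p q = 1 := SimpleGraph.dist_eq_one_iff_adj.2 h.symm
          omega
        · have h1 : G.dist p q' = 1 := SimpleGraph.dist_eq_one_iff_adj.2 h.symm
          have h2 : G.dist p q ≤ G.dist p q' + G.dist q' q := hG.dist_triangle
          rw [G.dist_comm (u := q')] at h2
          omega
    · refine att_of hZ hQ' hp.2 hz0 hq' (hr q' hPq') (fun he hqp u hu => hr u (Or.inr (Or.inr ⟨he, hu⟩)) ?_) ?_
      · rintro rfl; exact hu.ne hqp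
      · intro _
        rcases hp.1 with h | ⟨he, h⟩ | ⟨he, h⟩
        · have := (hwq p h).2; omega
        · have h1 : G.dist p q = 1 := SimpleGraph.dist_eq_one_iff_adj.2 h.symm
          have h2 : G.dist p q' ≤ G.dist p q + G.dist q q' := hG.dist_triangle
          omega
        · have h1 := hcore hQ' hQ hne.symm hq' hq he
          rw [G.dist_comm] at h1
          have : G.dist p q' = 1 := SimpleGraph.dist_eq_one_iff_adj.2 h.symm
          omega
  · push Not at hM
    obtain ⟨z, hz, p, hp, hzp⟩ := exists_bd hG hz0 hx0
    have key : ∀ {Q : Site V} {q : V}, Q.Valid G → q ∈ Q.X → q ∈ Z → (Q.e = 1 → ∀ u, G.Adj q u → u ∈ Z) →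
        Att G Z p Q := by
      intro Q q hQ hq hqZ hn
      refine att_of hZ hQ hp hz hq (fun _ => hZ.dl hp hqZ hz) (fun he hqp u hu => ?_) fun _ => ?_
      · subst hqp; exact absurd hqZ hp
      · have h1 : G.dist p z = 1 := SimpleGraph.dist_eq_one_iff_adj.2 hzp.symm
        have h2 : G.dist p q ≤ G.dist p z + G.dist z q := hG.dist_triangle
        rcases site_e hQ with he | he
        · have := dist_in' hZ hz hqZ; omega
        · have hco := (site_core hQ he hq).1
          obtain ⟨-, u, v, -, hu, hv, -, huv, -⟩ := id hco
          have : ∃ u, G.Adj q u ∧ ¬ (dl G q).Reachable z u := by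
            by_contra hcon
            push Not at hcon
            exact core_sep hco hu hv huv ((hcon u hu).symm.trans (hcon v hv))
          obtain ⟨u, hu, hr⟩ := this
          have := dist_in hZ hz hqZ (hn he u hu) hu.ne' hr
          omega
    exact ⟨p, hp, key hQ hq (hM q hPq) fun he u hu => hM u (Or.inr (Or.inl ⟨he, hu⟩)),
      key hQ' hq' (hM q' hPq') fun he u hu => hM u (Or.inr (Or.inr ⟨he, hu⟩))⟩

def PG (G : SimpleGraph V) (Z : Finset V) (p p' : V) : Prop :=
  p ∉ Z ∧ p' ∉ Z ∧ ∃ Q, Site.Valid G Q ∧ Att G Z p Q ∧ Att G Z p' Q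

lemma PG_reach (hG : G.Connected) {Z : Finset V} (hZ : CSet G Z) {z0 : V} (hz0 : z0 ∈ Z) {γ : Perm V} {c : ℕ}
    (hM : M G Z γ c) (hS : Z.image γ = Z) {p : V} (hp : p ∉ Z) : Relation.ReflTransGen (PG G Z) p (γ p) := by
  by_cases hR : Rigid G Z p
  · rw [INV2 hG hp hR hM hS]
  unfold Rigid at hR
  push Not at hR
  obtain ⟨Q, hQ, hA⟩ := hR
  have key : ∃ Q', Site.Valid G Q' ∧ Att G (Z.image γ) (γ p) Q' ∧
      ∀ y, y ∉ Z → Att G Z y Q' → Relation.ReflTransGen (PG G Z) p y := by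
    clear hS
    induction hM with
    | nil c => exact ⟨Q, hQ, by simpa using hA, fun y hy hyA => .single ⟨hp, hy, Q, hQ, hA, hyA⟩⟩
    | @cons γ δ c d h1 h2 ih =>
      obtain ⟨Q1, h3, h4, h5⟩ := ih
      obtain ⟨Q2, h6, h7, h8⟩ := INV1 hG h3 (by rwa [mem_image_perm]) h4 h2
      rw [Finset.card_image_of_injective _ γ.injective] at h8
      refine ⟨Q2, h6, by rw [image_mul]; exact h7, fun y hy hyA => ?_⟩
      by_cases he : Q2 = Q1
      · rw [he] at hyA; exact h5 y hy hyA
      · obtain ⟨r, hr, hr1, hr2⟩ := BL hG hZ hz0 hp h3 h6 (Ne.symm he) (h8.resolve_left he)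
        exact (h5 r hr hr1).tail ⟨hr, hy, Q2, h6, hr2, hyA⟩
  obtain ⟨Q', h1, h2, h3⟩ := key
  rw [hS] at h2
  exact h3 _ (by have := mem_image_perm (S := Z) (γ := γ) (v := p); rw [hS] at this; rwa [this]) h2

end P4a
end CM

open SimpleGraph
namespace CM
open Equiv Equiv.Perm
set_option linter.unusedSectionVars false
section P4b
variable {V : Type} [Fintype V] [DecidableEq V] {G : SimpleGraph V}

set_option linter.unusedSimpArgs false

lemma aii (g : Perm V) (v : V) : g (g⁻¹ v) = v := by simp

lemma iai (g : Perm V) (v : V) : g⁻¹ (g v) = v := by simp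

def AW (G : SimpleGraph V) (W : Finset V) (π : Perm V) (c : ℕ) : Prop :=
  (∀ w ∈ W, π w = w) ∧ ∀ S, W ⊆ S → M G S π c

lemma sub_image {W S : Finset V} {π : Perm V} (h : ∀ w ∈ W, π w = w) (hS : W ⊆ S) : W ⊆ S.image π :=
  fun w hw => Finset.mem_image.2 ⟨w, hS hw, h w hw⟩

lemma AW.mul {W : Finset V} {π σ : Perm V} {c d : ℕ} (h : AW G W π c) (h' : AW G W σ d) : AW G W (σ * π) (c + d) :=
  ⟨fun w hw => by rw [Perm.mul_apply, h.1 w hw, h'.1 w hw],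
    fun S hS => (h.2 S hS).trans (h'.2 _ (sub_image h.1 hS))⟩

lemma AW.inv {W : Finset V} {π : Perm V} {c : ℕ} (h : AW G W π c) : AW G W π⁻¹ c := by
  have h1 : ∀ w ∈ W, π⁻¹ w = w := fun w hw => by rw [Perm.inv_eq_iff_eq, h.1 w hw]
  refine ⟨h1, fun S hS => (h.2 _ (sub_image h1 hS)).symm' ?_⟩
  rw [← image_mul]; simp

lemma AW.mono {W : Finset V} {π : Perm V} {c d : ℕ} (h : AW G W π c) (hd : c ≤ d) : AW G W π d :=
  ⟨h.1, fun S hS => (h.2 S hS).mono hd⟩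

lemma AW.one {W : Finset V} {c : ℕ} : AW G W 1 c := ⟨fun _ _ => rfl, fun _ _ => M.nil _⟩

lemma AW.pow {W : Finset V} {π : Perm V} {c : ℕ} (h : AW G W π c) (k : ℕ) : AW G W (π ^ k) (k * c) := by
  induction k with
  | zero => exact AW.one
  | succ k ih => rw [pow_succ', Nat.succ_mul]; exact ih.mul h

lemma AW.conj {W : Finset V} {π : Perm V} {x y : V} {c d : ℕ} (h : AW G W π c) (h' : AW G W (swap x y) d) :
    AW G W (swap (π x) (π y)) (2 * c + d) := by
  have := (h.inv.mul h').mul h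
  rw [← mul_assoc, ← swap_apply_apply] at this
  exact this.mono (by omega)

lemma SW {W : Finset V} {g : Perm V} {a t : ℕ} {o : V} (hg : g.IsCycle) (ho : o ∈ g.support) (h1 : AW G W g a)
    (h2 : AW G W (swap o (g o)) t) {x y : V} (hx : x ∈ g.support) (hy : y ∈ g.support) (hxy : x ≠ y) :
    AW G W (swap x y) (4 * g.support.card * (a + t)) := by
  classical
  have hex : ∀ {u v : V}, u ∈ g.support → v ∈ g.support → ∃ i < g.support.card, (g ^ i) u = v := by
    intro u v hu hv
    obtain ⟨i, hi, h⟩ := (hg.sameCycle (Equiv.Perm.mem_support.1 hu) (Equiv.Perm.mem_support.1 hv)).exists_pow_eq'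
    rw [hg.orderOf] at hi
    exact ⟨i, hi, h⟩
  set L := g.support.card
  have key : ∀ z ∈ g.support, z ≠ o → AW G W (swap o z) (2 * L * (a + t)) := by
    intro z hz hzo
    have hE := hex ho hz
    have hE' : ∃ i, (g ^ i) o = z := ⟨_, hE.choose_spec.2⟩
    set i := Nat.find hE' with hi
    have hiz : (g ^ i) o = z := Nat.find_spec hE'
    have hmin : ∀ j < i, (g ^ j) o ≠ z := fun j hj => Nat.find_min hE' hj
    have hiL : i < L := lt_of_le_of_lt (Nat.find_min' hE' hE.choose_spec.2) hE.choose_spec.1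
    have hne : ∀ k, 1 ≤ k → k ≤ i → (g ^ k) o ≠ o := by
      intro k hk hki e
      rcases hki.eq_or_lt with rfl | hlt
      · exact hzo (hiz.symm.trans e)
      · apply hmin (i - k) (by omega)
        rw [← hiz]
        conv_rhs => rw [show i = (i - k) + k by omega, pow_add, Perm.mul_apply, e]
    have hi1 : 1 ≤ i := by
      rcases Nat.eq_zero_or_pos i with h | h
      · rw [h] at hiz; exact absurd hiz.symm hzo
      · exact h
    set δ := swap o (g o) * g with hδ
    have hδo : δ o = o := by simp [hδ]
    have hδk : ∀ k, k + 1 ≤ i → (δ ^ k) (g o) = (g ^ (k+1)) o := by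
      intro k
      induction k with
      | zero => intro _; simp
      | succ k ih =>
        intro hk
        rw [pow_succ', Perm.mul_apply, ih (by omega), hδ, Perm.mul_apply, ← Perm.mul_apply g, ← pow_succ' g]
        apply swap_apply_of_ne_of_ne (hne _ (by omega) (by omega))
        intro e
        apply hne (k+1) (by omega) (by omega)
        rw [pow_succ', Perm.mul_apply] at e
        exact g.injective e
    have h3 : AW G W (δ ^ (i-1)) ((i-1) * (a + t)) := (h1.mul h2).pow _
    have h4 := h3.conj h2
    rw [hδk (i-1) (by omega), Nat.sub_add_cancel hi1, hiz] at h4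
    have h5 : ∀ k, (δ ^ k) o = o := fun k => by
      induction k with
      | zero => rfl
      | succ k ih => rw [pow_succ', Perm.mul_apply, ih, hδo]
    rw [h5] at h4
    refine h4.mono ?_
    obtain ⟨k, hk⟩ : ∃ k, i - 1 = k := ⟨_, rfl⟩
    have : (k + 2) * (a + t) ≤ L * (a + t) := Nat.mul_le_mul_right _ (by omega)
    rw [hk]
    nlinarith
  obtain ⟨k, hk, hkx⟩ := hex ho hx
  have hy' : (g ^ k)⁻¹ y ∈ g.support := by
    rw [← zpow_natCast, ← zpow_neg, zpow_apply_mem_support]; exact hy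
  have hne : (g ^ k)⁻¹ y ≠ o := by
    intro e; rw [Perm.inv_eq_iff_eq, hkx] at e; exact hxy e.symm
  have := (h1.pow k).conj (key _ hy' hne)
  rw [hkx, aii] at this
  refine this.mono ?_
  have : k * a ≤ L * (a + t) := Nat.mul_le_mul hk.le (by omega)
  nlinarith

lemma M.sw' {S : Finset V} {γ : Perm V} {c : ℕ} (h : M G S γ c) {p q : V} (x : V) (hx : x ∈ S) (hq : γ x = q)
    (hpq : G.Adj p q) : M G S (swap p q * γ) (c + 1) :=
  h.trans (M.sw (Finset.mem_image.2 ⟨x, hx, hq⟩) hpq)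

lemma cyc_exch {g : Perm V} (hg : Cyc G g) {o w : V} (ho : o ∈ g.support) (hw : w ∉ g.support) (ha : G.Adj w o) :
    AW G {w} (swap o (g o)) (2 * g.support.card + 3) := by
  have hgw : g w = w := by simpa using hw
  have how : o ≠ w := ha.ne'
  have hgo : g o ≠ o := by simpa using ho
  have hgow : g o ≠ w := fun e => how (g.injective (e.trans hgw.symm))
  have hgi : g⁻¹ w = w := by rw [Perm.inv_eq_iff_eq, hgw]
  refine ⟨fun v hv => ?_, fun S hS => ?_⟩
  · rw [Finset.mem_singleton] at hv; subst hv
    exact swap_apply_of_ne_of_ne how.symm hgow.symm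
  have hwS : w ∈ S := hS (by simp)
  have h1 : M G S (swap o w) 1 := M.sw hwS ha.symm
  have h2 := h1.sw' (p := g o) (q := o) w hwS (by simp) (hg.1 o hgo).1.symm
  have h3 := h2.trans (M.rot hg.1.inv)
  have h4 := h3.sw' (p := w) (q := o) w hwS (by simp) ha
  have h5 := h4.trans (M.rot hg.1)
  have e : g * (swap w o * (g⁻¹ * (swap (g o) o * swap o w))) = swap o (g o) := by
    ext v
    simp only [Perm.mul_apply]
    by_cases h1 : v = o
    · subst h1
      rw [swap_apply_left, swap_apply_of_ne_of_ne hgow.symm how.symm, hgi]; simp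
    by_cases h2 : v = w
    · subst h2
      simp [hgw, swap_apply_of_ne_of_ne how.symm hgow.symm]
    rw [swap_apply_of_ne_of_ne h1 h2]
    by_cases h3 : v = g o
    · subst h3
      rw [swap_apply_left, swap_apply_right, swap_apply_of_ne_of_ne, aii]
      · rw [Ne, Perm.inv_eq_iff_eq, hgw]; exact how
      · rw [Ne, Perm.inv_eq_iff_eq]; exact hgo.symm
    rw [swap_apply_of_ne_of_ne h3 h1, swap_apply_of_ne_of_ne h1 h3, swap_apply_of_ne_of_ne, aii]
    · rw [Ne, Perm.inv_eq_iff_eq, hgw]; exact h2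
    · rw [Ne, Perm.inv_eq_iff_eq]; exact h3
  rw [e, support_inv] at h5
  exact h5.mono (by omega)

lemma star_exch {c l1 l2 l3 : V} (h1 : G.Adj c l1) (h2 : G.Adj c l2) (h3 : G.Adj c l3) (h12 : l1 ≠ l2)
    (h13 : l1 ≠ l3) (h23 : l2 ≠ l3) : AW G {l2, l3} (swap c l1) 7 := by
  have hc1 := h1.ne
  have hc2 := h2.ne
  have hc3 := h3.ne
  refine ⟨fun v hv => ?_, fun S hS => ?_⟩
  · simp only [Finset.mem_insert, Finset.mem_singleton] at hv
    rcases hv with rfl | rfl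
    · exact swap_apply_of_ne_of_ne hc2.symm h12.symm
    · exact swap_apply_of_ne_of_ne hc3.symm h13.symm
  have a2 : l2 ∈ S := hS (by simp)
  have a3 : l3 ∈ S := hS (by simp)
  have m1 : M G S (swap c l2) 1 := M.sw a2 h2
  have m2 := m1.sw' (p := c) (q := l3) l3 a3 (by simp [swap_apply_def, *, Ne.symm hc3, Ne.symm h23]) h3
  have m3 := m2.sw' (p := l1) (q := c) l3 a3 (by simp [swap_apply_def, *, Ne.symm hc3, Ne.symm h23]) h1.symm
  have m4 := m3.sw' (p := c) (q := l3) l2 a2 (by simp [swap_apply_def, *, Ne.symm hc3, Ne.symm h23, Ne.symm h13]) h3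
  have m5 := m4.sw' (p := l2) (q := c) l2 a2 (by simp [swap_apply_def, *, Ne.symm hc3, Ne.symm h23, Ne.symm h13]) h2.symm
  have m6 := m5.sw' (p := c) (q := l1) l3 a3 (by simp [swap_apply_def, *, Ne.symm hc3, Ne.symm h23, Ne.symm h13, Ne.symm hc1, Ne.symm hc2]) h1
  have m7 := m6.sw' (p := l3) (q := c) l3 a3 (by simp [swap_apply_def, *, Ne.symm hc3, Ne.symm h23, Ne.symm h13, Ne.symm hc1, Ne.symm hc2]) h3.symm
  refine (?_ : _ = swap c l1) ▸ m7
  ext v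
  simp only [Perm.mul_apply, swap_apply_def]
  grind

lemma formPerm_split (l1 l2 : List V) (x : V) :
    (l1 ++ x :: l2).formPerm = (l1 ++ [x]).formPerm * (x :: l2).formPerm := by
  induction l1 with
  | nil => simp
  | cons a l ih =>
    cases l with
    | nil => simp [List.formPerm_cons_cons]
    | cons b l =>
      simp only [List.cons_append, List.formPerm_cons_cons] at ih ⊢
      rw [ih, mul_assoc]

lemma formPerm_rev {u w : V} {l : List V} (hn : (u :: w :: l).Nodup) :
    (w :: l).formPerm * (u :: (w :: l).reverse).formPerm = swap u w := by
  have h1 : (u :: (w :: l).reverse) = ((w :: l) ++ [u]).reverse := by simp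
  have h2 : ((w :: l) ++ [u]).formPerm = (u :: w :: l).formPerm := by
    have := List.formPerm_rotate_one (u :: w :: l) hn
    simpa using this
  rw [h1, List.formPerm_reverse, h2, List.formPerm_cons_cons, mul_inv_rev, swap_inv, mul_inv_cancel_left]

lemma theta {u w : V} {A B X : List V} (hn : (u :: A ++ w :: B).Nodup) (hX : (u :: X ++ w :: A.reverse).Nodup)
    (hX' : (u :: X ++ w :: B).Nodup) :
    ∃ o, (u :: A ++ w :: B).formPerm o = u ∧ 
      (u :: X ++ w :: B).formPerm⁻¹ * ((u :: X ++ w :: A.reverse).formPerm * (u :: A ++ w :: B).formPerm) =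
        swap o u := by
  have e1 := formPerm_split (u :: A) B w
  have e2 := formPerm_split (u :: X) B w
  have e3 := formPerm_split (u :: X) A.reverse w
  have huw : u ∉ w :: B := by
    intro h
    have := List.nodup_append.1 hn
    exact this.2.2 u (by simp) u h rfl
  refine ⟨(w :: B).formPerm⁻¹ w, ?_, ?_⟩
  · rw [e1, Perm.mul_apply, aii]
    have := List.formPerm_apply_getLast u (A ++ [w])
    simpa using this
  · have hr := formPerm_rev (u := u) (w := w) (l := A.reverse) (by
      rw [List.cons_append, List.nodup_cons] at hX
      rw [List.nodup_cons]
      refine ⟨fun h => hX.1 (by simp at h ⊢; tauto), ?_⟩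
      exact (List.nodup_append.1 hX.2).2.1)
    have e4 : u :: (w :: A.reverse).reverse = u :: A ++ [w] := by simp
    rw [e4] at hr
    have hu : (w :: B).formPerm⁻¹ u = u := by
      rw [Perm.inv_eq_iff_eq, List.formPerm_apply_of_notMem huw]
    rw [e1, e2, e3, mul_inv_rev]
    calc _ = (w :: B).formPerm⁻¹ * ((w :: A.reverse).formPerm * (u :: A ++ [w]).formPerm) * (w :: B).formPerm := by group
      _ = _ := by
        rw [hr, swap_comm u w]
        have := swap_apply_apply ((w :: B).formPerm⁻¹) w u
        rw [inv_inv, hu] at this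
        exact this.symm

end P4b
end CM

open SimpleGraph
namespace CM
open Equiv Equiv.Perm
set_option linter.unusedSectionVars false
section P4c
variable {V : Type} [Fintype V] [DecidableEq V] {G : SimpleGraph V}

lemma cyc_list {g : Perm V} (hg : Cyc G g) {u : V} (hu : u ∈ g.support) : ∃ l : List V, (u :: l).Nodup ∧
    g = (u :: l).formPerm ∧ (∀ v, v ∈ g.support ↔ v ∈ u :: l) ∧ List.IsChain G.Adj (u :: l ++ [u]) := by
  have h0 := toList_getElem_zero g u hu
  have h1 := formPerm_toList g u
  have h2 := nodup_toList g u
  have h3 : ∀ v, v ∈ g.support ↔ v ∈ toList g u := fun v => by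
    rw [mem_toList_iff]
    exact ⟨fun hv => ⟨hg.2.sameCycle (Equiv.Perm.mem_support.1 hu) (Equiv.Perm.mem_support.1 hv), hu⟩,
      fun h => h.1.mem_support_iff.1 hu⟩
  rw [hg.2.cycleOf_eq (Equiv.Perm.mem_support.1 hu)] at h1
  have h5 : List.IsChain G.Adj (toList g u ++ [u]) := by
    have hl : (toList g u).length = orderOf g := by
      rw [length_toList, hg.2.cycleOf_eq (Equiv.Perm.mem_support.1 hu), hg.2.orderOf]
    have : ∀ i (hi : i < (toList g u ++ [u]).length), (toList g u ++ [u])[i] = (g ^ i) u := by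
      intro i hi
      by_cases h : i < (toList g u).length
      · rw [List.getElem_append_left h, getElem_toList]
      · have e : i = orderOf g := by rw [List.length_append, List.length_singleton] at hi; omega
        subst e
        rw [List.getElem_append_right (by omega), pow_orderOf_eq_one]; simp
    rw [List.isChain_iff_getElem]
    intro i hi
    rw [this, this, pow_succ', Perm.mul_apply]
    apply (hg.1 _ _).1
    rw [← Equiv.Perm.mem_support, pow_apply_mem_support]; exact hu
  cases h : toList g u with
  | nil => rw [toList_eq_nil_iff] at h; exact absurd hu h
  | cons a l =>
    rw [h] at h1 h2 h3 h5
    simp only [h, List.getElem_cons_zero] at h0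
    subst h0
    exact ⟨l, h2, h1.symm, h3, h5⟩

lemma AW.rot {g : Perm V} (hg : Rot G g) : AW G ∅ g (Fintype.card V) :=
  ⟨by simp, fun S _ => (M.rot hg).mono (Finset.card_le_univ _)⟩

lemma RICH {g : Perm V} (hg : Cyc G g) {u w : V} (hu : u ∈ g.support) (hw : w ∈ g.support) (huw : u ≠ w) {X : List V}
    (hX : X.Nodup) (hXg : ∀ x ∈ X, x ∉ g.support) (hch : List.IsChain G.Adj (u :: X ++ [w]))
    (hc : X = [] → w ≠ g u ∧ u ≠ g w) : ∃ o ∈ g.support, AW G ∅ (swap o (g o)) (3 * Fintype.card V) := by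
  obtain ⟨l, hn, he, hs, hl⟩ := cyc_list hg hu
  have hwl : w ∈ l := by
    have := (hs w).1 hw
    simpa [huw.symm] using this
  obtain ⟨A, B, rfl⟩ := List.append_of_mem hwl
  rw [← List.cons_append] at hn he hs hl
  have hX1 : u ∉ X := fun h => hXg u h hu
  have hX2 : w ∉ X := fun h => hXg w h hw
  have hXA : ∀ x ∈ X, x ∉ A := fun x hx h => hXg x hx ((hs x).2 (by simp [h]))
  have hXB : ∀ x ∈ X, x ∉ B := fun x hx h => hXg x hx ((hs x).2 (by simp [h]))
  have hlA : X = [] → A ≠ [] := by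
    rintro hx rfl
    apply (hc hx).1
    rw [he]
    simpa using (List.formPerm_apply_head u w B (by simpa using hn)).symm
  have hlB : X = [] → B ≠ [] := by
    rintro hx rfl
    apply (hc hx).2
    rw [he]
    simpa using (List.formPerm_apply_getLast u (A ++ [w])).symm
  have n1 : (u :: X ++ w :: A.reverse).Nodup := by
    have hn := hn
    simp only [List.cons_append, List.nodup_cons, List.nodup_append, List.mem_append, List.mem_cons, List.mem_reverse, List.nodup_reverse] at hn ⊢
    grind
  have n2 : (u :: X ++ w :: B).Nodup := by
    have hn := hn
    simp only [List.cons_append, List.nodup_cons, List.nodup_append, List.mem_append, List.mem_cons] at hn ⊢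
    grind
  have c0 : List.IsChain G.Adj (u :: A ++ [w]) ∧ List.IsChain G.Adj (w :: (B ++ [u])) := by
    rw [← List.isChain_split]; simpa using hl
  have c1 : List.IsChain G.Adj (u :: (X ++ w :: A.reverse) ++ [u]) := by
    have : List.IsChain G.Adj (u :: X ++ w :: (A.reverse ++ [u])) := by
      rw [List.isChain_split]
      refine ⟨hch, ?_⟩
      have := List.isChain_reverse.2 (show List.IsChain (flip G.Adj) (u :: A ++ [w]) from
        c0.1.imp fun _ _ h => h.symm)
      simp only [List.reverse_append, List.reverse_cons, List.reverse_nil, List.nil_append, List.cons_append] at this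
      exact this
    simpa using this
  have c2 : List.IsChain G.Adj (u :: (X ++ w :: B) ++ [u]) := by
    have : List.IsChain G.Adj (u :: X ++ w :: (B ++ [u])) := by
      rw [List.isChain_split]
      exact ⟨hch, c0.2⟩
    simpa using this
  have r1 := (LC (l := X ++ w :: A.reverse) n1 (by
    rcases X with _ | ⟨x, X⟩
    · rcases A with _ | ⟨x, A⟩
      · exact absurd rfl (hlA rfl)
      · simp
    · simp; omega) c1).1
  have r2 := (LC (l := X ++ w :: B) n2 (by
    rcases X with _ | ⟨x, X⟩
    · rcases B with _ | ⟨x, A⟩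
      · exact absurd rfl (hlB rfl)
      · simp
    · simp; omega) c2).1
  obtain ⟨o, ho, ht⟩ := theta hn n1 n2
  rw [← he] at ho ht
  refine ⟨o, ?_, ?_⟩
  · rw [← Equiv.Perm.apply_mem_support, ho]; exact hu
  · rw [ho, ← ht]
    exact (((AW.rot hg.1).mul (AW.rot r1.1)).mul (AW.rot r2.1).inv).mono (by omega)

lemma rich_swap {g : Perm V} (hg : Cyc G g) (h : ∃ o ∈ g.support, AW G ∅ (swap o (g o)) (3 * Fintype.card V)) {x y : V}
    (hx : x ∈ g.support) (hy : y ∈ g.support) (hxy : x ≠ y) (S : Finset V) : 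
    M G S (swap x y) (16 * (Fintype.card V * g.support.card)) := by
  obtain ⟨o, ho, h⟩ := h
  exact ((SW hg.2 ho (AW.rot hg.1) h hx hy hxy).2 S (by simp)).mono (by nlinarith)

lemma ENT {D : Set V} {K : Finset V} {s a : V} (h : (kp G D).Reachable s a) (hs : s ∉ K) (ha : a ∈ K) :
    ∃ v u, v ∉ K ∧ u ∈ K ∧ (kp G D).Adj v u ∧ (kp G {x | x ∈ D ∧ x ∉ K}).Reachable s v := by
  obtain ⟨w⟩ := h
  induction w with
  | nil => exact absurd ha hs
  | @cons s s1 a h w ih =>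
    by_cases h1 : s1 ∈ K
    · exact ⟨s, s1, hs, h1, h, Reachable.refl _⟩
    · obtain ⟨v, u, h2, h3, h4, h5⟩ := ih h1 ha
      exact ⟨v, u, h2, h3, h4, Reachable.trans (Adj.reachable ⟨h.1, ⟨h.2.1, hs⟩, ⟨h.2.2, h1⟩⟩) h5⟩

def Pure (G : SimpleGraph V) : Prop :=
  ∃ g, Cyc G g ∧ g.support = Finset.univ ∧ ∀ u v, G.Adj u v → v = g u ∨ u = g v

lemma cyc_cset {g : Perm V} (hg : Cyc G g) : CSet G g.support := fun _ hu _ hv => cyc_conn hg hu hv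

lemma M.conj' {S : Finset V} {γ : Perm V} {a b : V} {c d e : ℕ} (h : M G S γ c) (ha : a ∉ S) (hb : b ∉ S)
    (h' : M G (S.image γ) (swap (γ a) (γ b)) d) (he : 2 * c + d ≤ e) : M G S (swap a b) e := (h.conj ha hb h').mono he

lemma XO (hG : G.Connected) (hP : ¬ Pure G) {g : Perm V} (hg : Cyc G g) {S : Finset V} (hS : S.Nonempty) {a b : V}
    (ha : a ∈ g.support) (hb : b ∈ g.support) (haS : a ∉ S) (hbS : b ∉ S) (hab : a ≠ b) :
    M G S (swap a b) (40 * (Fintype.card V * g.support.card)) := by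
  have hL : g.support.card ≤ Fintype.card V := Finset.card_le_univ _
  have hL0 : 1 ≤ g.support.card := Finset.card_pos.2 ⟨a, ha⟩
  by_cases hu : g.support = Finset.univ
  · have : ∃ u v, G.Adj u v ∧ v ≠ g u ∧ u ≠ g v := by
      by_contra hcon
      push Not at hcon
      exact hP ⟨g, hg, hu, fun u v h => or_iff_not_imp_left.2 (hcon u v h)⟩
    obtain ⟨u, v, h1, h2, h3⟩ := this
    refine (rich_swap hg (RICH hg (u := u) (w := v) (by simp [hu]) (by simp [hu]) h1.ne (X := []) (by simp) (by simp)
      (by simpa using h1) fun _ => ⟨h2, h3⟩) ha hb hab S).mono (by omega)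
  have fin : ∀ (γ : Perm V) (w o : V), M G S γ (Fintype.card V + 1) → w ∈ S.image γ → w ∉ g.support → o ∈ g.support →
      G.Adj w o → γ a ∈ g.support → γ b ∈ g.support → M G S (swap a b) (40 * (Fintype.card V * g.support.card)) := by
    intro γ w o h1 h2 h3 h4 h5 h6 h7
    have hA : AW G {w} g g.support.card :=
      ⟨fun v hv => by rw [Finset.mem_singleton] at hv; subst hv; simpa using h3, fun S _ => M.rot hg.1⟩
    have := SW hg.2 h4 hA (cyc_exch hg h4 h3 h5) h6 h7 (fun e => hab (γ.injective e))
    exact h1.conj' haS hbS (this.2 _ (by simpa using h2)) (by nlinarith)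
  by_cases hs : ∃ s ∈ S, s ∉ g.support
  · obtain ⟨s, hs, hsg⟩ := hs
    have hr : (kp G Set.univ).Reachable s a := by rw [kp_univ]; exact hG.preconnected s a
    obtain ⟨v, u, h1, h2, h3, h4⟩ := ENT hr hsg ha
    by_cases hv : v ∈ S
    · exact fin 1 v u (M.nil _) (by simpa) h1 h2 h3.1 ha hb
    · obtain ⟨γ, h5, h6, h7⟩ := ULs h4 hs hv
      refine fin γ v u (h5.mono (by omega)) (by rw [h6]; simp) h1 h2 h3.1 ?_ ?_
      · rw [h7]; exact ha
        simp only [Set.mem_ofPred_eq, not_and, not_not]; intro _; exact ha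
      · rw [h7]; exact hb
        simp only [Set.mem_ofPred_eq, not_and, not_not]; intro _; exact hb
  · push Not at hs
    obtain ⟨x, hx⟩ : ∃ x, x ∉ g.support := by
      by_contra hcon; push Not at hcon; exact hu (Finset.eq_univ_iff_forall.2 hcon)
    obtain ⟨o, ho, w, hw, how⟩ := exists_bd hG ha hx
    obtain ⟨γ, h1, h2, h3⟩ := UL (S := S) (cyc_cset hg) (B := {o}) (by simpa using ho) (by
      rw [Finset.inter_eq_left.2 hs, Finset.card_singleton]; exact Finset.card_pos.2 hS)
    have ho' : o ∈ S.image γ := h2 (by simp)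
    have hne : ∀ c, c ∉ S → γ c ≠ o := fun c hc e => hc (by rw [← e, mem_image_perm] at ho'; exact ho')
    have hin : ∀ c ∈ g.support, c ∉ S → (swap w o * γ) c ∈ g.support := fun c hc hcS => by
      have hcg : γ c ∈ g.support := fix_in (D := (g.support : Set V)) h3 hc
      have hcw : γ c ≠ w := fun e => hw (e ▸ hcg)
      rw [Perm.mul_apply, swap_apply_of_ne_of_ne hcw (hne c hcS)]; exact hcg
    have h4 := h1.trans (M.sw ho' how.symm)
    refine fin _ w o (h4.mono (by simp)) ?_ hw ho how.symm (hin a ha haS) (hin b hb hbS)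
    rw [image_mul]
    exact Finset.mem_image.2 ⟨o, ho', by simp⟩

def star (c l1 l2 l3 : V) : Finset V := {c, l1, l2, l3}

lemma star_cset {c l1 l2 l3 : V} (h1 : G.Adj c l1) (h2 : G.Adj c l2) (h3 : G.Adj c l3) : CSet G (star c l1 l2 l3) := by
  have key : ∀ u ∈ star c l1 l2 l3, (kp G (star c l1 l2 l3 : Set V)).Reachable c u := by
    intro u hu
    by_cases e : u = c
    · rw [e]
    · refine Adj.reachable ⟨?_, by simp [star], by simpa using hu⟩
      simp [star] at hu; rcases hu with rfl | rfl | rfl | rfl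
      · exact absurd rfl e
      all_goals assumption
  exact fun u hu v hv => (key u hu).symm.trans (key v hv)

lemma XS {c l1 l2 l3 : V} (h1 : G.Adj c l1) (h2 : G.Adj c l2) (h3 : G.Adj c l3) (h12 : l1 ≠ l2)
    (h13 : l1 ≠ l3) (h23 : l2 ≠ l3) {S : Finset V} {a b : V} (hS : 2 ≤ (S ∩ star c l1 l2 l3).card)
    (ha : a ∈ star c l1 l2 l3) (hb : b ∈ star c l1 l2 l3) (haS : a ∉ S) (hbS : b ∉ S) (hab : a ≠ b) :
    M G S (swap a b) (11 * Fintype.card V) := by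
  have hn : 1 ≤ Fintype.card V := Fintype.card_pos_iff.2 ⟨a⟩
  obtain ⟨γ, m1, m2, m3⟩ := UL (S := S) (star_cset h1 h2 h3) (B := {l2, l3}) (by intro x; simp [star]; tauto) (by
    rw [Finset.card_pair h23]; exact hS)
  have ex := (star_exch h1 h2 h3 h12 h13 h23).2 _ m2
  have hin : ∀ x ∈ star c l1 l2 l3, x ∉ S → γ x = c ∨ γ x = l1 := by
    intro x hx hxS
    have hcg : γ x ∈ star c l1 l2 l3 := fix_in (D := (star c l1 l2 l3 : Set V)) m3 hx
    have : γ x ∉ S.image γ := by rwa [mem_image_perm]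
    have q2 : γ x ≠ l2 := fun e => this (e ▸ m2 (by simp))
    have q3 : γ x ≠ l3 := fun e => this (e ▸ m2 (by simp))
    simp [star] at hcg
    tauto
  have hne : γ a ≠ γ b := fun e => hab (γ.injective e)
  rw [Finset.card_pair h23] at m1
  refine m1.conj' (d := 7) haS hbS ?_ (by omega)
  rcases hin a ha haS with e1 | e1 <;> rcases hin b hb hbS with e2 | e2
  · exact absurd (e1.trans e2.symm) hne
  · rw [e1, e2]; exact ex
  · rw [e1, e2, swap_comm]; exact ex
  · exact absurd (e1.trans e2.symm) hne

end P4c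
end CM

open SimpleGraph
namespace CM
open Equiv Equiv.Perm
set_option linter.unusedSectionVars false
section P4d
variable {V : Type} [Fintype V] [DecidableEq V] {G : SimpleGraph V}

structure Gad (G : SimpleGraph V) (K : Finset V) (ρ : ℕ) : Prop where
  conn : CSet G K
  ent : ∀ {S : Finset V} {a u v : V}, (S ∩ K).card = ρ → a ∈ K → a ∉ S → u ∈ K → v ∈ S → v ∉ K → G.Adj u v →
    ∃ γ, M G S γ (20 * Fintype.card V) ∧ γ a ∈ K ∧ S.image γ \ K = (S \ K).erase v ∧ ∀ x, x ∉ K → x ≠ v → γ x = x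

lemma nem {K : Finset V} {x u : V} (hx : x ∉ K) (hu : u ∈ K) : x ≠ u := fun e => hx (e ▸ hu)

lemma notin_image {S : Finset V} {γ : Perm V} {a : V} (ha : a ∉ S) : γ a ∉ S.image γ := by
  rwa [mem_image_perm]

lemma gad_cyc {g : Perm V} (hg : Cyc G g) : Gad G g.support 0 := by
  refine ⟨cyc_cset hg, ?_⟩
  intro S a u v hS ha haS hu hv hvK hadj
  have hdis : ∀ x ∈ g.support, x ∉ S := fun x hx hxS => by
    rw [Finset.card_eq_zero] at hS
    have : x ∈ S ∩ g.support := Finset.mem_inter.2 ⟨hxS, hx⟩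
    rw [hS] at this; simp at this
  have fin : ∀ γ : Perm V, M G S γ (Fintype.card V) → S.image γ = S → γ a ∈ g.support → γ a ≠ u → (∀ x, x ∉ g.support → γ x = x) →
      ∃ γ, M G S γ (20 * Fintype.card V) ∧ γ a ∈ g.support ∧ S.image γ \ g.support = (S \ g.support).erase v ∧
        ∀ x, x ∉ g.support → x ≠ v → γ x = x := by
    intro γ h1 h2 h3 h4 h5
    have hn : 1 ≤ Fintype.card V := Fintype.card_pos_iff.2 ⟨a⟩
    refine ⟨swap u v * γ, (h1.trans (M.sw (by rwa [h2]) hadj)).mono (by omega), ?_, ?_, ?_⟩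
    · have : γ a ≠ v := fun e => hvK (e ▸ h3)
      rw [Perm.mul_apply, swap_apply_of_ne_of_ne h4 this]; exact h3
    · rw [image_mul, h2, image_swap_mem hv (hdis u hu)]
      ext x; simp only [Finset.mem_sdiff, Finset.mem_insert, Finset.mem_erase]
      constructor
      · rintro ⟨rfl | h, h'⟩
        · exact absurd hu h'
        · tauto
      · tauto
    · intro x hx hxv
      rw [Perm.mul_apply, h5 x hx, swap_apply_of_ne_of_ne (nem hx hu) hxv]
  by_cases hau : a = u
  · subst hau
    refine fin g ((M.rot hg.1).mono (Finset.card_le_univ _)) ?_ (Equiv.Perm.apply_mem_support.2 ha) (Equiv.Perm.mem_support.1 ha) (fun x hx => by simpa using hx)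
    conv_rhs => rw [← Finset.image_id (s := S)]
    refine Finset.image_congr fun x hx => ?_
    by_contra hne
    exact hdis x (Equiv.Perm.mem_support.2 hne) hx
  · exact fin 1 (M.nil _) (by simp) ha hau (fun _ _ => rfl)

lemma gad_star {c l1 l2 l3 : V} (h1 : G.Adj c l1) (h2 : G.Adj c l2) (h3 : G.Adj c l3) (h12 : l1 ≠ l2)
    (h13 : l1 ≠ l3) (h23 : l2 ≠ l3) : Gad G (star c l1 l2 l3) 2 := by
  refine ⟨star_cset h1 h2 h3, ?_⟩
  intro S a u v hS ha haS hu hv hvK hadj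
  have hK4 : (star c l1 l2 l3).card = 4 := by
    simp [star, h1.ne, h2.ne, h3.ne, h12, h13, h23]
  obtain ⟨y, hy⟩ : ((star c l1 l2 l3).erase u).Nonempty := by
    rw [← Finset.card_pos, Finset.card_erase_of_mem hu, hK4]; omega
  have hcard : (((star c l1 l2 l3).erase u).erase y).card = 2 := by
    rw [Finset.card_erase_of_mem hy, Finset.card_erase_of_mem hu, hK4]
  rw [Finset.mem_erase] at hy
  have hXS := @XS V _ _ G c l1 l2 l3 h1 h2 h3 h12 h13 h23
  have hKc := star_cset h1 h2 h3
  set K := star c l1 l2 l3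
  obtain ⟨γ, m1, m2, m3⟩ := UL (S := S) hKc (B := (K.erase u).erase y)
    (fun x hx => Finset.mem_of_mem_erase (Finset.mem_of_mem_erase hx)) (by rw [hcard, hS])
  have hci := card_inter (S := S) m3
  rw [hcard] at m1
  have hBeq : S.image γ ∩ K = (K.erase u).erase y := by
    symm
    apply Finset.eq_of_subset_of_card_le
    · intro x hx
      exact Finset.mem_inter.2 ⟨m2 hx, Finset.mem_of_mem_erase (Finset.mem_of_mem_erase hx)⟩
    · rw [hci, hS, hcard]
  have huS : u ∉ S.image γ := fun h => by
    have : u ∈ S.image γ ∩ K := Finset.mem_inter.2 ⟨h, hu⟩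
    rw [hBeq] at this; simp at this
  have hyS : y ∉ S.image γ := fun h => by
    have : y ∈ S.image γ ∩ K := Finset.mem_inter.2 ⟨h, hy.2⟩
    rw [hBeq] at this; simp at this
  have hvS : v ∈ S.image γ := (fix_out m3 (by simpa using hvK)).2 hv
  have haK : γ a ∈ K := fix_in (D := (K : Set V)) m3 ha
  have haS' : γ a ∉ S.image γ := notin_image haS
  have hor : γ a = u ∨ γ a = y := by
    by_contra hcon
    push Not at hcon
    exact haS' (m2 (Finset.mem_erase.2 ⟨hcon.2, Finset.mem_erase.2 ⟨hcon.1, haK⟩⟩))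
  have fin : ∀ γ' : Perm V, M G S γ' (13 * Fintype.card V) → S.image γ' = S.image γ → γ' a = y → (∀ x, x ∉ K → γ' x = x) →
      ∃ γ, M G S γ (20 * Fintype.card V) ∧ γ a ∈ K ∧ S.image γ \ K = (S \ K).erase v ∧
        ∀ x, x ∉ K → x ≠ v → γ x = x := by
    intro γ' n1 n2 n3 n4
    have hn : 1 ≤ Fintype.card V := Fintype.card_pos_iff.2 ⟨a⟩
    refine ⟨swap u v * γ', (n1.trans (M.sw (by rwa [n2]) hadj)).mono (by omega), ?_, ?_, ?_⟩
    · rw [Perm.mul_apply, n3, swap_apply_of_ne_of_ne hy.1 (nem hvK hy.2).symm]; exact hy.2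
    · rw [image_mul, n2, image_swap_mem hvS huS]
      ext x; simp only [Finset.mem_sdiff, Finset.mem_insert, Finset.mem_erase]
      constructor
      · rintro ⟨rfl | h, h'⟩
        · exact absurd hu h'
        · exact ⟨h.1, (fix_out m3 (by simpa using h')).1 h.2, h'⟩
      · rintro ⟨p1, p2, p3⟩
        exact ⟨Or.inr ⟨p1, (fix_out m3 (by simpa using p3)).2 p2⟩, p3⟩
    · intro x hx hxv
      rw [Perm.mul_apply, n4 x hx, swap_apply_of_ne_of_ne (nem hx hu) hxv]
  rcases hor with e | e
  · have := hXS (S := S.image γ) (a := u) (b := y) (by rw [hci, hS]) hu hy.2 huS hyS (Ne.symm hy.1)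
    refine fin _ ((m1.trans this).mono (by omega)) ?_ ?_ ?_
    · rw [image_mul, image_swap_notMem huS hyS]
    · rw [Perm.mul_apply, e, swap_apply_left]
    · intro x hx
      rw [Perm.mul_apply, m3 x (by simpa using hx), swap_apply_of_ne_of_ne (nem hx hu) (nem hx hy.2)]
  · exact fin γ (m1.mono (by omega)) rfl e (fun x hx => m3 x (by simpa using hx))

lemma gad_E {K D S : Finset V} {ρ : ℕ} (hK : Gad G K ρ) (hD : CSet G D) (hKD : K ⊆ D) (hS : (S ∩ K).card = ρ) {a s : V}
    (ha : a ∈ K) (haS : a ∉ S) (hs : s ∈ S) (hsD : s ∈ D) (hsK : s ∉ K) :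
    ∃ γ, M G S γ (21 * Fintype.card V) ∧ γ a ∈ K ∧ S.image γ \ K = (S \ K).erase s ∧ ∀ x, x ∉ D → γ x = x := by
  obtain ⟨v, u, hv, hu, hvu, hr⟩ := ENT (hD s hsD a (hKD ha)) hsK ha
  have hvD : v ∈ D := by simpa using hvu.2.1
  by_cases hvs : v = s
  · subst hvs
    obtain ⟨γ, h1, h2, h3, h4⟩ := hK.ent hS ha haS hu hs hv hvu.1.symm
    exact ⟨γ, h1.mono (by omega), h2, h3, fun x hx => h4 x (fun h => hx (hKD h)) (fun e => hx (e ▸ hvD))⟩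
  by_cases hvS : v ∈ S
  · obtain ⟨γ, h1, h2, h3, h4⟩ := hK.ent hS ha haS hu hvS hv hvu.1.symm
    have mem : ∀ x, x ∉ K → (x ∈ S.image γ ↔ x ∈ S ∧ x ≠ v) := by
      intro x hx
      have := congrArg (x ∈ ·) h3
      simp only [Finset.mem_sdiff, Finset.mem_erase, hx, not_false_eq_true, and_true, eq_iff_iff] at this
      tauto
    obtain ⟨δ, n1, n2, n3⟩ := ULs hr ((mem s hsK).2 ⟨hs, Ne.symm hvs⟩) (fun h => ((mem v hv).1 h).2 rfl)
    refine ⟨δ * γ, (h1.trans n1).mono (by omega), ?_, ?_, ?_⟩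
    · rw [Perm.mul_apply, n3]; exact h2
      rintro ⟨-, h⟩; exact h h2
    · rw [image_mul, n2]
      ext x
      by_cases hx : x ∈ K
      · simp [hx]
      · simp only [Finset.mem_sdiff, Finset.mem_insert, Finset.mem_erase, hx, mem x hx]
        constructor
        · rintro ⟨rfl | h, -⟩ 
          · tauto
          · tauto
        · rintro ⟨p1, p2, -⟩; tauto
    · intro x hx
      rw [Perm.mul_apply, h4 x (fun h => hx (hKD h)) (fun e => hx (e ▸ hvD)), n3]
      rintro ⟨h, -⟩; exact hx h
  · obtain ⟨δ, n1, n2, n3⟩ := ULs hr hs hvS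
    have hfK : ∀ x ∈ K, δ x = x := fun x hx => n3 x (by rintro ⟨-, h⟩; exact h hx)
    have hmK : ∀ x ∈ K, (x ∈ S.image δ ↔ x ∈ S) := fun x hx => by
      conv_lhs => rw [← hfK x hx]
      exact mem_image_perm
    have e1 : S.image δ ∩ K = S ∩ K := by
      ext x; simp only [Finset.mem_inter]
      constructor
      · rintro ⟨p, q⟩; exact ⟨(hmK x q).1 p, q⟩
      · rintro ⟨p, q⟩; exact ⟨(hmK x q).2 p, q⟩
    obtain ⟨γ, h1, h2, h3, h4⟩ := hK.ent (S := S.image δ) (by rw [e1, hS]) ha (fun h => haS ((hmK a ha).1 h)) hu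
      (by rw [n2]; simp) hv hvu.1.symm
    refine ⟨γ * δ, (n1.trans h1).mono (by omega), ?_, ?_, ?_⟩
    · rw [Perm.mul_apply, hfK a ha]; exact h2
    · rw [image_mul, h3, n2]
      ext x
      simp only [Finset.mem_sdiff, Finset.mem_insert, Finset.mem_erase]
      constructor
      · tauto
      · rintro ⟨p1, p2, p3⟩
        exact ⟨fun e => hvS (e ▸ p2), Or.inr ⟨p1, p2⟩, p3⟩
    · intro x hx
      rw [Perm.mul_apply, n3 x (by rintro ⟨h, -⟩; exact hx h)]
      exact h4 x (fun h => hx (hKD h)) (fun e => hx (e ▸ hvD))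

lemma gad_XX {K S : Finset V} (hK : CSet G K) (hS : 1 ≤ (S ∩ K).card) {a u v : V}
    (ha : a ∈ K) (haS : a ∉ S) (hu : u ∈ K) (hv : v ∉ K) (hvS : v ∉ S) (hadj : G.Adj v u) :
    ∃ γ, M G S γ (Fintype.card V + 1) ∧ γ a ∈ K ∧ S.image γ \ K = insert v (S \ K) ∧ ∀ x, x ∉ K → x ≠ v → γ x = x := by
  obtain ⟨γ, m1, m2, m3⟩ := UL (S := S) hK (B := {u}) (by simpa) (by simpa using hS)
  have huS : u ∈ S.image γ := m2 (by simp)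
  have hvS' : v ∉ S.image γ := fun h => hvS ((fix_out m3 (by simpa using hv)).1 h)
  have haK : γ a ∈ K := fix_in (D := (K : Set V)) m3 ha
  refine ⟨swap v u * γ, (m1.trans (M.sw huS hadj)).mono (by simp), ?_, ?_, ?_⟩
  · have e1 : γ a ≠ v := fun e => hv (e ▸ haK)
    have e2 : γ a ≠ u := fun e => notin_image haS (e ▸ huS)
    rw [Perm.mul_apply, swap_apply_of_ne_of_ne e1 e2]; exact haK
  · rw [image_mul, image_swap_mem huS hvS']
    ext x
    by_cases hx : x ∈ K
    · simp only [Finset.mem_sdiff, Finset.mem_insert, hx, not_true, and_false, or_false, false_iff]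
      rintro rfl; exact hv hx
    · have := fix_out (S := S) m3 (v := x) (by simpa using hx)
      have hxu : x ≠ u := fun e => hx (e ▸ hu)
      simp only [Finset.mem_sdiff, Finset.mem_insert, Finset.mem_erase, this]
      tauto
  · intro x hx hxv
    rw [Perm.mul_apply, m3 x (by simpa using hx), swap_apply_of_ne_of_ne hxv (fun e => hx (e ▸ hu))]

lemma gad_X {K D S : Finset V} (hK : CSet G K) (hD : CSet G D) (hKD : K ⊆ D) (hS : 1 ≤ (S ∩ K).card) {a t : V}
    (ha : a ∈ K) (haS : a ∉ S) (ht : t ∉ S) (htD : t ∈ D) (htK : t ∉ K) :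
    ∃ γ, M G S γ (3 * Fintype.card V) ∧ γ a ∈ K ∧ S.image γ \ K = insert t (S \ K) ∧ ∀ x, x ∉ D → γ x = x := by
  have hn : 1 ≤ Fintype.card V := Fintype.card_pos_iff.2 ⟨a⟩
  obtain ⟨v, u, hv, hu, hvu, hr⟩ := ENT (hD t htD a (hKD ha)) htK ha
  have hvD : v ∈ D := by simpa using hvu.2.1
  by_cases hvS : v ∈ S
  · obtain ⟨δ, n1, n2, n3⟩ := ULs hr.symm hvS ht
    have hfK : ∀ x ∈ K, δ x = x := fun x hx => n3 x (by rintro ⟨-, h⟩; exact h hx)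
    have hmK : ∀ x ∈ K, (x ∈ S.image δ ↔ x ∈ S) := fun x hx => by
      conv_lhs => rw [← hfK x hx]
      exact mem_image_perm
    have e1 : S.image δ ∩ K = S ∩ K := by
      ext x; simp only [Finset.mem_inter]
      constructor
      · rintro ⟨p, q⟩; exact ⟨(hmK x q).1 p, q⟩
      · rintro ⟨p, q⟩; exact ⟨(hmK x q).2 p, q⟩
    have hvt : v ≠ t := fun e => ht (e ▸ hvS)
    obtain ⟨γ, h1, h2, h3, h4⟩ := gad_XX (S := S.image δ) hK (by rwa [e1]) ha (fun h => haS ((hmK a ha).1 h)) hu hv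
      (by rw [n2]; simp [hvt]) hvu.1
    refine ⟨γ * δ, (n1.trans h1).mono (by omega), ?_, ?_, ?_⟩
    · rw [Perm.mul_apply, hfK a ha]; exact h2
    · rw [image_mul, h3, n2]
      ext x
      simp only [Finset.mem_sdiff, Finset.mem_insert, Finset.mem_erase]
      constructor
      · rintro (rfl | ⟨rfl | h, h'⟩)
        · tauto
        · tauto
        · tauto
      · rintro (rfl | ⟨h, h'⟩)
        · tauto
        · tauto
    · intro x hx
      rw [Perm.mul_apply, n3 x (by rintro ⟨h, -⟩; exact hx h)]
      exact h4 x (fun h => hx (hKD h)) (fun e => hx (e ▸ hvD))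
  · obtain ⟨γ, h1, h2, h3, h4⟩ := gad_XX hK hS ha haS hu hv hvS hvu.1
    by_cases hvt : v = t
    · subst hvt
      exact ⟨γ, h1.mono (by omega), h2, h3, fun x hx => h4 x (fun h => hx (hKD h)) (fun e => hx (e ▸ hvD))⟩
    have mem : ∀ x, x ∉ K → (x ∈ S.image γ ↔ x ∈ S ∨ x = v) := by
      intro x hx
      have := congrArg (x ∈ ·) h3
      simp only [Finset.mem_sdiff, Finset.mem_insert, hx, not_false_eq_true, and_true, eq_iff_iff] at this
      tauto
    obtain ⟨δ, n1, n2, n3⟩ := ULs hr.symm ((mem v hv).2 (Or.inr rfl)) (fun h => by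
      rcases (mem t htK).1 h with h | h
      · exact ht h
      · exact hvt h.symm)
    refine ⟨δ * γ, (h1.trans n1).mono (by omega), ?_, ?_, ?_⟩
    · rw [Perm.mul_apply, n3]; exact h2
      rintro ⟨-, h⟩; exact h h2
    · rw [image_mul, n2]
      ext x
      by_cases hx : x ∈ K
      · simp only [Finset.mem_sdiff, Finset.mem_insert, hx, not_true, and_false, or_false, false_iff]
        rintro rfl; exact htK hx
      · simp only [Finset.mem_sdiff, Finset.mem_insert, Finset.mem_erase, hx, mem x hx]
        constructor
        · tauto
        · rintro (rfl | ⟨h, -⟩)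
          · tauto
          · exact ⟨Or.inr ⟨fun e => hvS (e ▸ h), Or.inl h⟩, by simp⟩
    · intro x hx
      rw [Perm.mul_apply, h4 x (fun h => hx (hKD h)) (fun e => hx (e ▸ hvD)), n3]
      rintro ⟨h, -⟩; exact hx h

end P4d
end CM

open SimpleGraph
namespace CM
open Equiv Equiv.Perm
set_option linter.unusedSectionVars false
section P4e
variable {V : Type} [Fintype V] [DecidableEq V] {G : SimpleGraph V}

lemma card_split {S K : Finset V} {γ : Perm V} : (S.image γ ∩ K).card + (S.image γ \ K).card = (S ∩ K).card + (S \ K).card := by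
  rw [Finset.card_inter_add_card_sdiff, Finset.card_inter_add_card_sdiff, Finset.card_image_of_injective _ γ.injective]

lemma GU {K D B : Finset V} {ρ : ℕ} (hK : Gad G K ρ) (hD : CSet G D) (hKD : K ⊆ D) (hB : B ⊆ D) (hBK : ∀ x ∈ B, x ∉ K) :
    ∀ m (S : Finset V) (a : V), (B \ S).card = m → ρ ≤ (S ∩ K).card → a ∈ K → a ∉ S → B.card + ρ ≤ (S ∩ D).card →
    ∃ γ, M G S γ (m * (24 * Fintype.card V)) ∧ B ⊆ S.image γ ∧ γ a ∈ K ∧ ρ ≤ (S.image γ ∩ K).card ∧ ∀ x, x ∉ (D : Set V) → γ x = x := by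
  intro m
  induction m with
  | zero =>
    intro S a hm hr ha haS hc
    refine ⟨1, M.nil _, ?_, ha, by simpa using hr, fun _ _ => rfl⟩
    rw [Finset.card_eq_zero, Finset.sdiff_eq_empty_iff_subset] at hm
    simpa using hm
  | succ m ih =>
    intro S a hm hr ha haS hc
    obtain ⟨t, ht⟩ : (B \ S).Nonempty := by rw [← Finset.card_pos]; omega
    have ht' := ht
    rw [Finset.mem_sdiff] at ht'
    have step : ∃ γ, M G S γ (24 * Fintype.card V) ∧ γ a ∈ K ∧ ρ ≤ (S.image γ ∩ K).card ∧ (∀ x, x ∉ (D : Set V) → γ x = x) ∧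
        B \ S.image γ = (B \ S).erase t := by
      by_cases h : ρ + 1 ≤ (S ∩ K).card
      · obtain ⟨γ, h1, h2, h3, h4⟩ := gad_X hK.conn hD hKD (by omega) ha haS ht'.2 (hB ht'.1) (hBK t ht'.1)
        refine ⟨γ, h1.mono (by omega), h2, ?_, by simpa using h4, ?_⟩
        · have := card_split (S := S) (K := K) (γ := γ)
          rw [h3, Finset.card_insert_of_notMem (by simp [ht'.2])] at this
          omega
        · ext x
          have := congrArg (x ∈ ·) h3
          have hb := hBK x
          simp only [Finset.mem_sdiff, Finset.mem_insert, Finset.mem_erase, eq_iff_iff] at this ⊢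
          tauto
      · have hr' : (S ∩ K).card = ρ := by omega
        obtain ⟨s, hs, hsB⟩ : ∃ s ∈ (S ∩ D) \ K, s ∉ B := by
          by_contra hcon
          push Not at hcon
          have h1 : (S ∩ D) \ K ⊆ B.erase t := fun x hx => Finset.mem_erase.2 ⟨fun e => by
            subst e; simp only [Finset.mem_sdiff, Finset.mem_inter] at hx; exact ht'.2 hx.1.1, hcon x hx⟩
          have h2 := Finset.card_le_card h1
          rw [Finset.card_erase_of_mem ht'.1] at h2
          have h3 := Finset.card_inter_add_card_sdiff (S ∩ D) K
          rw [Finset.inter_assoc, Finset.inter_eq_right.2 hKD] at h3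
          have := Finset.card_pos.2 ⟨t, ht'.1⟩
          omega
        simp only [Finset.mem_sdiff, Finset.mem_inter] at hs
        obtain ⟨γ, h1, h2, h3, h4⟩ := gad_E hK hD hKD hr' ha haS hs.1.1 hs.1.2 hs.2
        have hc1 := card_split (S := S) (K := K) (γ := γ)
        rw [h3, Finset.card_erase_of_mem (by simp [hs])] at hc1
        have := Finset.card_pos.2 ⟨s, show s ∈ S \ K by simp [hs]⟩
        have htS : t ∉ S.image γ := by
          intro h
          have : t ∈ S.image γ \ K := by simp only [Finset.mem_sdiff]; exact ⟨h, hBK t ht'.1⟩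
          rw [h3] at this
          simp only [Finset.mem_erase, Finset.mem_sdiff] at this
          exact ht'.2 this.2.1
        obtain ⟨δ, n1, n2, n3, n4⟩ := gad_X hK.conn hD hKD (by omega) h2 (notin_image haS) htS (hB ht'.1) (hBK t ht'.1)
        refine ⟨δ * γ, (h1.trans n1).mono (by omega), n2, ?_, ?_, ?_⟩
        · rw [image_mul]
          have := card_split (S := S.image γ) (K := K) (γ := δ)
          rw [n3, Finset.card_insert_of_notMem (by simp only [Finset.mem_sdiff]; tauto)] at this
          omega
        · intro x hx; rw [Perm.mul_apply, h4 x hx, n4 x hx]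
        · rw [image_mul]
          ext x
          have e1 := congrArg (x ∈ ·) n3
          have e2 := congrArg (x ∈ ·) h3
          have hb := hBK x
          have : x ∈ B → x ≠ s := fun h e => hsB (e ▸ h)
          by_cases hxB : x ∈ B
          · have hb' := hb hxB
            have hxs := this hxB
            simp only [Finset.mem_sdiff, Finset.mem_insert, Finset.mem_erase, eq_iff_iff, hb', hxB, hxs, not_false_iff, and_true, true_and, ne_eq] at e1 e2 ⊢
            rw [e1, e2]; tauto
          · simp [hxB]
    obtain ⟨γ, h1, h2, h3, h4, h5⟩ := step
    obtain ⟨δ, n1, n2, n3, n4, n5⟩ := ih (S.image γ) (γ a) (by rw [h5, Finset.card_erase_of_mem ht]; omega) h3 h2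
      (notin_image haS) (by rwa [card_inter h4])
    refine ⟨δ * γ, (h1.trans n1).mono (by rw [Nat.add_mul, Nat.one_mul, Nat.add_comm]), by rwa [image_mul], n3, by rwa [image_mul], fun x hx => ?_⟩
    rw [Perm.mul_apply, h4 x hx, n5 x hx]

lemma comp_cset {E : Set V} {a : V} {D : Finset V} (hD : ∀ x, x ∈ D ↔ (kp G E).Reachable a x) : CSet G D := by
  have key : ∀ x ∈ D, (kp G (D : Set V)).Reachable a x := by
    intro x hx
    obtain ⟨w⟩ := (hD x).1 hx
    refine walk_kp (w.mapLe kp_le) fun v hv => ?_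
    rw [Walk.support_mapLe_eq_support] at hv
    exact (hD v).2 ⟨w.takeUntil v hv⟩
  exact fun x hx y hy => (key x hx).symm.trans (key y hy)

lemma path_dl {b k : V} {w : G.Walk b k} (hw : w.IsPath) {v : V} (hv : v ∈ w.support) (hvb : v ≠ b) :
    (dl G b).Reachable v k := by
  refine walk_kp (w.dropUntil v hv) fun x hx (e : x = b) => ?_
  subst e
  have h1 := w.take_spec hv
  have h2 := hw
  rw [← h1] at h2
  have := h2.support_nodup
  rw [Walk.support_append] at this
  have h3 := (List.nodup_append.1 this).2.2 x (by simp) x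
  rw [← Walk.cons_tail_support] at hx
  rcases List.mem_cons.1 hx with e | e
  · exact hvb e.symm
  · exact h3 e rfl

lemma gad_L (hG : G.Connected) {K S : Finset V} {ρ : ℕ} (hK : Gad G K ρ) {a b k0 : V} (ha : a ∈ K) (haS : a ∉ S) (hb : b ∉ K) (hbS : b ∉ S)
    (hr : ρ ≤ (S ∩ K).card) (hS : ∀ s ∈ S, (dl G b).Reachable a s) (hk0 : k0 ∈ K) (hd : G.dist b k0 + ρ ≤ S.card) :
    ∃ γ, M G S γ (24 * Fintype.card V * S.card) ∧ γ a ∈ K ∧ γ b ∈ K ∧ ρ ≤ (S.image γ ∩ K).card := by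
  obtain ⟨k, hk, hmin⟩ := Finset.exists_min_image K (fun v => G.dist b v) ⟨k0, hk0⟩
  have hdk : G.dist b k + ρ ≤ S.card := by have := hmin k0 hk0; omega
  clear hd hk0 k0
  have hbk : b ≠ k := fun e => hb (e ▸ hk)
  obtain ⟨w, hw, hl⟩ := hG.exists_path_of_dist b k
  have hwd : ∀ v ∈ w.support, G.dist b v + G.dist v k ≤ G.dist b k := fun v hv => by
    have h1 := dist_le (w.takeUntil v hv)
    have h2 := dist_le (w.dropUntil v hv)
    have h3 := congrArg Walk.length (w.take_spec hv)
    rw [Walk.length_append] at h3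
    omega
  have hwK : ∀ v ∈ w.support, v ∈ K → v = k := fun v hv hvK => by
    have h1 := hwd v hv
    have h2 := hmin v hvK
    by_contra hne
    have := hG.pos_dist_of_ne hne
    omega
  set T := (w.support.toFinset.erase b).erase k with hT
  have hTm : ∀ v, v ∈ T ↔ v ≠ k ∧ v ≠ b ∧ v ∈ w.support := fun v => by simp [hT]
  have hTc : T.card + 1 = G.dist b k := by
    rw [hT, Finset.card_erase_of_mem (by simp [hbk.symm]), Finset.card_erase_of_mem (by simp),
      List.toFinset_card_of_nodup hw.support_nodup, Walk.length_support]
    have := hG.pos_dist_of_ne hbk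
    omega
  let D := fl fun x => (dl G b).Reachable a x
  have hDm : ∀ x, x ∈ D ↔ (kp G {b}ᶜ).Reachable a x := fun x => mem_fl
  have hDc : CSet G D := comp_cset hDm
  have hKD : K ⊆ D := fun x hx => (hDm x).2 (hK.conn.dl hb ha hx)
  have hSD : S ⊆ D := fun x hx => (hDm x).2 (hS x hx)
  have hab : a ≠ b := fun e => hb (e ▸ ha)
  have hbD : b ∉ (D : Set V) := fun h => dl_ne ((hDm b).1 h) hab rfl
  have hTD : T ⊆ D := fun v hv => by
    rw [hTm] at hv
    exact (hDm v).2 (((hDm k).1 (hKD hk)).trans (path_dl hw hv.2.2 hv.2.1).symm)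
  have hTK : ∀ x ∈ T, x ∉ K := fun v hv hvK => by
    rw [hTm] at hv; exact hv.1 (hwK v hv.2.2 hvK)
  obtain ⟨γ, h1, h2, h3, h4, h5⟩ := GU hK hDc hKD hTD hTK _ S a rfl hr ha haS (by
    rw [Finset.inter_eq_left.2 hSD]; omega)
  have hS1D : S.image γ ⊆ D := fun x hx => by
    by_contra h
    exact h (hSD ((fix_out h5 h).1 hx))
  have hcS : (S.image γ).card = S.card := Finset.card_image_of_injective _ γ.injective
  have hn : 1 ≤ Fintype.card V := Fintype.card_pos_iff.2 ⟨a⟩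
  have st2 : ∃ δ, M G (S.image γ) δ (21 * Fintype.card V) ∧ T ⊆ (S.image γ).image δ ∧ δ (γ a) ∈ K ∧
      ρ + 1 ≤ ((S.image γ).image δ ∩ K).card ∧ ∀ x, x ∉ (D : Set V) → δ x = x := by
    by_cases h : ρ + 1 ≤ (S.image γ ∩ K).card
    · exact ⟨1, M.nil _, by simpa using h2, h3, by simpa using h, fun _ _ => rfl⟩
    · have hsp := Finset.card_inter_add_card_sdiff (S.image γ) K
      obtain ⟨s, hs, hsT⟩ : ∃ s ∈ S.image γ \ K, s ∉ T := by
        by_contra hcon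
        push Not at hcon
        have := Finset.card_le_card (show S.image γ \ K ⊆ T from hcon)
        omega
      rw [Finset.mem_sdiff] at hs
      obtain ⟨δ, n1, n2, n3, n4⟩ := gad_E hK hDc hKD (by omega) h3 (notin_image haS) hs.1 (hS1D hs.1) hs.2
      refine ⟨δ, n1, fun x hx => ?_, n2, ?_, by simpa using n4⟩
      · have : x ∈ (S.image γ).image δ \ K := by
          rw [n3, Finset.mem_erase, Finset.mem_sdiff]
          exact ⟨fun e => hsT (e ▸ hx), h2 hx, hTK x hx⟩
        exact (Finset.mem_sdiff.1 this).1
      · have hc1 := card_split (S := S.image γ) (K := K) (γ := δ)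
        rw [n3, Finset.card_erase_of_mem (Finset.mem_sdiff.2 hs)] at hc1
        have := Finset.card_pos.2 ⟨s, show s ∈ S.image γ \ K from Finset.mem_sdiff.2 hs⟩
        omega
  obtain ⟨δ, n1, n2, n3, n4, n5⟩ := st2
  rw [← image_mul] at n2 n4
  have m1 := h1.trans n1
  have f1 : (δ * γ) b = b := by rw [Perm.mul_apply, h5 b hbD, n5 b hbD]
  set ε := δ * γ with hε
  obtain ⟨ζ, p1, p2, p3⟩ := UL (S := S.image ε) hK.conn (B := {k}) (by simpa using hk) (by simp only [Finset.card_singleton]; omega)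
  have hbζ : ζ b = b := p3 b (by simpa using hb)
  have hkS : k ∈ (S.image ε).image ζ := p2 (by simp)
  have hTS : T ⊆ (S.image ε).image ζ := fun x hx => (fix_out p3 (by simpa using hTK x hx)).2 (n2 hx)
  have hbS' : b ∉ (S.image ε).image ζ := by
    have : b ∉ S.image ε := by rw [← f1]; exact notin_image hbS
    rw [← hbζ]; exact notin_image this
  have hci := card_inter (S := S.image ε) p3
  obtain ⟨η, q1, q2, q3, q4⟩ := Wk w ((S.image ε).image ζ) hw (fun v hv hvb => by
    by_cases e : v = k
    · exact e ▸ hkS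
    · exact hTS ((hTm v).2 ⟨e, hvb, hv⟩)) hbS'
  refine ⟨η * (ζ * ε), ((m1.trans p1).trans (by rw [image_mul]; exact q1)).mono ?_, ?_, ?_, ?_⟩
  · have hx1 : (T \ S).card ≤ T.card := Finset.card_le_card Finset.sdiff_subset
    have hx2 : w.length ≤ Fintype.card V := hw.length_lt.le
    have hx3 : (T \ S).card * (24 * Fintype.card V) + 24 * Fintype.card V ≤ 24 * Fintype.card V * S.card := by
      have : ((T \ S).card + 1) * (24 * Fintype.card V) ≤ S.card * (24 * Fintype.card V) :=
        Nat.mul_le_mul_right _ (by omega)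
      nlinarith
    simp only [Finset.card_singleton]
    omega
  · have hz : ζ (ε a) ∈ K := fix_in (D := (K : Set V)) p3 n3
    have hz' : ζ (ε a) ∉ (S.image ε).image ζ := notin_image (notin_image haS)
    rw [Perm.mul_apply, Perm.mul_apply, q4]
    · exact hz
    · intro h
      have := hwK _ h hz
      rw [this] at hz'; exact hz' hkS
  · rw [Perm.mul_apply, Perm.mul_apply, f1, hbζ, q2]; exact hk
  · rw [image_mul, image_mul, q3 hbk]
    have e : insert b (((S.image ε).image ζ).erase k) ∩ K = ((S.image ε).image ζ ∩ K).erase k := by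
      ext x
      simp only [Finset.mem_inter, Finset.mem_insert, Finset.mem_erase]
      constructor
      · rintro ⟨rfl | h, h'⟩
        · exact absurd h' hb
        · tauto
      · tauto
    rw [e, Finset.card_erase_of_mem (Finset.mem_inter.2 ⟨hkS, hk⟩)]
    omega

end P4e
end CM

open SimpleGraph
namespace CM
open Equiv Equiv.Perm
set_option linter.unusedSectionVars false
section P4f
variable {V : Type} [Fintype V] [DecidableEq V] {G : SimpleGraph V}

lemma att_in (hG : G.Connected) {Z : Finset V} (hZ : CSet G Z) {a z : V} {Q : Site V} (ha : a ∉ Z) (hz : z ∈ Z) (h : Att G Z a Q) :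
    (a ∈ Q.X ∧ Q.e = 0) ∨ (a ∉ Q.X ∧ ∃ q ∈ Q.X, G.dist a q + Q.e ≤ Z.card ∧ (dl G a).Reachable q z) := by
  rcases h with ⟨h1, q, hq, hd⟩ | ⟨h1, h2 | ⟨s, hs, s', hs', -, -, hn⟩⟩
  · right
    have hp := hG.pos_dist_of_ne (nem h1 hq)
    obtain ⟨v, hv⟩ : (hc G Z a q).Nonempty := by rw [← Finset.card_pos]; omega
    rw [mem_hc] at hv
    exact ⟨h1, q, hq, hd.trans (Finset.card_le_card fun x hx => (mem_hc.1 hx).1), hv.2.trans (hZ.dl ha hv.1 hz)⟩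
  · exact Or.inl ⟨h1, h2⟩
  · exact absurd (hZ.dl ha hs hs') hn

lemma kp_thru {D : Set V} {x y b : V} (h : (kp G D).Reachable x y) (hn : ¬ (kp G (D \ {b})).Reachable x y) :
    (kp G D).Reachable x b := by
  obtain ⟨w⟩ := h
  by_cases hb : b ∈ w.support
  · exact ⟨w.takeUntil b hb⟩
  · exfalso
    by_cases e : x = y
    · subst e; exact hn (Reachable.refl _)
    have hx := (kp_mem ⟨w⟩ e).1
    refine hn (walk_kp (w.mapLe kp_le) fun v hv => ?_)
    rw [Walk.support_mapLe_eq_support] at hv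
    exact ⟨walk_supp w hx v hv, fun (e : v = b) => hb (e ▸ hv)⟩

lemma JN {a b x y : V} (hxb : x ≠ b) (hyb : y ≠ b) (h1 : (dl G a).Reachable x y) (h2 : (dl G b).Reachable x y)
    (hn : ¬ (kp G {a, b}ᶜ).Reachable x y) : ∃ g, Cyc G g ∧ a ∈ g.support ∧ b ∈ g.support := by
  have hE : ({a}ᶜ \ {b} : Set V) = {a, b}ᶜ := by ext v; simp
  have hn' : ¬ (kp G ({a}ᶜ \ {b})).Reachable x y := by rwa [hE]
  obtain ⟨u, hu1, hu2⟩ := last_step (kp_thru (D := {a}ᶜ) h1 hn') hxb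
  obtain ⟨u', hu1', hu2'⟩ := last_step (kp_thru (D := {a}ᶜ) h1.symm (fun h => hn' h.symm)) hyb
  have hne : u ≠ u' := fun e => hn' (hu2.trans (e ▸ hu2'.symm))
  have hs : kp G ({a}ᶜ \ {b}) ≤ dl G b := kp_mono fun v hv => hv.2
  obtain ⟨g, hg, -, -, g1, g2, g3, -⟩ := CYC hu1.1.symm hu1'.1.symm hne (D := {b}ᶜ) (by simp)
    (((hu2.mono hs).symm.trans h2).trans (hu2'.mono hs))
  refine ⟨g, hg, ?_, g1⟩
  by_contra ha
  refine hn' ((hu2.trans ((cyc_reach hg g2 g3 hu1.1.ne hu1'.1.ne).mono (kp_mono ?_))).trans hu2'.symm)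
  rintro v ⟨hv, hvb⟩
  exact ⟨fun (e : v = a) => ha (e ▸ hv), hvb⟩

lemma path_kp {a b k : V} {w : G.Walk a k} (hw : w.IsPath) (hb : b ∉ w.support) {v : V} (hv : v ∈ w.support) (hva : v ≠ a) :
    (kp G {a, b}ᶜ).Reachable v k := by
  refine walk_kp (w.dropUntil v hv) fun x hx => ?_
  have hxw := w.support_dropUntil_subset_support hv hx
  simp only [Set.mem_compl_iff, Set.mem_insert_iff, Set.mem_singleton_iff, not_or]
  refine ⟨fun e => ?_, fun e => hb (e ▸ hxw)⟩
  subst e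
  have h1 := w.take_spec hv
  have h2 := hw
  rw [← h1] at h2
  have := h2.support_nodup
  rw [Walk.support_append] at this
  have h3 := (List.nodup_append.1 this).2.2 x (by simp) x
  rw [← Walk.cons_tail_support] at hx
  rcases List.mem_cons.1 hx with e | e
  · exact hva e.symm
  · exact h3 e rfl

lemma MOVE {Z : Finset V} (hZ : CSet G Z) {a b k z : V} (ha : a ∉ Z) (hb : b ∉ Z) (hz : z ∈ Z) {w : G.Walk a k}
    (hw : w.IsPath) (hbw : b ∉ w.support) {B0 : Finset V} (hzk : (dl G b).Reachable k z)
    (hT : ∀ v ∈ w.support, v ≠ a → (kp G {a, b}ᶜ).Reachable z v) (hB : ∀ v ∈ B0, (kp G {a, b}ᶜ).Reachable z v)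
    (hd : ∀ v ∈ B0, v ∉ w.support) (hc : w.length + B0.card ≤ Z.card) :
    ∃ γ, M G Z γ (2 * (Fintype.card V * Z.card)) ∧ γ a = k ∧ γ b = b ∧ B0 ⊆ Z.image γ ∧ ∀ s ∈ Z.image γ, (dl G b).Reachable k s := by
  let D := fl fun x => (kp G {a, b}ᶜ).Reachable z x
  have hDm : ∀ x, x ∈ D ↔ (kp G {a, b}ᶜ).Reachable z x := fun x => mem_fl
  have hDc : CSet G D := comp_cset hDm
  have hzab : z ∈ ({a, b}ᶜ : Set V) := by
    simp only [Set.mem_compl_iff, Set.mem_insert_iff, Set.mem_singleton_iff, not_or]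
    exact ⟨(nem ha hz).symm, (nem hb hz).symm⟩
  have hDab : ∀ x ∈ D, x ≠ a ∧ x ≠ b := fun x hx => by
    have := kp_mem_right ((hDm x).1 hx) hzab
    simpa using this
  have hZD : Z ⊆ D := fun x hx => (hDm x).2 ((hZ z hz x hx).mono (kp_mono fun v hv => by
    simp only [Set.mem_compl_iff, Set.mem_insert_iff, Set.mem_singleton_iff, not_or]
    exact ⟨(nem ha hv).symm, (nem hb hv).symm⟩))
  have haD : a ∉ (D : Set V) := fun h => (hDab a h).1 rfl
  have hbD : b ∉ (D : Set V) := fun h => (hDab b h).2 rfl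
  set T := w.support.toFinset.erase a with hTd
  have hTc : T.card = w.length := by
    rw [hTd, Finset.card_erase_of_mem (by simp), List.toFinset_card_of_nodup hw.support_nodup, Walk.length_support]; omega
  have hTB : (T ∪ B0).card ≤ Z.card := (Finset.card_union_le _ _).trans (by omega)
  obtain ⟨γ, m1, m2, m3⟩ := UL (S := Z) hDc (B := T ∪ B0) (fun x hx => by
    rcases Finset.mem_union.1 hx with h | h
    · simp only [hTd, Finset.mem_erase, List.mem_toFinset] at h
      exact (hDm x).2 (hT x h.2 h.1)
    · exact (hDm x).2 (hB x h)) (by rwa [Finset.inter_eq_left.2 hZD])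
  have hγa := m3 a haD
  have hγb := m3 b hbD
  obtain ⟨η, q1, q2, -, q4⟩ := Wk w (Z.image γ) hw (fun v hv hva => m2 (Finset.mem_union_left _ (by simp [hTd, hv, hva])))
    (by rw [← hγa]; exact notin_image ha)
  have hfo : ∀ {v}, v ∉ w.support → (v ∈ (Z.image γ).image η ↔ v ∈ Z.image γ) := fun {v} hv =>
    fix_out (D := {v | v ∈ w.support}) (fun v hv => q4 v hv) hv
  refine ⟨η * γ, (m1.trans q1).mono ?_, ?_, ?_, ?_, ?_⟩
  · have h1 := Nat.mul_le_mul_right (Fintype.card V) hTB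
    have h2 : w.length ≤ Fintype.card V := hw.length_lt.le
    have h3 : 1 ≤ Z.card := Finset.card_pos.2 ⟨z, hz⟩
    nlinarith
  · rw [Perm.mul_apply, hγa, q2]
  · rw [Perm.mul_apply, hγb, q4 b hbw]
  · rw [image_mul]
    exact fun x hx => (hfo (hd x hx)).2 (m2 (Finset.mem_union_right _ hx))
  · rw [image_mul]
    intro s hs
    by_cases hsw : s ∈ w.support
    · refine (walk_kp (w.dropUntil s hsw) fun x hx (e : x = b) => hbw (e ▸ w.support_dropUntil_subset_support hsw hx)).symm
    · have := (hfo hsw).1 hs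
      have hsD : s ∈ D := by
        by_contra h
        exact h (hZD ((fix_out m3 h).1 this))
      exact hzk.trans (((hDm s).1 hsD).mono (kp_mono fun v hv => by
        simp only [Set.mem_compl_iff, Set.mem_insert_iff, Set.mem_singleton_iff, not_or] at hv; exact hv.2))

lemma oneIn (hG : G.Connected) (hP : ¬ Pure G) {g : Perm V} (hg : Cyc G g) {S : Finset V} (hS : S.Nonempty) {a b q : V}
    (ha : a ∈ g.support) (haS : a ∉ S) (hbS : b ∉ S) (hab : a ≠ b) (hr : ∀ s ∈ S, (dl G b).Reachable a s) (hq : q ∈ g.support)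
    (hd : G.dist b q ≤ S.card) : M G S (swap a b) (48 * (Fintype.card V * (S.card + g.support.card))) := by
  by_cases hb : b ∈ g.support
  · exact (XO hG hP hg hS ha hb haS hbS hab).mono (by nlinarith)
  · obtain ⟨γ, h1, h2, h3, -⟩ := gad_L hG (gad_cyc hg) ha haS hb hbS (by omega) hr hq hd
    exact h1.conj' haS hbS (XO hG hP hg (hS.image _) h2 h3 (notin_image haS) (notin_image hbS) (γ.injective.ne hab)) (by nlinarith)

lemma geo_notin {a b k : V} {w : G.Walk a k} (hl : w.length = G.dist a k) (hab : a ≠ b) (hG : G.Connected) (h : G.dist a k ≤ G.dist b k) :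
    b ∉ w.support := fun hb => by
  have h1 := dist_le (w.takeUntil b hb)
  have h2 := dist_le (w.dropUntil b hb)
  have h3 := congrArg Walk.length (w.take_spec hb)
  rw [Walk.length_append] at h3
  have := hG.pos_dist_of_ne hab
  omega

lemma LLc (hG : G.Connected) (hP : ¬ Pure G) {Z : Finset V} (hZ : CSet G Z) {z a b qa qb : V} (hz : z ∈ Z) (ha : a ∉ Z) (hb : b ∉ Z)
    (hab : a ≠ b) {g : Perm V} (hg : Cyc G g) (hbO : b ∉ g.support) (hqa : qa ∈ g.support) (hqb : qb ∈ g.support)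
    (hda : G.dist a qa ≤ Z.card) (hdb : G.dist b qb ≤ Z.card) (hrb : (dl G b).Reachable qb z)
    (hJ : ∀ k ∈ g.support, (kp G {a, b}ᶜ).Reachable z k) (hmin : ∀ q' ∈ g.support, ∃ q ∈ g.support, G.dist a q ≤ G.dist b q') :
    M G Z (swap a b) (52 * (Fintype.card V * (Z.card + g.support.card))) := by
  obtain ⟨k, hk, hkm⟩ := Finset.exists_min_image g.support (fun v => G.dist a v) ⟨qa, hqa⟩
  obtain ⟨w, hw, hl⟩ := hG.exists_path_of_dist a k
  have hbw : b ∉ w.support := geo_notin hl hab hG (by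
    obtain ⟨q, hq, h⟩ := hmin k hk
    exact (hkm q hq).trans h)
  have hcon : ∀ {q' q}, q' ∈ g.support → q ∈ g.support → (dl G b).Reachable q' q := fun h h' =>
    (cyc_reach hg h h' (nem hbO h).symm (nem hbO h').symm).mono (kp_mono fun v hv => hv.2)
  obtain ⟨γ, m1, m2, m3, -, m5⟩ := MOVE hZ ha hb hz hw hbw (B0 := ∅) ((hcon hk hqb).trans hrb)
    (fun v hv hva => (hJ k hk).trans (path_kp hw hbw hv hva).symm) (by simp) (by simp) (by
      have := hkm qa hqa
      simp only [Finset.card_empty]; omega)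
  have hcard : (Z.image γ).card = Z.card := Finset.card_image_of_injective _ γ.injective
  have hf := oneIn hG hP hg (S := Z.image γ) ⟨γ z, Finset.mem_image_of_mem _ hz⟩ hk (by rw [← m2]; exact notin_image ha)
    (by rw [← m3]; exact notin_image hb) (nem hbO hk).symm m5 hqb (by omega)
  rw [hcard] at hf
  exact m1.conj' ha hb (by rw [m2, m3]; exact hf) (by nlinarith)

lemma pred (hG : G.Connected) {a c : V} (h : a ≠ c) : ∃ α, G.Adj c α ∧ G.dist a α + 1 = G.dist a c := by
  obtain ⟨w, hl⟩ := hG.exists_walk_length_eq_dist c a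
  cases w with
  | nil => exact absurd rfl h
  | @cons _ α _ hadj p =>
    refine ⟨α, hadj, ?_⟩
    have h1 := dist_le p
    have h2 := hG.dist_triangle (u := c) (v := α) (w := a)
    rw [dist_eq_one_iff_adj.2 hadj] at h2
    rw [Walk.length_cons] at hl
    rw [dist_comm (u := a), dist_comm (u := a)]
    omega

lemma core_third {c α β : V} (h : Core G c) : ∃ γ, G.Adj c γ ∧ γ ≠ α ∧ γ ≠ β := by
  obtain ⟨-, u, v, w, hu, hv, hw, huv, huw, hvw⟩ := h
  by_contra hcon
  push Not at hcon
  have h1 := hcon u hu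
  have h2 := hcon v hv
  have h3 := hcon w hw
  by_cases a1 : u = α
  · subst a1
    exact hvw ((h2 huv.symm).trans (h3 huw.symm).symm)
  · have := h1 a1
    by_cases a2 : v = α
    · subst a2; exact huw (this.trans (h3 hvw.symm).symm)
    · exact huv (this.trans (h2 a2).symm)

lemma LLs (hG : G.Connected) {Z : Finset V} (hZ : CSet G Z) {z a b c : V} (hz : z ∈ Z) (ha : a ∉ Z) (hb : b ∉ Z)
    (hab : a ≠ b) (hc : Core G c) (hac : a ≠ c) (hbc : b ≠ c) (hdb : G.dist b c + 1 ≤ Z.card)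
    (hrb : (dl G b).Reachable c z) (hJ : (kp G {a, b}ᶜ).Reachable z c) (hmin : G.dist a c ≤ G.dist b c) :
    M G Z (swap a b) (70 * (Fintype.card V * Z.card)) := by
  obtain ⟨α, hα, dα⟩ := pred hG hac
  obtain ⟨β, hβ, dβ⟩ := pred hG hbc
  obtain ⟨l, hl, hlα, hlβ⟩ := core_third (α := α) (β := β) hc
  have hla : l ≠ a := fun e => by
    subst e
    have h1 : G.dist l c = 1 := dist_eq_one_iff_adj.2 hl.symm
    have : G.dist l α = 0 := by omega
    exact hlα (hG.dist_eq_zero_iff.1 this)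
  have hlb : l ≠ b := fun e => by
    subst e
    have h1 : G.dist l c = 1 := dist_eq_one_iff_adj.2 hl.symm
    have : G.dist l β = 0 := by omega
    exact hlβ (hG.dist_eq_zero_iff.1 this)
  obtain ⟨β', hβ', hβα, hβl, hββ⟩ : ∃ β', G.Adj c β' ∧ β' ≠ α ∧ β' ≠ l ∧ (β = α ∨ β = β') := by
    by_cases e : β = α
    · obtain ⟨β', h1, h2, h3⟩ := core_third (α := α) (β := l) hc
      exact ⟨β', h1, h2, h3, Or.inl e⟩
    · exact ⟨β, hβ, e, hlβ.symm, Or.inr rfl⟩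
  obtain ⟨w, hw, hwl⟩ := hG.exists_path_of_dist a α
  have hdc : ∀ v ∈ w.support, G.dist a v + G.dist v α ≤ G.dist a α := fun v hv => by
    have h1 := dist_le (w.takeUntil v hv)
    have h2 := dist_le (w.dropUntil v hv)
    have h3 := congrArg Walk.length (w.take_spec hv)
    rw [Walk.length_append] at h3
    omega
  have tri : ∀ v, G.dist v c ≤ G.dist v α + 1 := fun v => by
    have := hG.dist_triangle (u := v) (v := α) (w := c)
    rwa [dist_eq_one_iff_adj.2 hα.symm] at this
  have hbw : b ∉ w.support := fun h => by
    have h1 := hdc b h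
    have h2 := hG.pos_dist_of_ne hab
    have h3 := tri b
    omega
  have hcw : c ∉ w.support := fun h => by
    have h1 := hdc c h
    omega
  have hlw : l ∉ w.support := fun h => by
    have h1 := hdc l h
    have h2 := hG.pos_dist_of_ne hlα
    have h3 := hG.dist_triangle (u := a) (v := l) (w := c)
    rw [dist_eq_one_iff_adj.2 hl.symm] at h3
    omega
  have hcab : c ∈ ({a, b}ᶜ : Set V) := by simp [hac.symm, hbc.symm]
  have hαb : α ≠ b := fun e => hbw (e ▸ w.end_mem_support)
  obtain ⟨γ, m1, m2, m3, m4, m5⟩ := MOVE hZ ha hb hz hw hbw (B0 := {c, l}) ((dl_step hα.symm hαb hbc.symm).trans hrb) (by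
      intro v hv hva
      have h1 := path_kp hw hbw hv hva
      refine hJ.trans (Reachable.trans (Adj.reachable ⟨hα, hcab, ?_⟩) h1.symm)
      refine kp_mem_right h1 ?_
      simp [hva, nem (K := w.support.toFinset) (by simpa using hbw) (show v ∈ _ by simpa using hv) |>.symm]) (by
      intro v hv
      simp only [Finset.mem_insert, Finset.mem_singleton] at hv
      rcases hv with rfl | rfl
      · exact hJ
      · exact hJ.trans (Adj.reachable ⟨hl, hcab, by simp [hla, hlb]⟩)) (by
      intro v hv
      simp only [Finset.mem_insert, Finset.mem_singleton] at hv
      rcases hv with rfl | rfl <;> assumption) (by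
      rw [Finset.card_pair hl.ne]; omega)
  have hcard : (Z.image γ).card = Z.card := Finset.card_image_of_injective _ γ.injective
  have h2 : ∀ {S : Finset V}, {c, l} ⊆ S → 2 ≤ (S ∩ star c α l β').card := fun {S} h => by
    rw [← Finset.card_pair hl.ne]
    exact Finset.card_le_card (Finset.subset_inter h (by intro x; simp [star]; tauto))
  have haS : α ∉ Z.image γ := by rw [← m2]; exact notin_image ha
  have hbS : b ∉ Z.image γ := by rw [← m3]; exact notin_image hb
  have hαK : α ∈ star c α l β' := by simp [star]
  have hh : 1 ≤ Z.card := Finset.card_pos.2 ⟨z, hz⟩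
  refine m1.conj' (d := 59 * (Fintype.card V * Z.card)) ha hb ?_ (by nlinarith)
  rw [m2, m3]
  by_cases hbK : b ∈ star c α l β'
  · exact (XS hα hl hβ' hlα.symm hβα.symm hβl.symm (h2 m4) hαK hbK haS hbS hαb).mono (by nlinarith)
  · obtain ⟨δ, n1, n2, n3, n4⟩ := gad_L hG (gad_star hα hl hβ' hlα.symm hβα.symm hβl.symm) hαK haS hbK hbS (h2 m4) m5
      (k0 := β) (by rcases hββ with rfl | rfl <;> simp [star]) (by omega)
    rw [hcard] at n1
    exact n1.conj' haS hbS (XS hα hl hβ' hlα.symm hβα.symm hβl.symm n4 n2 n3 (notin_image haS) (notin_image hbS)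
      (δ.injective.ne hαb)) (by nlinarith)

lemma LL (hG : G.Connected) (hP : ¬ Pure G) {Z : Finset V} (hZ : CSet G Z) {z a b : V} (hz : z ∈ Z) (hab : a ≠ b)
    (h : PG G Z a b) : ∃ Q, Site.Valid G Q ∧ Att G Z a Q ∧ Att G Z b Q ∧
      M G Z (swap a b) (70 * (Fintype.card V * (Z.card + Q.X.card))) := by
  have hJN : ∀ {a b : V}, a ∉ Z → b ∉ Z → a ≠ b → (∃ g, Cyc G g ∧ a ∈ g.support ∧ b ∈ g.support) →
      ∃ Q, Site.Valid G Q ∧ Att G Z a Q ∧ Att G Z b Q ∧ M G Z (swap a b) (70 * (Fintype.card V * (Z.card + Q.X.card))) := by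
    rintro a b ha hb hab ⟨g, hg, h1, h2⟩
    exact ⟨_, cyc_valid hg, Or.inr ⟨h1, Or.inl rfl⟩, Or.inr ⟨h2, Or.inl rfl⟩,
      (XO hG hP hg ⟨z, hz⟩ h1 h2 ha hb hab).mono (by simp only; nlinarith)⟩
  obtain ⟨ha, hb, Q, hQ, hA, hB⟩ := h
  have hA' := att_in hG hZ ha hz hA
  have hB' := att_in hG hZ hb hz hB
  have hone : ∀ {a b : V}, a ∉ Z → b ∉ Z → a ≠ b → (a ∈ Q.X ∧ Q.e = 0) → (b ∉ Q.X ∧ ∃ q ∈ Q.X, G.dist b q + Q.e ≤ Z.card ∧ (dl G b).Reachable q z) →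
      M G Z (swap a b) (70 * (Fintype.card V * (Z.card + Q.X.card))) := by
    rintro a b ha hb hab ⟨h1, h2⟩ ⟨h3, q, h4, h5, h6⟩
    rcases hQ with ⟨g, hg, hX, -⟩ | ⟨c, -, -, he⟩
    · rw [hX] at h1 h3 h4 ⊢
      refine (oneIn hG hP hg ⟨z, hz⟩ h1 ha hb hab (fun s hs => ?_) h4 (by omega)).mono (by nlinarith)
      exact ((cyc_reach hg h1 h4 hab (nem h3 h4).symm).mono (kp_mono fun v hv => hv.2)).trans (h6.trans (hZ.dl hb hz hs))
    · omega
  rcases hA' with hA' | hA' <;> rcases hB' with hB' | hB'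
  · rcases hQ with ⟨g, hg, hX, -⟩ | ⟨c, -, -, he⟩
    · exact hJN ha hb hab ⟨g, hg, hX ▸ hA'.1, hX ▸ hB'.1⟩
    · omega
  · exact ⟨Q, hQ, hA, hB, hone ha hb hab hA' hB'⟩
  · exact ⟨Q, hQ, hA, hB, swap_comm b a ▸ hone hb ha hab.symm hB' hA'⟩
  by_cases hcy : ∃ g, Cyc G g ∧ a ∈ g.support ∧ b ∈ g.support
  · exact hJN ha hb hab hcy
  obtain ⟨haQ, qa, hqa, hda, hra⟩ := hA'
  obtain ⟨hbQ, qb, hqb, hdb, hrb⟩ := hB'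
  have hJ : ∀ k ∈ Q.X, (kp G {a, b}ᶜ).Reachable z k := fun k hk => by
    by_contra hn
    exact hcy (JN (nem hb hz).symm (nem hbQ hk).symm
      (hra.symm.trans (site_conn hQ hqa hk (nem haQ hqa).symm (nem haQ hk).symm))
      (hrb.symm.trans (site_conn hQ hqb hk (nem hbQ hqb).symm (nem hbQ hk).symm)) hn)
  have hJ' : ∀ k ∈ Q.X, (kp G {b, a}ᶜ).Reachable z k := by rwa [Set.pair_comm]
  refine ⟨Q, hQ, hA, hB, ?_⟩
  rcases hQ with ⟨g, hg, hX, he⟩ | ⟨c, hc, hX, he⟩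
  · rw [hX] at hqa hqb haQ hbQ hJ hJ' ⊢
    obtain ⟨k, hk, hkm⟩ := Finset.exists_min_image g.support (fun v => G.dist a v) ⟨qa, hqa⟩
    obtain ⟨k', hk', hkm'⟩ := Finset.exists_min_image g.support (fun v => G.dist b v) ⟨qa, hqa⟩
    rcases le_total (G.dist a k) (G.dist b k') with hle | hle
    · exact (LLc hG hP hZ hz ha hb hab hg hbQ hqa hqb (by omega) (by omega) hrb hJ
        (fun q' hq' => ⟨k, hk, hle.trans (hkm' q' hq')⟩)).mono (by nlinarith)
    · rw [swap_comm]
      exact (LLc hG hP hZ hz hb ha hab.symm hg haQ hqb hqa (by omega) (by omega) hra hJ'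
        (fun q' hq' => ⟨k', hk', hle.trans (hkm q' hq')⟩)).mono (by nlinarith)
  · rw [hX] at hqa hqb haQ hbQ hJ hJ' ⊢
    rw [Finset.mem_singleton] at hqa hqb haQ hbQ
    subst hqa; subst qb
    rcases le_total (G.dist a qa) (G.dist b qa) with hle | hle
    · exact (LLs hG hZ hz ha hb hab hc haQ hbQ (by omega) hrb (hJ _ (by simp)) hle).mono (by nlinarith)
    · rw [swap_comm]
      exact (LLs hG hZ hz hb ha hab.symm hc hbQ haQ (by omega) hra (hJ' _ (by simp)) hle).mono (by nlinarith)

end P4f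
end CM

open SimpleGraph
namespace CM
open Equiv Equiv.Perm
set_option linter.unusedSectionVars false
section P5
variable {V : Type} [Fintype V] [DecidableEq V] {G : SimpleGraph V}

lemma ball_card (hG : G.Connected) (q : V) {r : ℕ} (hr : r < Fintype.card V) : r + 1 ≤ (fl fun v => G.dist q v ≤ r).card := by
  by_cases h : ∃ v, r ≤ G.dist q v
  · obtain ⟨v, hv⟩ := h
    obtain ⟨w, hw, hl⟩ := hG.exists_path_of_dist q v
    have hinj : Set.InjOn w.getVert (Finset.range (r + 1) : Set ℕ) := fun i hi j hj e =>
      hw.getVert_injOn (by simp at hi ⊢; omega) (by simp at hj ⊢; omega) e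
    rw [← Finset.card_range (r + 1), ← Finset.card_image_of_injOn hinj]
    refine Finset.card_le_card fun x hx => ?_
    rw [Finset.mem_image] at hx
    obtain ⟨i, hi, rfl⟩ := hx
    rw [Finset.mem_range] at hi
    rw [mem_fl]
    have := dist_le (w.take i)
    rw [Walk.take_length] at this
    omega
  · push Not at h
    have : (fl fun v => G.dist q v ≤ r) = Finset.univ := by
      ext v; simp only [mem_fl, Finset.mem_univ, iff_true]; exact (h v).le
    rw [this, Finset.card_univ]; omega

lemma disj_sum {ι : Type} [DecidableEq ι] (I : Finset ι) (B : ι → Finset V) (h : ∀ i ∈ I, ∀ j ∈ I, i ≠ j → Disjoint (B i) (B j)) :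
    ∑ i ∈ I, (B i).card ≤ Fintype.card V := by
  rw [← Finset.card_biUnion h]; exact Finset.card_le_univ _

def PGr (G : SimpleGraph V) (Z : Finset V) : SimpleGraph V where
  Adj p q := p ≠ q ∧ PG G Z p q
  symm := ⟨fun _ _ h => ⟨h.1.symm, h.2.2.1, h.2.1, h.2.2.2.imp fun _ h => ⟨h.1, h.2.2, h.2.1⟩⟩⟩
  loopless := ⟨fun _ h => h.1 rfl⟩

lemma PGr_walk {Z : Finset V} {p q : V} (h : PG G Z p q) : ∃ w : (PGr G Z).Walk p q, w.length ≤ 1 := by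
  by_cases e : p = q
  · subst e; exact ⟨Walk.nil, by simp⟩
  · have ha : (PGr G Z).Adj p q := ⟨e, h⟩
    exact ⟨ha.toWalk, by simp⟩

lemma geo_short {W : Type} {H : SimpleGraph W} {p q : W} {w : H.Walk p q} (hl : w.length = H.dist p q) {i j : ℕ} (hij : i ≤ j) (hj : j ≤ w.length)
    (u : H.Walk (w.getVert i) (w.getVert j)) : j - i ≤ u.length := by
  have := dist_le (((w.take i).append u).append (w.drop j))
  rw [Walk.length_append, Walk.length_append, Walk.take_length, Walk.drop_length] at this
  omega

lemma PACK (hG : G.Connected) {Z : Finset V} (hZ : CSet G Z) {z p q : V} (hz : z ∈ Z) (hp : p ∉ Z) {w : (PGr G Z).Walk p q}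
    (hl : w.length = (PGr G Z).dist p q) {Q : ℕ → Site V} (hQ : ∀ i < w.length, (Q i).Valid G ∧ Att G Z (w.getVert i) (Q i) ∧
      Att G Z (w.getVert (i + 1)) (Q i)) : ∑ i ∈ Finset.range w.length, (Z.card + (Q i).X.card) ≤ 8 * Fintype.card V := by
  have hh : 1 ≤ Z.card := Finset.card_pos.2 ⟨z, hz⟩
  have hn : Z.card ≤ Fintype.card V := Finset.card_le_univ _
  have hZn : ∀ i ≤ w.length, w.getVert i ∉ Z := by
    intro i hi
    rcases Nat.eq_zero_or_pos i with rfl | h0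
    · simpa using hp
    · have := w.adj_getVert_succ (i := i - 1) (by omega)
      rw [Nat.sub_add_cancel h0] at this
      exact this.2.2.1
  have hul : ∀ i j, i + 2 ≤ j → j < w.length → Q i ≠ Q j ∧ ¬ Lnk G Z.card (Q i) (Q j) := by
    intro i j hij hj
    obtain ⟨a1, a2, a3⟩ := hQ i (by omega)
    obtain ⟨b1, b2, b3⟩ := hQ j hj
    have hne : Q i ≠ Q j := fun e => by
      obtain ⟨u, hu⟩ := PGr_walk (G := G) (Z := Z) ⟨hZn i (by omega), hZn (j + 1) (by omega), Q i, a1, a2, e ▸ b3⟩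
      have := geo_short hl (by omega) (by omega) u
      omega
    refine ⟨hne, fun hL => ?_⟩
    obtain ⟨x, x1, x2, x3⟩ := BL hG hZ hz hp a1 b1 hne hL
    obtain ⟨u, hu⟩ := PGr_walk (G := G) (Z := Z) ⟨hZn i (by omega), x1, Q i, a1, a2, x2⟩
    obtain ⟨u', hu'⟩ := PGr_walk (G := G) (Z := Z) ⟨x1, hZn (j + 1) (by omega), Q j, b1, x3, b3⟩
    have := geo_short hl (by omega) (by omega) (u.append u')
    rw [Walk.length_append] at this
    omega
  have hne : ∀ i < w.length, ∃ x, x ∈ (Q i).X := by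
    intro i hi
    rcases (hQ i hi).1 with ⟨g, hg, hX, -⟩ | ⟨c, -, hX, -⟩
    · rw [hX]
      obtain ⟨x, hx, -⟩ := hg.2
      exact ⟨x, Equiv.Perm.mem_support.2 hx⟩
    · exact ⟨c, by simp [hX]⟩
  have hfar : ∀ i j, i + 2 ≤ j → j < w.length → ∀ x ∈ (Q i).X, ∀ y ∈ (Q j).X, 2 * ((Z.card - 2) / 2) < G.dist x y := by
    intro i j hij hj x hx y hy
    obtain ⟨h1, h2⟩ := hul i j hij hj
    obtain ⟨a1, -⟩ := hQ i (by omega)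
    obtain ⟨b1, -⟩ := hQ j hj
    have h3 : ¬ (G.dist x y + (Q i).e + (Q j).e ≤ Z.card) := fun h => h2 ⟨x, hx, y, hy, h⟩
    have h4 := site_e a1
    have h5 := site_e b1
    by_cases h0 : G.dist x y = 0
    · exfalso
      have hxy := hG.dist_eq_zero_iff.1 h0
      subst hxy
      have e1 : (Q i).e = 1 := by omega
      have e2 : (Q j).e = 1 := by omega
      exact h1 ((site_core a1 e1 hx).2.trans (site_core b1 e2 hy).2.symm)
    · omega
  have : Nonempty V := ⟨z⟩
  choose! x hx using hne
  set r := (Z.card - 2) / 2 with hr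
  have sep : ∀ I ⊆ Finset.range w.length, (∀ i ∈ I, ∀ j ∈ I, i < j → i + 2 ≤ j) →
      ∑ i ∈ I, (Z.card + (Q i).X.card) ≤ 4 * Fintype.card V := by
    intro I hI hs
    have hlt : ∀ i ∈ I, i < w.length := fun i hi => Finset.mem_range.1 (hI hi)
    have s1 := disj_sum I (fun i => (Q i).X) (fun i hi j hj hij => by
      rw [Finset.disjoint_left]
      intro v hv hv'
      rcases lt_or_gt_of_ne hij with h | h
      · have := hfar i j (hs i hi j hj h) (hlt j hj) v hv v hv'
        simp at this
      · have := hfar j i (hs j hj i hi h) (hlt i hi) v hv' v hv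
        simp at this)
    have s2 := disj_sum I (fun i => fl fun v => G.dist (x i) v ≤ r) (fun i hi j hj hij => by
      rw [Finset.disjoint_left]
      intro v hv hv'
      rw [mem_fl] at hv hv'
      have t1 := hG.dist_triangle (u := x i) (v := v) (w := x j)
      rw [dist_comm (u := v)] at t1
      rcases lt_or_gt_of_ne hij with h | h
      · have := hfar i j (hs i hi j hj h) (hlt j hj) _ (hx i (hlt i hi)) _ (hx j (hlt j hj))
        omega
      · have := hfar j i (hs j hj i hi h) (hlt i hi) _ (hx j (hlt j hj)) _ (hx i (hlt i hi))
        rw [dist_comm] at this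
        omega)
    have s3 : ∑ i ∈ I, Z.card ≤ ∑ i ∈ I, 3 * (fl fun v => G.dist (x i) v ≤ r).card := Finset.sum_le_sum fun i _ => by
      have := ball_card hG (x i) (r := r) (by omega)
      omega
    rw [← Finset.mul_sum] at s3
    rw [Finset.sum_add_distrib]
    omega
  rw [← Finset.sum_filter_add_sum_filter_not (Finset.range w.length) (fun i => i % 2 = 0)]
  have e1 := sep ((Finset.range w.length).filter (fun i => i % 2 = 0)) (Finset.filter_subset _ _) (by
    intro i hi j hj hij; rw [Finset.mem_filter] at hi hj; omega)
  have e2 := sep ((Finset.range w.length).filter (fun i => ¬ i % 2 = 0)) (Finset.filter_subset _ _) (by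
    intro i hi j hj hij; rw [Finset.mem_filter] at hi hj; omega)
  omega

lemma swap_chain {S : Finset V} (r : ℕ → V) (c : ℕ → ℕ) (T : ℕ) (hS : ∀ i ≤ T, r i ∉ S) (hinj : ∀ i ≤ T, ∀ j ≤ T, i ≠ j → r i ≠ r j)
    (hM : ∀ i < T, M G S (swap (r i) (r (i + 1))) (c i)) : ∀ i < T, M G S (swap (r 0) (r (i + 1))) (2 * ∑ j ∈ Finset.range (i + 1), c j) := by
  intro i
  induction i with
  | zero => intro h; exact (hM 0 h).mono (by simp; omega)
  | succ i ih =>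
    intro h
    have h1 := ih (by omega)
    have h2 := hM (i + 1) h
    have n1 := hinj 0 (by omega) (i + 1) (by omega) (by omega)
    have n2 := hinj 0 (by omega) (i + 1 + 1) (by omega) (by omega)
    refine h2.conj' (hS 0 (by omega)) (hS (i + 1 + 1) (by omega)) (d := 2 * ∑ j ∈ Finset.range (i + 1), c j) ?_ ?_
    · rw [image_swap_notMem (hS _ (by omega)) (hS _ (by omega)), swap_apply_of_ne_of_ne n1 n2, swap_apply_right]; exact h1
    · rw [Finset.sum_range_succ _ (i + 1)]; omega

lemma SWP (hG : G.Connected) (hP : ¬ Pure G) {Z : Finset V} (hZ : CSet G Z) {z p q : V} (hz : z ∈ Z) (hp : p ∉ Z) (hpq : p ≠ q)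
    (h : Relation.ReflTransGen (PG G Z) p q) : M G Z (swap p q) (1120 * Fintype.card V ^ 2) := by
  have hr : (PGr G Z).Reachable p q := by
    clear hpq
    induction h with
    | refl => exact Reachable.refl _
    | tail _ h ih =>
      obtain ⟨w, -⟩ := PGr_walk h
      exact ih.trans ⟨w⟩
  obtain ⟨w, hw, hl⟩ := hr.exists_path_of_dist
  have hex : ∀ i < w.length, ∃ Q, Site.Valid G Q ∧ Att G Z (w.getVert i) Q ∧ Att G Z (w.getVert (i + 1)) Q ∧
      M G Z (swap (w.getVert i) (w.getVert (i + 1))) (70 * (Fintype.card V * (Z.card + Q.X.card))) := fun i hi =>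
    LL hG hP hZ hz (w.adj_getVert_succ hi).1 (w.adj_getVert_succ hi).2
  have : Nonempty (Site V) := ⟨⟨∅, 0⟩⟩
  choose! Q hQ using hex
  have hT : 0 < w.length := by
    by_contra h0
    exact hpq (Walk.eq_of_length_eq_zero (p := w) (by omega))
  have hPK := PACK hG hZ hz hp hl (Q := Q) (fun i hi => ⟨(hQ i hi).1, (hQ i hi).2.1, (hQ i hi).2.2.1⟩)
  have := swap_chain (G := G) (S := Z) w.getVert (fun i => 70 * (Fintype.card V * (Z.card + (Q i).X.card))) w.length (by
      intro i hi
      rcases Nat.eq_zero_or_pos i with rfl | h0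
      · simpa using hp
      · have := w.adj_getVert_succ (i := i - 1) (by omega)
        rw [Nat.sub_add_cancel h0] at this
        exact this.2.2.1) (by
      intro i hi j hj hij e
      exact hij (hw.getVert_injOn (by simpa using hi) (by simpa using hj) e)) (fun i hi => (hQ i hi).2.2.2) (w.length - 1) (by omega)
  rw [Nat.sub_add_cancel hT, Walk.getVert_zero, Walk.getVert_length] at this
  refine this.mono ?_
  rw [← Finset.mul_sum, ← Finset.mul_sum]
  nlinarith

lemma SORT {Z : Finset V} {R : V → V → Prop} (hsym : ∀ x y, R x y → R y x) (htr : ∀ x y z, R x y → R y z → R x z) {K : ℕ}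
    (hM : ∀ p q, p ∉ Z → q ∉ Z → p ≠ q → R p q → M G Z (swap p q) K) :
    ∀ m (σ : Perm V), (fl fun v => v ∉ Z ∧ σ v ≠ v).card ≤ m → Z.image σ = Z → (∀ p ∉ Z, R p (σ p)) →
    ∃ γ, M G Z γ (m * K) ∧ Z.image γ = Z ∧ ∀ v ∉ Z, γ v = σ v := by
  intro m
  induction m with
  | zero =>
    intro σ h1 h2 h3
    refine ⟨1, M.nil _, by simp, fun v hv => ?_⟩
    have : fl (fun v => v ∉ Z ∧ σ v ≠ v) = ∅ := Finset.card_eq_zero.1 (by omega)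
    by_contra h
    have h4 : v ∈ fl (fun v => v ∉ Z ∧ σ v ≠ v) := mem_fl.2 ⟨hv, fun e => h (by simp [e])⟩
    rw [this] at h4; simp at h4
  | succ m ih =>
    intro σ h1 h2 h3
    by_cases hex : ∃ v, v ∉ Z ∧ σ v ≠ v
    · obtain ⟨v, hv, hσv⟩ := hex
      have hout : ∀ x, x ∉ Z → σ x ∉ Z := fun x hx => by rw [← h2]; exact notin_image hx
      have hfix : (swap v (σ v) * σ) v = v := by simp
      obtain ⟨γ, m1, m2, m3⟩ := ih (swap v (σ v) * σ) (by
        have : fl (fun x => x ∉ Z ∧ (swap v (σ v) * σ) x ≠ x) ⊆ (fl fun v => v ∉ Z ∧ σ v ≠ v).erase v := by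
          intro x hx
          rw [mem_fl] at hx
          have hxv : x ≠ v := fun e => hx.2 (e ▸ hfix)
          refine Finset.mem_erase.2 ⟨hxv, mem_fl.2 ⟨hx.1, fun e => hx.2 ?_⟩⟩
          rw [Perm.mul_apply, e, swap_apply_of_ne_of_ne hxv]
          intro e2; exact hxv (σ.injective (e.trans e2))
        have := Finset.card_le_card this
        rw [Finset.card_erase_of_mem (mem_fl.2 ⟨hv, hσv⟩)] at this
        omega) (by rw [image_mul, h2, image_swap_notMem hv (hout v hv)]) (by
        intro p hp
        by_cases hpv : p = v
        · rw [hpv, hfix]; exact htr _ _ _ (h3 v hv) (hsym _ _ (h3 v hv))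
        · rw [Perm.mul_apply]
          by_cases e : σ p = v
          · rw [e, swap_apply_left]
            exact htr _ _ _ (e ▸ h3 p hp) (h3 v hv)
          · rw [swap_apply_of_ne_of_ne e (σ.injective.ne hpv)]; exact h3 p hp)
      have hs := hM v (σ v) hv (hout v hv) hσv.symm (h3 v hv)
      refine ⟨swap v (σ v) * γ, (m1.trans (by rw [m2]; exact hs)).mono (by rw [Nat.succ_mul]), ?_, fun x hx => ?_⟩
      · rw [image_mul, m2, image_swap_notMem hv (hout v hv)]
      · rw [Perm.mul_apply, m3 x hx, Perm.mul_apply, swap_apply_self]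
    · push Not at hex
      exact ⟨1, M.nil _, by simp, fun v hv => (hex v hv).symm⟩

lemma exists_cset (hG : G.Connected) : ∀ h, 1 ≤ h → h ≤ Fintype.card V → ∃ Z : Finset V, CSet G Z ∧ Z.card = h := by
  intro h
  induction h with
  | zero => intro h; omega
  | succ h ih =>
    intro _ hle
    rcases Nat.eq_zero_or_pos h with rfl | h0
    · obtain ⟨v⟩ := hG.nonempty
      refine ⟨{v}, fun x hx y hy => ?_, by simp⟩
      simp at hx hy; rw [hx, hy]
    · obtain ⟨Z, hZ, hc⟩ := ih h0 (by omega)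
      obtain ⟨z, hz⟩ := Finset.card_pos.1 (show 0 < Z.card by omega)
      obtain ⟨x, hx⟩ : ∃ x, x ∉ Z := by
        by_contra hcon
        push Not at hcon
        have : Z = Finset.univ := Finset.eq_univ_iff_forall.2 hcon
        rw [this, Finset.card_univ] at hc; omega
      obtain ⟨a, ha, b, hb, hab⟩ := exists_bd hG hz hx
      refine ⟨insert b Z, ?_, by rw [Finset.card_insert_of_notMem hb, hc]⟩
      have key : ∀ y ∈ insert b Z, (kp G (insert b Z : Finset V)).Reachable a y := by
        intro y hy
        rcases Finset.mem_insert.1 hy with rfl | hy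
        · exact Adj.reachable ⟨hab, by simp [ha], by simp⟩
        · exact (hZ a ha y hy).mono (kp_mono (by simp))
      exact fun x hx y hy => (key x hx).symm.trans (key y hy)

lemma univ_cset (hG : G.Connected) : CSet G (Finset.univ : Finset V) := fun x _ y _ => by
  rw [Finset.coe_univ, kp_univ]; exact hG.preconnected x y

lemma gather (hG : G.Connected) {S Z : Finset V} (h : Z.card = S.card) : ∃ β, M G S β (Fintype.card V ^ 2) ∧ S.image β = Z := by
  obtain ⟨β, h1, h2, -⟩ := UL (S := S) (univ_cset hG) (Finset.subset_univ Z) (by rw [Finset.inter_univ, h])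
  refine ⟨β, h1.mono ?_, (Finset.eq_of_subset_of_card_le h2 ?_).symm⟩
  · rw [sq]; exact Nat.mul_le_mul_right _ (Finset.card_le_univ _)
  · rw [Finset.card_image_of_injective _ β.injective, h]

lemma general (hG : G.Connected) (hP : ¬ Pure G) {S : Finset V} (hS : S.Nonempty) {γ : Perm V} {c : ℕ} (hM : M G S γ c) :
    ∃ γ', (∀ v ∉ S, γ' v = γ v) ∧ M G S γ' (1122 * Fintype.card V ^ 3) := by
  obtain ⟨Z, hZ, hc⟩ := exists_cset hG S.card (Finset.card_pos.2 hS) (Finset.card_le_univ _)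
  obtain ⟨z, hz⟩ := Finset.card_pos.1 (hc ▸ Finset.card_pos.2 hS)
  obtain ⟨β, b1, b2⟩ := gather hG hc
  obtain ⟨β', b1', b2'⟩ := gather hG (S := S.image γ) (hc.trans (Finset.card_image_of_injective _ γ.injective).symm)
  have hZS : Z.image (β⁻¹ : Perm V) = S := image_inv_of b2
  have m1 : M G Z (β' * (γ * β⁻¹)) _ := ((b1.symm' b2).trans (by rw [hZS]; exact hM)).trans (by rw [image_mul, hZS]; exact b1')
  have himg : Z.image (β' * (γ * β⁻¹) : Perm V) = Z := by rw [image_mul, image_mul, hZS, b2']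
  obtain ⟨δ, d1, d2, d3⟩ := SORT (G := G) (Z := Z) (R := Relation.ReflTransGen (PG G Z)) (K := 1120 * Fintype.card V ^ 2)
    (fun x y h => by
      induction h with
      | refl => exact .refl
      | tail _ h ih => exact .head ⟨h.2.1, h.1, h.2.2.imp fun _ h => ⟨h.1, h.2.2, h.2.1⟩⟩ ih)
    (fun _ _ _ => Relation.ReflTransGen.trans) (fun p q hp _ hpq h => SWP hG hP hZ hz hp hpq h) (Fintype.card V)
    (β' * (γ * β⁻¹)) (Finset.card_le_univ _) himg (fun p hp => PG_reach hG hZ hz m1 himg hp)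
  refine ⟨β'⁻¹ * (δ * β), fun v hv => ?_, ((b1.trans (by rw [b2]; exact d1)).trans (by
    rw [image_mul, b2, d2]; exact b1'.symm' b2')).mono ?_⟩
  · have : β v ∉ Z := by rw [← b2]; exact notin_image hv
    rw [Perm.mul_apply, Perm.mul_apply, d3 _ this]
    simp
  · have : 1 ≤ Fintype.card V := Fintype.card_pos_iff.2 ⟨z⟩
    have e : Fintype.card V ^ 3 = Fintype.card V * Fintype.card V ^ 2 := by ring
    have : 1 * Fintype.card V ^ 2 ≤ Fintype.card V * Fintype.card V ^ 2 := Nat.mul_le_mul_right _ this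
    rw [e]; nlinarith

end P5
end CM

open SimpleGraph
namespace CM
open Equiv Equiv.Perm
set_option linter.unusedSectionVars false
section P6
variable {V : Type} [Fintype V] [DecidableEq V] {G : SimpleGraph V}

open Classical in
noncomputable def cd (g : Perm V) (x y : V) : ℕ := if h : ∃ k : ℕ, (g ^ k) x = y then Nat.find h else 0

def Full (g : Perm V) : Prop := ∀ x y, ∃ k : ℕ, (g ^ k) x = y

lemma cd_spec {g : Perm V} (hg : Full g) (x y : V) : (g ^ cd g x y) x = y := by
  unfold cd; rw [dif_pos (hg x y)]; exact Nat.find_spec (hg x y)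

lemma cd_le {g : Perm V} (hg : Full g) {x y : V} {k : ℕ} (h : (g ^ k) x = y) : cd g x y ≤ k := by
  unfold cd; rw [dif_pos (hg x y)]; exact Nat.find_le h

lemma cd_succ {g : Perm V} (hg : Full g) {x y : V} (h : x ≠ y) : cd g x y = cd g (g x) y + 1 := by
  have h1 := cd_spec hg x y
  have h2 := cd_spec hg (g x) y
  have h3 : cd g x y ≠ 0 := fun e => by rw [e] at h1; exact h h1
  obtain ⟨k, hk⟩ := Nat.exists_eq_succ_of_ne_zero h3
  apply le_antisymm
  · refine cd_le hg ?_
    rw [pow_succ, Perm.mul_apply]; exact h2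
  · rw [hk] at h1 ⊢
    rw [Nat.succ_eq_add_one, pow_succ, Perm.mul_apply] at h1
    have := cd_le hg h1
    omega

lemma cd_shift {g : Perm V} (hg : Full g) (x y : V) : cd g (g x) (g y) = cd g x y := by
  apply le_antisymm
  · refine cd_le hg ?_
    rw [← Perm.mul_apply, ← pow_succ, pow_succ', Perm.mul_apply, cd_spec hg]
  · refine cd_le hg (g.injective ?_)
    rw [← Perm.mul_apply, ← pow_succ', pow_succ, Perm.mul_apply, cd_spec hg]

lemma cd_shift' {g : Perm V} (hg : Full g) (x y : V) : cd g (g⁻¹ x) (g⁻¹ y) = cd g x y := by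
  rw [← cd_shift hg, aii, aii]

lemma cd_r {g : Perm V} (hg : Full g) {x y : V} (h : x ≠ g y) : cd g x (g y) = cd g x y + 1 := by
  rw [cd_succ hg h, cd_shift hg]

lemma cd_inj {g : Perm V} (hg : Full g) {x y y' : V} (h : cd g x y = cd g x y') : y = y' := by
  rw [← cd_spec hg x y, h, cd_spec hg]

lemma rot_key {g δ : Perm V} (hδ : Rot G δ) (h : ∀ v, δ v ≠ v → δ v = g v ∨ δ v = g⁻¹ v) {v0 : V} (h0 : δ v0 ≠ v0)
    (h1 : δ v0 = g v0) : ∀ k : ℕ, δ ((g ^ k) v0) = g ((g ^ k) v0) ∧ g ((g ^ k) v0) ≠ (g ^ k) v0 := by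
  intro k
  induction k with
  | zero => exact ⟨h1, h1 ▸ h0⟩
  | succ k ih =>
    rw [pow_succ', Perm.mul_apply]
    obtain ⟨a, b⟩ := ih
    have hne : g (g ((g ^ k) v0)) ≠ g ((g ^ k) v0) := g.injective.ne b
    refine ⟨?_, hne⟩
    have hm : δ (g ((g ^ k) v0)) ≠ g ((g ^ k) v0) := fun e => b (δ.injective (e.trans a.symm))
    rcases h _ hm with h | h
    · exact h
    · exfalso
      rw [iai] at h
      have := (hδ _ (a ▸ b)).2
      rw [a] at this
      exact this h

lemma rot_eq {g δ : Perm V} (hg : Full g) (hδ : Rot G δ) (h : ∀ v, δ v ≠ v → δ v = g v ∨ δ v = g⁻¹ v) {v0 : V} (h0 : δ v0 ≠ v0)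
    (h1 : δ v0 = g v0) : δ = g := by
  ext v
  obtain ⟨k, rfl⟩ := hg v0 v
  exact (rot_key hδ h h0 h1 k).1

lemma ord_step {g δ : Perm V} {S : Finset V} {d : ℕ} (hg : Full g) (hadj : ∀ u v, G.Adj u v → v = g u ∨ u = g v) (hE : E G S δ d)
    {x0 x y : V} (h0 : x0 ∉ S) (hx : x ∉ S) (hy : y ∉ S) (hx0 : x ≠ x0) (hy0 : y ≠ x0) (hlt : cd g x0 x < cd g x0 y) :
    cd g (δ x0) (δ x) < cd g (δ x0) (δ y) := by
  have hxy : x ≠ y := fun e => by rw [e] at hlt; omega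
  cases hE with
  | rot _ hr =>
    have hδ : ∀ v, δ v ≠ v → δ v = g v ∨ δ v = g⁻¹ v := fun v hv => by
      rcases hadj _ _ (hr v hv).1 with h | h
      · exact Or.inl h
      · right; rw [eq_comm, Perm.inv_eq_iff_eq]; exact h
    by_cases h1 : ∃ v, δ v ≠ v ∧ δ v = g v
    · obtain ⟨v, h1, h2⟩ := h1
      rw [rot_eq hg hr hδ h1 h2, cd_shift hg, cd_shift hg]; exact hlt
    · by_cases h3 : ∃ v, δ v ≠ v
      · obtain ⟨v, hv⟩ := h3
        have hg' : Full g⁻¹ := fun a b => by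
          obtain ⟨k, hk⟩ := hg b a
          exact ⟨k, by rw [inv_pow, Perm.inv_eq_iff_eq]; exact hk.symm⟩
        have : δ = g⁻¹ := rot_eq hg' hr (fun v hv => by rw [inv_inv]; exact (hδ v hv).symm) hv ((hδ v hv).resolve_left fun e => h1 ⟨v, hv, e⟩)
        rw [this, cd_shift' hg, cd_shift' hg]; exact hlt
      · push Not at h3
        rw [h3, h3, h3]; exact hlt
  | sw p q hq ha =>
    have e1 := cd_succ hg hx0.symm
    have e2 := cd_succ hg hy0.symm
    have n0 := (nem h0 hq)
    have nx := (nem hx hq)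
    have ny := (nem hy hq)
    rcases hadj _ _ ha with h | h
    · subst h
      by_cases c0 : x0 = p
      · subst c0
        rw [swap_apply_left, swap_apply_of_ne_of_ne hx0 nx, swap_apply_of_ne_of_ne hy0 ny]
        omega
      · rw [swap_apply_of_ne_of_ne c0 n0]
        by_cases cx : x = p
        · subst cx
          rw [swap_apply_left, swap_apply_of_ne_of_ne hxy.symm ny, cd_r hg n0]
          have : cd g x0 (g x) ≠ cd g x0 y := fun e => ny (cd_inj hg e).symm
          rw [cd_r hg n0] at this
          omega
        · rw [swap_apply_of_ne_of_ne cx nx]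
          by_cases cy : y = p
          · subst cy
            rw [swap_apply_left, cd_r hg n0]; omega
          · rw [swap_apply_of_ne_of_ne cy ny]; exact hlt
    · subst h
      by_cases c0 : x0 = g q
      · subst c0
        rw [swap_apply_left, swap_apply_of_ne_of_ne hx0 nx, swap_apply_of_ne_of_ne hy0 ny, cd_succ hg nx.symm, cd_succ hg ny.symm]
        omega
      · rw [swap_apply_of_ne_of_ne c0 n0]
        have hq' := cd_r hg c0
        by_cases cx : x = g q
        · subst cx
          rw [swap_apply_left, swap_apply_of_ne_of_ne hxy.symm ny]
          omega
        · rw [swap_apply_of_ne_of_ne cx nx]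
          by_cases cy : y = g q
          · subst cy
            rw [swap_apply_left]
            have : cd g x0 x ≠ cd g x0 q := fun e => nx (cd_inj hg e)
            omega
          · rw [swap_apply_of_ne_of_ne cy ny]; exact hlt

lemma ord_inv {g γ : Perm V} {S : Finset V} {c : ℕ} (hg : Full g) (hadj : ∀ u v, G.Adj u v → v = g u ∨ u = g v) (hM : M G S γ c)
    {x0 x y : V} (h0 : x0 ∉ S) (hx : x ∉ S) (hy : y ∉ S) (hx0 : x ≠ x0) (hy0 : y ≠ x0) (hlt : cd g x0 x < cd g x0 y) :
    cd g (γ x0) (γ x) < cd g (γ x0) (γ y) := by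
  induction hM with
  | nil => exact hlt
  | @cons γ δ c d hM hE ih =>
    exact ord_step hg hadj hE (notin_image h0) (notin_image hx) (notin_image hy) (γ.injective.ne hx0) (γ.injective.ne hy0) ih

lemma mono_id {σ : Perm V} {S : Finset V} (f : V → ℕ) (hS : S.image σ = S) (hm : ∀ u ∈ S, ∀ v ∈ S, f u < f v → f (σ u) < f (σ v))
    (hf : ∀ u v, f u = f v → u = v) : ∀ m, ∀ v ∈ S, f v = m → σ v = v := by
  intro m
  induction m using Nat.strong_induction_on with
  | _ m ih =>
    intro v hv hm'
    subst hm'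
    have hσ : ∀ u, u ∈ S → σ u ∈ S := fun u hu => by rw [← hS]; exact Finset.mem_image_of_mem _ hu
    rcases lt_trichotomy (f (σ v)) (f v) with h | h | h
    · exact σ.injective (ih _ h (σ v) (hσ v hv) rfl)
    · exact hf _ _ h
    · have hv' := hv
      rw [← hS, Finset.mem_image] at hv'
      obtain ⟨w, hw, hwv⟩ := hv'
      rcases lt_trichotomy (f w) (f v) with h' | h' | h'
      · have := ih _ h' w hw rfl
        rw [← this.symm.trans hwv]; exact this
      · rw [hf _ _ h'] at hwv; exact hwv
      · have := hm v hv w hw h'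
        rw [hwv] at this; omega

lemma pureCase (hP : Pure G) {S : Finset V} {γ : Perm V} {c : ℕ} (hM : M G S γ c) :
    ∃ γ', (∀ v ∉ S, γ' v = γ v) ∧ M G S γ' (1122 * Fintype.card V ^ 3) := by
  obtain ⟨g, hg, hu, hadj⟩ := hP
  have hFull : Full g := fun x y => by
    have hs : SameCycle g x y := hg.2.sameCycle (Equiv.Perm.mem_support.1 (by rw [hu]; simp)) (Equiv.Perm.mem_support.1 (by rw [hu]; simp))
    obtain ⟨i, -, hi⟩ := hs.exists_pow_eq'
    exact ⟨i, hi⟩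
  by_cases hS : ∃ p, p ∉ S
  · obtain ⟨p, hp⟩ := hS
    have hn : 1 ≤ Fintype.card V := Fintype.card_pos_iff.2 ⟨p⟩
    have hs : SameCycle g p (γ p) := hg.2.sameCycle (Equiv.Perm.mem_support.1 (by rw [hu]; simp)) (Equiv.Perm.mem_support.1 (by rw [hu]; simp))
    obtain ⟨i, hi, hi2⟩ := hs.exists_pow_eq'
    have hi' : i ≤ Fintype.card V := hi.le.trans (hg.2.orderOf ▸ Finset.card_le_univ _)
    have m1 := ((AW.rot hg.1).pow i).2 S (by simp)
    obtain ⟨ζ, z1, z2, z3⟩ := UL (S := S.image (g ^ i : Perm V)) (D := Finset.univ.erase (γ p)) (B := S.image γ) (by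
        intro x hx y hy
        refine (cyc_reach hg (p := γ p) (by rw [hu]; simp) (by rw [hu]; simp) (Finset.ne_of_mem_erase hx) (Finset.ne_of_mem_erase hy)).mono
          (kp_mono ?_)
        rintro v ⟨-, hv⟩; simp [hv]) (by
        intro x hx
        simp only [Finset.mem_erase, Finset.mem_univ, and_true]
        rintro rfl; exact notin_image hp hx) (by
        rw [Finset.inter_eq_left.2, Finset.card_image_of_injective _ γ.injective, Finset.card_image_of_injective _ (g ^ i).injective]
        intro x hx
        simp only [Finset.mem_erase, Finset.mem_univ, and_true]
        rintro rfl; rw [← hi2] at hx; exact notin_image hp hx)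
    have hz : (S.image (g ^ i : Perm V)).image ζ = S.image γ := by
      refine (Finset.eq_of_subset_of_card_le z2 ?_).symm
      rw [Finset.card_image_of_injective _ ζ.injective, Finset.card_image_of_injective _ γ.injective, Finset.card_image_of_injective _ (g ^ i).injective]
    have hzp : (ζ * g ^ i) p = γ p := by rw [Perm.mul_apply, hi2]; exact z3 _ (by simp)
    have m2 := m1.trans z1
    rw [← image_mul] at hz
    set β := ζ * g ^ i with hβ
    have m3 := hM.trans (m2.symm' hz)
    have himg : S.image (β⁻¹ * γ : Perm V) = S := by rw [image_mul]; exact image_inv_of hz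
    have hpp : (β⁻¹ * γ) p = p := by rw [Perm.mul_apply, ← hzp, iai]
    have hid : ∀ v ∉ S, (β⁻¹ * γ) v = v := by
      intro v hv
      by_cases e : v = p
      · rw [e, hpp]
      refine mono_id (S := Finset.univ.filter (fun v => v ∉ S ∧ v ≠ p)) (cd g p) ?_ ?_ (fun u v => cd_inj hFull) _ v (by simp [hv, e]) rfl
      · refine Finset.eq_of_subset_of_card_le ?_ (by rw [Finset.card_image_of_injective _ (β⁻¹ * γ).injective])
        intro x hx
        obtain ⟨y, hy, rfl⟩ := Finset.mem_image.1 hx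
        simp only [Finset.mem_filter, Finset.mem_univ, true_and] at hy ⊢
        refine ⟨?_, fun e => hy.2 ((β⁻¹ * γ).injective (e.trans hpp.symm))⟩
        have := notin_image (γ := β⁻¹ * γ) hy.1
        rwa [himg] at this
      · intro u hu v hv hlt
        simp only [Finset.mem_filter, Finset.mem_univ, true_and] at hu hv
        have := ord_inv hFull hadj m3 hp hu.1 hv.1 hu.2 hv.2 hlt
        rwa [hpp] at this
    refine ⟨β, fun v hv => ?_, m2.mono ?_⟩
    · have := hid v hv
      rw [Perm.mul_apply, Perm.inv_eq_iff_eq] at this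
      exact this.symm
    · have h1 := Nat.mul_le_mul_right (Fintype.card V) hi'
      have h2 := Nat.mul_le_mul_right (Fintype.card V) (Finset.card_le_univ (S.image γ))
      have e : Fintype.card V ^ 3 = Fintype.card V * (Fintype.card V * Fintype.card V) := by ring
      have h3 : 1 * (Fintype.card V * Fintype.card V) ≤ Fintype.card V * (Fintype.card V * Fintype.card V) := Nat.mul_le_mul_right _ hn
      rw [e]; omega
  · push Not at hS
    exact ⟨1, fun v hv => absurd (hS v) hv, M.nil _⟩

end P6
end CM

open SimpleGraph
namespace CM
open Equiv Equiv.Perm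
set_option linter.unusedSectionVars false
section P7a
variable {V : Type} [Fintype V] [DecidableEq V] {G : SimpleGraph V}

def IG (G : SimpleGraph V) : SimpleGraph (Perm V) where
  Adj g h := g ≠ h ∧ Cyc G g ∧ Cyc G h ∧ ∃ v, v ∈ g.support ∧ v ∈ h.support
  symm := ⟨fun _ _ ⟨a, b, c, v, d, e⟩ => ⟨a.symm, c, b, v, e, d⟩⟩
  loopless := ⟨fun _ h => h.1 rfl⟩

lemma cyc_to {g : Perm V} (hg : Cyc G g) {x y : V} (hx : x ∈ g.support) (hy : y ∈ g.support) :
    ∃ i, i < g.support.card ∧ (g ^ i) x = y ∧ AW G ∅ (g ^ i) (g.support.card * Fintype.card V) := by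
  have hs := hg.2.sameCycle (Equiv.Perm.mem_support.1 hx) (Equiv.Perm.mem_support.1 hy)
  obtain ⟨i, hi, h⟩ := hs.exists_pow_eq'
  have hi' : i < g.support.card := lt_of_lt_of_le hi hg.2.orderOf.le
  exact ⟨i, hi', h, ((AW.rot hg.1).pow i).mono (Nat.mul_le_mul_right _ hi'.le)⟩

lemma pow_fix {g : Perm V} {v : V} (h : v ∉ g.support) (i : ℕ) : (g ^ i) v = v := by
  by_contra hc
  exact h (support_pow_le g i (Equiv.Perm.mem_support.2 hc))

lemma sum_split (k : ℕ) (C : ℕ → Finset V) (h : ∀ i j, i + 1 < j → j ≤ k → Disjoint (C i) (C j)) :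
    ∑ i ∈ Finset.range (k+1), (C i).card ≤ 2 * Fintype.card V := by
  rw [← Finset.sum_filter_add_sum_filter_not _ (fun i => Even i), two_mul]
  refine Nat.add_le_add (disj_sum _ _ ?_) (disj_sum _ _ ?_) <;>
  · intro i hi j hj hij
    simp only [Finset.mem_filter, Finset.mem_range] at hi hj
    have : i + 1 ≠ j := by rintro rfl; exact absurd hj.2 (by simp [hi.2, Nat.even_add_one])
    have : j + 1 ≠ i := by rintro rfl; exact absurd hi.2 (by simp [hj.2, Nat.even_add_one])
    rcases lt_or_gt_of_ne hij with hl | hl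
    · exact h i j (by omega) (by omega)
    · exact (h j i (by omega) (by omega)).symm

lemma TR (hG : G.Connected) (hE : ∀ u v, G.Adj u v → ∃ g, Cyc G g ∧ u ∈ g.support ∧ v ∈ g.support) {O : Perm V}
    (hO : Cyc G O) {x : V} (hx : x ∉ O.support) : ∃ C z e ψ, Cyc G C ∧ z ∈ O.support ∧ z ∈ C.support ∧ e ∈ C.support ∧
      e ∉ O.support ∧ AW G ∅ ψ (2 * Fintype.card V ^ 2) ∧ ψ e = x ∧ ∀ v ∈ O.support, ψ v = v := by
  obtain ⟨o, ho⟩ : O.support.Nonempty := Finset.nonempty_iff_ne_empty.2 fun h => hO.2.ne_one (support_eq_empty_iff.1 h)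
  obtain ⟨C, hC, hxC, hr⟩ : ∃ C, Cyc G C ∧ x ∈ C.support ∧ (IG G).Reachable O C := by
    obtain ⟨w⟩ := hG.preconnected o x
    have : ∀ {a b : V} (w : G.Walk a b), (∃ C, Cyc G C ∧ a ∈ C.support ∧ (IG G).Reachable O C) →
        ∃ C, Cyc G C ∧ b ∈ C.support ∧ (IG G).Reachable O C := by
      intro a b w
      induction w with
      | nil => exact id
      | cons h _ ih =>
        rintro ⟨C, hC, ha, hr⟩
        obtain ⟨g, hg, h1, h2⟩ := hE _ _ h
        refine ih ⟨g, hg, h2, ?_⟩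
        by_cases e : C = g
        · exact e ▸ hr
        · exact hr.trans (Adj.reachable ⟨e, hC, hg, _, ha, h1⟩)
    exact this w ⟨O, hO, ho, Reachable.refl _⟩
  obtain ⟨w, hl⟩ := hr.exists_walk_length_eq_dist
  have hk : 1 ≤ w.length := by
    by_contra hc
    have := w.eq_of_length_eq_zero (by omega)
    exact hx (this ▸ hxC)
  have hadj : ∀ i < w.length, (IG G).Adj (w.getVert i) (w.getVert (i+1)) := fun i hi => w.adj_getVert_succ hi
  have hcy : ∀ i ≤ w.length, Cyc G (w.getVert i) := by
    intro i hi
    rcases Nat.eq_zero_or_pos i with rfl | h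
    · simpa using hO
    · have := (hadj (i-1) (by omega)).2.2.1
      rwa [Nat.sub_add_cancel h] at this
  have hdis : ∀ i j, i + 1 < j → j ≤ w.length → Disjoint (w.getVert i).support (w.getVert j).support := by
    intro i j hij hj
    rw [Finset.disjoint_left]
    intro v h1 h2
    by_cases e : w.getVert i = w.getVert j
    · have := geo_short hl (by omega : i ≤ j) hj (Walk.nil.copy rfl e)
      simp at this; omega
    · have ha : (IG G).Adj (w.getVert i) (w.getVert j) := ⟨e, hcy i (by omega), hcy j hj, v, h1, h2⟩
      have := geo_short hl (by omega : i ≤ j) hj ha.toWalk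
      rw [Walk.length_cons, Walk.length_nil] at this; omega
  obtain ⟨z, hz1, hz2⟩ := (hadj 0 (by omega)).2.2.2
  rw [Walk.getVert_zero] at hz1
  rcases Nat.lt_or_ge 1 w.length with h2 | h2
  · obtain ⟨e, he1, he2⟩ := (hadj 1 h2).2.2.2
    have hfix : ∀ j, 2 ≤ j → j ≤ w.length → ∀ v ∈ O.support, v ∉ (w.getVert j).support := by
      intro j hj hjl v hv
      have := hdis 0 j (by omega) hjl
      rw [Walk.getVert_zero] at this
      exact Finset.disjoint_left.1 this hv
    have key : ∀ j, j + 2 ≤ w.length → ∀ y ∈ (w.getVert (j+2)).support, ∃ ψ,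
        AW G ∅ ψ (∑ i ∈ Finset.range (j+3), (w.getVert i).support.card * Fintype.card V) ∧ ψ e = y ∧ ∀ v ∈ O.support, ψ v = v := by
      intro j
      induction j with
      | zero =>
        intro hj y hy
        obtain ⟨i, -, h, ha⟩ := cyc_to (hcy 2 hj) he2 hy
        refine ⟨_, ha.mono ?_, h, fun v hv => pow_fix (hfix 2 le_rfl hj v hv) i⟩
        rw [Finset.sum_range_succ]; exact Nat.le_add_left _ _
      | succ j ih =>
        intro hj y hy
        obtain ⟨y', hy1, hy2⟩ := (hadj (j+2) (by omega)).2.2.2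
        obtain ⟨ψ, h1, h2, h3⟩ := ih (by omega) y' hy1
        obtain ⟨i, -, h, ha⟩ := cyc_to (hcy (j+1+2) hj) hy2 hy
        refine ⟨_, (h1.mul ha).mono ?_, by rw [Perm.mul_apply, h2, h], fun v hv => ?_⟩
        · rw [Finset.sum_range_succ _ (j+1+2)]
        · rw [Perm.mul_apply, h3 v hv]
          exact pow_fix (hfix _ (by omega) hj v hv) i
    obtain ⟨ψ, h1, h3, h4⟩ := key (w.length - 2) (by omega) x (by
      rw [Nat.sub_add_cancel h2, Walk.getVert_length]; exact hxC)
    refine ⟨w.getVert 1, z, e, ψ, hcy 1 (by omega), hz1, hz2, he1, fun h => hfix 2 le_rfl h2 e h he2, h1.mono ?_, h3, h4⟩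
    rw [← Finset.sum_mul, pow_two, ← mul_assoc]
    have := sum_split w.length (fun i => (w.getVert i).support) hdis
    rw [show w.length - 2 + 3 = w.length + 1 by omega]
    exact Nat.mul_le_mul_right _ this
  · have e1 : w.length = 1 := by omega
    have e2 : w.getVert 1 = C := by rw [← e1, Walk.getVert_length]
    rw [show 0 + 1 = 1 from rfl, e2] at hz2
    exact ⟨C, z, x, 1, hC, hz1, hz2, hxC, hx, AW.one, rfl, fun _ _ => rfl⟩

end P7a
end CM

open SimpleGraph
namespace CM
open Equiv Equiv.Perm
set_option linter.unusedSectionVars false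
section P7b
variable {V : Type} [Fintype V] [DecidableEq V] {G : SimpleGraph V}

def Rich (G : SimpleGraph V) (g : Perm V) : Prop := ∃ o ∈ g.support, AW G ∅ (swap o (g o)) (3 * Fintype.card V)

lemma first_split {P : V → Prop} : ∀ {l : List V}, (∃ x ∈ l, P x) → ∃ A p B, l = A ++ p :: B ∧ P p ∧ ∀ a ∈ A, ¬ P a
  | [], h => by simp at h
  | y :: l, h => by
    by_cases hy : P y
    · exact ⟨[], y, l, rfl, hy, by simp⟩
    · obtain ⟨A, p, B, e, hp, hA⟩ := first_split (P := P) (l := l) (by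
        obtain ⟨x, hx, h⟩ := h
        rcases List.mem_cons.1 hx with rfl | hx
        · exact absurd h hy
        · exact ⟨x, hx, h⟩)
      refine ⟨y :: A, p, B, by rw [e]; rfl, hp, fun a ha => ?_⟩
      rcases List.mem_cons.1 ha with rfl | ha
      · exact hy
      · exact hA a ha

lemma last_split {P : V → Prop} {l : List V} (h : ∃ x ∈ l, P x) : ∃ A p B, l = A ++ p :: B ∧ P p ∧ ∀ a ∈ B, ¬ P a := by
  obtain ⟨A, p, B, e, hp, hA⟩ := first_split (P := P) (l := l.reverse) (by simpa using h)
  refine ⟨B.reverse, p, A.reverse, ?_, hp, by simpa using hA⟩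
  have := congrArg List.reverse e
  simpa using this

lemma EAR {g g' : Perm V} (hg : Cyc G g) (hg' : Cyc G g') {p q e : V} (hpq : p ≠ q) (hp : p ∈ g.support) (hp' : p ∈ g'.support)
    (hq : q ∈ g.support) (hq' : q ∈ g'.support) (he : e ∉ g.support) (he' : e ∈ g'.support) : Rich G g := by
  obtain ⟨l, hn, -, hs, hl⟩ := cyc_list hg' he'
  have hpl : p ∈ l := by
    have := (hs p).1 hp'
    rcases List.mem_cons.1 this with rfl | h
    · exact absurd hp he
    · exact h
  have hql : q ∈ l := by
    have := (hs q).1 hq'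
    rcases List.mem_cons.1 this with rfl | h
    · exact absurd hq he
    · exact h
  obtain ⟨A, a, R, rfl, ha, hA⟩ := first_split (P := fun x => x ∈ g.support) ⟨p, hpl, hp⟩
  obtain ⟨B, b, D, rfl, hb, hD⟩ := last_split (P := fun x => x ∈ g.support) (l := R) (by
    have h1 : ∀ x, x ∈ g.support → x ∈ A ++ a :: R → x ≠ a → x ∈ R := by
      intro x hx hxl hxa
      rcases List.mem_append.1 hxl with h | h
      · exact absurd hx (hA x h)
      · exact (List.mem_cons.1 h).resolve_left hxa
    by_cases e : p = a
    · exact ⟨q, h1 q hq hql (e ▸ hpq.symm), hq⟩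
    · exact ⟨p, h1 p hp hpl e, hp⟩)
  refine RICH hg hb ha ?_ (X := D ++ e :: A) ?_ ?_ ?_ (by simp)
  · rintro rfl
    simp [List.nodup_cons, List.nodup_append] at hn
  · refine List.Perm.nodup (l := e :: A ++ D) ?_ ?_
    · simp; exact (List.perm_middle.trans (List.Perm.cons _ List.perm_append_comm)).symm
    · refine hn.sublist ?_
      have : List.Sublist D (a :: (B ++ b :: D)) := ((List.sublist_cons_self b D).trans (List.sublist_append_right B _)).cons _
      simpa using this
  · intro x hx
    simp only [List.mem_append, List.mem_cons] at hx
    rcases hx with h | rfl | h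
    · exact hD x h
    · exact he
    · exact hA x h
  · have e1 : e :: (A ++ a :: (B ++ b :: D)) ++ [e] = ((e :: A ++ [a]) ++ B) ++ (b :: D ++ [e]) := by simp
    rw [e1, List.append_assoc] at hl
    have h1 := hl.left_of_append
    have h2 := hl.right_of_append.right_of_append
    have e2 : b :: (D ++ e :: A) ++ [a] = (b :: D) ++ ([e] ++ (A ++ [a])) := by simp
    rw [e2, ← List.append_assoc]
    exact List.IsChain.append_overlap h2 (by simpa using h1) (by simp)

lemma chord_or {g : Perm V} (hg : Cyc G g) (hr : ¬ Rich G g) {u v : V} (hu : u ∈ g.support) (hv : v ∈ g.support) (h : G.Adj u v) :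
    v = g u ∨ u = g v := by
  by_contra hc
  push Not at hc
  exact hr (RICH hg hu hv h.ne (X := []) (by simp) (by simp) (by simpa using h) (fun _ => hc))

lemma CHORD {O g : Perm V} (hO : Cyc G O) (hg : Cyc G g) (hs : O.support ⊆ g.support) {e : V} (he : e ∈ g.support)
    (heO : e ∉ O.support) : Rich G g := by
  by_contra hr
  have h : ∀ v, O v ≠ v → O v = g v ∨ O v = g⁻¹ v := by
    intro v hv
    have hv' := Equiv.Perm.mem_support.2 hv
    rcases chord_or hg hr (hs hv') (hs (Equiv.Perm.apply_mem_support.2 hv')) (hO.1 v hv).1 with h | h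
    · exact Or.inl h
    · right; rw [eq_comm, Perm.inv_eq_iff_eq]; exact h
  obtain ⟨o, ho⟩ : O.support.Nonempty := Finset.nonempty_iff_ne_empty.2 fun h => hO.2.ne_one (support_eq_empty_iff.1 h)
  have ho' := Equiv.Perm.mem_support.1 ho
  have : ∃ g', (∀ v, O v ≠ v → O v = g' v ∨ O v = g'⁻¹ v) ∧ O o = g' o ∧ Cyc G g' ∧ o ∈ g'.support ∧ e ∈ g'.support := by
    rcases h o ho' with h1 | h1
    · exact ⟨g, h, h1, hg, hs ho, he⟩
    · exact ⟨g⁻¹, fun v hv => by rw [inv_inv]; exact (h v hv).symm, h1, hg.inv, by rw [support_inv]; exact hs ho,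
        by rw [support_inv]; exact he⟩
  obtain ⟨g', h1, h2, h3, h4, h5⟩ := this
  obtain ⟨i, -, hi, -⟩ := cyc_to h3 h4 h5
  have := rot_key hO.1 h1 ho' h2 i
  rw [hi] at this
  exact heO (Equiv.Perm.mem_support.2 (this.1 ▸ this.2))

lemma not_full {g : Perm V} (hP : ¬ Pure G) (hg : Cyc G g) (hr : ¬ Rich G g) : ∃ x, x ∉ g.support := by
  by_contra hc
  push Not at hc
  exact hP ⟨g, hg, Finset.eq_univ_iff_forall.2 hc, fun u v h => chord_or hg hr (hc u) (hc v) h⟩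

lemma caseA (hG : G.Connected) (hE : ∀ u v, G.Adj u v → ∃ g, Cyc G g ∧ u ∈ g.support ∧ v ∈ g.support) {O : Perm V}
    (hO : Cyc G O) (hr : Rich G O) : ∀ x y, x ≠ y → AW G ∅ (swap x y) (162 * Fintype.card V ^ 2) := by
  classical
  obtain ⟨O, ⟨hO, hr⟩, hmax⟩ := Set.Finite.exists_maximalFor (fun g : Perm V => g.support.card) {g | Cyc G g ∧ Rich G g}
    (Set.toFinite _) ⟨O, hO, hr⟩
  have hin : ∀ x y, x ∈ O.support → y ∈ O.support → x ≠ y → AW G ∅ (swap x y) (16 * Fintype.card V ^ 2) := fun x y hx hy hxy =>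
    ⟨by simp, fun S _ => (rich_swap hO hr hx hy hxy S).mono (by
      have := Finset.card_le_univ O.support
      rw [pow_two]; exact Nat.mul_le_mul_left _ (Nat.mul_le_mul_left _ this))⟩
  have hmix : ∀ p x, p ∈ O.support → x ∉ O.support → AW G ∅ (swap p x) (54 * Fintype.card V ^ 2) := by
    intro p x hp hx
    obtain ⟨C, z, e, ψ, hC, hz, hzC, he, heO, hψ, hψe, hψO⟩ := TR hG hE hO hx
    obtain ⟨o, ho, hoC⟩ : ∃ o, o ∈ O.support ∧ o ∉ C.support := by
      by_contra hc
      push Not at hc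
      have h1 : O.support ⊂ C.support := ⟨hc, fun h => heO (h he)⟩
      have := hmax (j := C) ⟨hC, CHORD hO hC hc he heO⟩ (Finset.card_le_card hc)
      exact absurd (Finset.card_lt_card h1) (not_lt.2 this)
    obtain ⟨i, -, hi, ha⟩ := cyc_to hC hzC he
    have hoz : o ≠ z := nem hoC hzC
    have h1 := ha.conj (hin o z ho hz hoz)
    rw [hi, pow_fix hoC] at h1
    have h2 := hψ.conj h1
    rw [hψe, hψO o ho] at h2
    have hc : C.support.card * Fintype.card V ≤ Fintype.card V ^ 2 := by
      rw [pow_two]; exact Nat.mul_le_mul_right _ (Finset.card_le_univ _)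
    have h3 : AW G ∅ (swap o x) (22 * Fintype.card V ^ 2) := h2.mono (by linarith)
    by_cases e1 : o = p
    · exact e1 ▸ h3.mono (Nat.mul_le_mul_right _ (by norm_num))
    · have h4 := (hin o p ho hp e1).conj h3
      rw [swap_apply_left, swap_apply_of_ne_of_ne (nem hx ho) (nem hx hp)] at h4
      exact h4.mono (by linarith)
  intro x y hxy
  by_cases hx : x ∈ O.support <;> by_cases hy : y ∈ O.support
  · exact (hin x y hx hy hxy).mono (Nat.mul_le_mul_right _ (by norm_num))
  · exact (hmix x y hx hy).mono (Nat.mul_le_mul_right _ (by norm_num))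
  · rw [swap_comm]; exact (hmix y x hy hx).mono (Nat.mul_le_mul_right _ (by norm_num))
  · obtain ⟨o, ho, -⟩ := hr
    have h4 := (hmix o x ho hx).conj (hmix o y ho hy)
    rw [swap_apply_left, swap_apply_of_ne_of_ne (nem hy ho) hxy.symm] at h4
    exact h4.mono (by linarith)

end P7b
end CM

open SimpleGraph
namespace CM
open Equiv Equiv.Perm
set_option linter.unusedSectionVars false
section P7c
variable {V : Type} [Fintype V] [DecidableEq V] {G : SimpleGraph V}

lemma AW.conj2 {W : Finset V} {π : Perm V} {x y z t : V} {c d : ℕ} (h : AW G W π c) (h' : AW G W (swap x y * swap z t) d) :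
    AW G W (swap (π x) (π y) * swap (π z) (π t)) (2 * c + d) := by
  have := (h.inv.mul h').mul h
  rw [swap_apply_apply, swap_apply_apply]
  convert this.mono (show _ ≤ 2 * c + d by omega) using 1
  group

lemma comm_swap {a b : Perm V} {z : V} (hab : ∀ v, v ≠ z → b v ≠ v → a v = v) (ho : b (a z) = a z) (hz : a z ≠ z) :
    a * b * a⁻¹ * b⁻¹ = swap z (a z) * swap (b z) (a z) := by
  have hd : Disjoint ((swap z (a z))⁻¹ * a) b := by
    intro v
    by_cases hb : b v = v
    · exact Or.inr hb
    · left
      by_cases hv : v = z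
      · subst hv; simp
      · rw [Perm.mul_apply, hab v hv hb, swap_inv]
        exact swap_apply_of_ne_of_ne hv (fun e => hb (by rw [e]; exact ho))
  have h1 := hd.commute.eq
  have h2 : a * b * a⁻¹ = swap z (a z) * b * (swap z (a z))⁻¹ := by
    have : a * b = swap z (a z) * (((swap z (a z))⁻¹ * a) * b) := by group
    rw [this, h1]; group
  rw [h2, swap_inv]
  have h3 : swap (b z) (a z) = b * swap z (a z) * b⁻¹ := by
    rw [← swap_apply_apply, ho]
  rw [h3]; group

lemma KAP (hG : G.Connected) (hE : ∀ u v, G.Adj u v → ∃ g, Cyc G g ∧ u ∈ g.support ∧ v ∈ g.support)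
    (hr : ∀ g, Cyc G g → ¬ Rich G g) {O : Perm V} (hO : Cyc G O) {o1 o2 x : V} (h1 : o1 ∈ O.support) (h2 : o2 ∈ O.support)
    (h12 : o1 ≠ o2) (hx : x ∉ O.support) : AW G ∅ (swap o1 o2 * swap x o2) (10 * Fintype.card V ^ 2) := by
  obtain ⟨C, z, e, ψ, hC, hz, hzC, he, heO, hψ, hψe, hψO⟩ := TR hG hE hO hx
  have hc : ∀ g : Perm V, g.support.card * Fintype.card V ≤ Fintype.card V ^ 2 := fun g => by
    rw [pow_two]; exact Nat.mul_le_mul_right _ (Finset.card_le_univ _)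
  have hone : ∀ v, v ≠ z → v ∈ C.support → v ∉ O.support := fun v hv hvC hvO =>
    hr O hO (EAR hO hC hv hvO hvC hz hzC heO he)
  obtain ⟨m, -, hm, hma⟩ := cyc_to hO hz h1
  obtain ⟨o, rfl⟩ := (O ^ m).surjective o2
  have ho : o ∈ O.support := by
    by_contra h
    rw [pow_fix h] at h2; exact h h2
  have hoz : o ≠ z := by
    rintro rfl; exact h12 hm.symm
  obtain ⟨i, -, hi, hia⟩ := cyc_to hO hz ho
  obtain ⟨j, -, hj, hja⟩ := cyc_to hC hzC he
  have hoC : o ∉ C.support := fun h => hone o hoz h ho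
  have h3 := comm_swap (a := O ^ i) (b := C ^ j) (z := z) (fun v hv hb => pow_fix (hone v hv (by
    by_contra h; exact hb (pow_fix h j))) i) (by rw [hi, pow_fix hoC]) (by rw [hi]; exact hoz)
  have h4 := ((hja.inv.mul hia.inv).mul hja).mul hia
  rw [← mul_assoc, ← mul_assoc, h3, hi, hj] at h4
  have h5 := hma.conj2 (hψ.conj2 h4)
  rw [hψO z hz, hψO o ho, hψe, hm, pow_fix hx] at h5
  have := hc O
  have := hc C
  exact h5.mono (by linarith)

lemma STAR (hG : G.Connected) (hE : ∀ u v, G.Adj u v → ∃ g, Cyc G g ∧ u ∈ g.support ∧ v ∈ g.support) (hP : ¬ Pure G)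
    (hr : ∀ g, Cyc G g → ¬ Rich G g) {O : Perm V} (hO : Cyc G O) {p q v : V} (hp : p ∈ O.support) (hq : q ∈ O.support)
    (hpq : p ≠ q) (hvp : v ≠ p) (hvq : v ≠ q) : AW G ∅ (swap p v * swap p q) (20 * Fintype.card V ^ 2) := by
  have h1 : ∀ x v, x ∉ O.support → v ∈ O.support → v ≠ p → AW G ∅ (swap p v * swap p x) (10 * Fintype.card V ^ 2) := by
    intro x v hx hv hvp
    have := KAP hG hE hr hO hv hp hvp hx
    rwa [swap_comm v, swap_comm x] at this
  have h2 : ∀ x v, x ∉ O.support → v ∈ O.support → v ≠ p → AW G ∅ (swap p x * swap p v) (10 * Fintype.card V ^ 2) := by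
    intro x v hx hv hvp
    have := (h1 x v hx hv hvp).inv
    rwa [mul_inv_rev, swap_inv, swap_inv] at this
  by_cases hv : v ∈ O.support
  · obtain ⟨x, hx⟩ := not_full hP hO (hr O hO)
    have := (h2 x q hx hq hpq.symm).mul (h1 x v hx hv hvp)
    rw [mul_assoc, swap_mul_self_mul] at this
    exact this.mono (by linarith)
  · exact (h2 v q hv hq hpq.symm).mono (Nat.mul_le_mul_right _ (by norm_num))

def Good (G : SimpleGraph V) (p q : V) (σ : Perm V) (c : ℕ) : Prop :=
  (AW G ∅ σ c ∧ sign σ = 1) ∨ (AW G ∅ (swap p q * σ) c ∧ sign σ = -1)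

lemma Good.star {p q : V} {K : ℕ} (hpq : p ≠ q) (hK : ∀ v, v ≠ p → v ≠ q → AW G ∅ (swap p v * swap p q) K) {σ : Perm V} {c : ℕ}
    (h : Good G p q σ c) {v : V} (hv : v ≠ p) : Good G p q (swap p v * σ) (c + K) := by
  rcases h with ⟨h, hs⟩ | ⟨h, hs⟩
  · right
    refine ⟨?_, by rw [Perm.sign_mul, sign_swap hv.symm, hs]; rfl⟩
    by_cases e : v = q
    · subst e; rw [swap_mul_self_mul]; exact h.mono (by omega)
    · have h1 := (hK v hv e).inv
      rw [mul_inv_rev, swap_inv, swap_inv] at h1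
      rw [← mul_assoc]; exact h.mul h1
  · left
    refine ⟨?_, by rw [Perm.sign_mul, sign_swap hv.symm, hs]; rfl⟩
    by_cases e : v = q
    · subst e; exact h.mono (by omega)
    · have := h.mul (hK v hv e)
      rwa [mul_assoc, swap_mul_self_mul] at this

lemma Good.mono {p q : V} {σ : Perm V} {c d : ℕ} (h : Good G p q σ c) (hd : c ≤ d) : Good G p q σ d :=
  h.imp (fun h => ⟨h.1.mono hd, h.2⟩) (fun h => ⟨h.1.mono hd, h.2⟩)

lemma Good.swap {p q : V} {K : ℕ} (hpq : p ≠ q) (hK : ∀ v, v ≠ p → v ≠ q → AW G ∅ (swap p v * swap p q) K) {σ : Perm V} {c : ℕ}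
    (h : Good G p q σ c) {a b : V} (hab : a ≠ b) : Good G p q (Equiv.swap a b * σ) (c + 3 * K) := by
  by_cases ha : a = p
  · subst ha; exact (h.star hpq hK hab.symm).mono (by omega)
  by_cases hb : b = p
  · subst hb; rw [swap_comm]; exact (h.star hpq hK hab).mono (by omega)
  have := ((h.star hpq hK ha).star hpq hK hb).star hpq hK ha
  have e : Equiv.swap a b = Equiv.swap p a * Equiv.swap p b * Equiv.swap p a := by
    have := swap_apply_apply (Equiv.swap p a) p b
    rw [swap_apply_left, swap_apply_of_ne_of_ne hb hab.symm, swap_inv] at this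
    exact this
  rw [e, mul_assoc, mul_assoc]
  exact this.mono (by omega)

lemma Good.all {p q : V} {K : ℕ} (hpq : p ≠ q) (hK : ∀ v, v ≠ p → v ≠ q → AW G ∅ (Equiv.swap p v * Equiv.swap p q) K) :
    ∀ m (σ : Perm V), σ.support.card ≤ m → Good G p q σ (m * (3 * K)) := by
  intro m
  induction m with
  | zero =>
    intro σ h
    have : σ = 1 := by rwa [Nat.le_zero, Finset.card_eq_zero, support_eq_empty_iff] at h
    subst this; exact Or.inl ⟨AW.one, sign_one⟩
  | succ m ih =>
    intro σ h
    by_cases h1 : σ = 1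
    · subst h1; exact Or.inl ⟨AW.one, sign_one⟩
    obtain ⟨v, hv⟩ : ∃ v, σ v ≠ v := by
      by_contra hc; push Not at hc; exact h1 (Equiv.ext hc)
    have h2 := card_support_swap_mul hv
    have h3 := (ih _ (by omega : (Equiv.swap v (σ v) * σ).support.card ≤ m)).swap hpq hK hv.symm
    rw [swap_mul_self_mul] at h3
    exact h3.mono (by linarith)

lemma M_odd {S : Finset V} {γ : Perm V} {c : ℕ} (h : M G S γ c) : S = ∅ → sign γ = -1 → ∃ δ, Rot G δ ∧ sign δ = -1 := by
  rintro rfl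
  induction h with
  | nil => simp
  | @cons γ δ c d _ h2 ih =>
    intro hs
    cases h2 with
    | sw p q hq ha => simp at hq
    | rot _ hr =>
      rcases Int.units_eq_one_or (sign δ) with h | h
      · rw [Perm.sign_mul, h, one_mul] at hs; exact ih hs
      · exact ⟨_, hr, h⟩

lemma M_one (hn : ∀ g, ¬ Cyc G g) {S : Finset V} {γ : Perm V} {c : ℕ} (h : M G S γ c) : S = ∅ → γ = 1 := by
  rintro rfl
  induction h with
  | nil => rfl
  | @cons γ δ c d _ h2 ih =>
    cases h2 with
    | sw p q hq ha => simp at hq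
    | rot _ hr =>
      rw [ih, mul_one]
      by_contra h1
      obtain ⟨v, hv⟩ : ∃ v, δ v ≠ v := by
        by_contra hc; push Not at hc; exact h1 (Equiv.ext hc)
      exact hn _ (rot_cyc hr hv).1

lemma emptyCase (hG : G.Connected) (hE : ∀ u v, G.Adj u v → ∃ g, Cyc G g ∧ u ∈ g.support ∧ v ∈ g.support) (hP : ¬ Pure G)
    {γ : Perm V} {c : ℕ} (hM : M G ∅ γ c) : M G ∅ γ (1122 * Fintype.card V ^ 3) := by
  by_cases hn : ∀ g, ¬ Cyc G g
  · rw [M_one hn hM rfl]; exact M.nil _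
  push Not at hn
  obtain ⟨O, hO⟩ := hn
  by_cases hr : ∃ g, Cyc G g ∧ Rich G g
  · obtain ⟨g, hg, hr⟩ := hr
    have h1 := caseA hG hE hg hr
    obtain ⟨γ', h2, -, h3⟩ := SORT (G := G) (Z := ∅) (R := fun _ _ => True) (fun _ _ _ => trivial) (fun _ _ _ _ _ => trivial)
      (K := 162 * Fintype.card V ^ 2) (fun p q _ _ h _ => (h1 p q h).2 ∅ (by simp)) (Fintype.card V) γ (Finset.card_le_univ _) (by simp)
      (fun _ _ => trivial)
    have : γ' = γ := Equiv.ext fun v => h3 v (by simp)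
    subst this
    exact h2.mono (by rw [pow_succ' _ 2]; nlinarith [Nat.zero_le (Fintype.card V * Fintype.card V ^ 2)])
  · push Not at hr
    obtain ⟨p, hp⟩ : O.support.Nonempty := Finset.nonempty_iff_ne_empty.2 fun h => hO.2.ne_one (support_eq_empty_iff.1 h)
    have hK := fun v hv hv' => STAR hG hE hP hr hO (v := v) hp (Equiv.Perm.apply_mem_support.2 hp) (Equiv.Perm.mem_support.1 hp).symm hv hv'
    have hev : ∀ σ : Perm V, sign σ = 1 → AW G ∅ σ (60 * Fintype.card V ^ 3) := by
      intro σ hs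
      rcases Good.all (Equiv.Perm.mem_support.1 hp).symm hK (Fintype.card V) σ (Finset.card_le_univ _) with h | h
      · exact h.1.mono (by rw [pow_succ' _ 2]; nlinarith [Nat.zero_le (Fintype.card V * Fintype.card V ^ 2)])
      · rw [hs] at h; exact absurd h.2 (by decide)
    rcases Int.units_eq_one_or (sign γ) with h | h
    · exact ((hev γ h).2 ∅ (by simp)).mono (Nat.mul_le_mul_right _ (by norm_num))
    · obtain ⟨δ, hd, hs⟩ := M_odd hM rfl h
      have h1 := (hev (δ⁻¹ * γ) (by rw [Perm.sign_mul, sign_inv, hs, h]; rfl)).mul (AW.rot hd)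
      rw [mul_inv_cancel_left] at h1
      refine (h1.2 ∅ (by simp)).mono ?_
      have : Fintype.card V ≤ Fintype.card V ^ 3 := Nat.le_self_pow (by norm_num) _
      linarith

end P7c
end CM

open SimpleGraph
namespace CM
open Equiv Equiv.Perm
set_option linter.unusedSectionVars false
section P8
variable {V : Type} [Fintype V] [DecidableEq V] {G : SimpleGraph V}

abbrev sg (G : SimpleGraph V) (p : V → Prop) : SimpleGraph (Subtype p) := G.comap Subtype.val

def Cl (G : SimpleGraph V) (p : V → Prop) : Prop := ∀ u v, G.Adj u v → (p u ↔ p v)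

lemma Cl.mk (K : G.ConnectedComponent) : Cl G (fun v => G.connectedComponentMk v = K) := fun u v h => by
  have : G.connectedComponentMk u = G.connectedComponentMk v := ConnectedComponent.eq.2 h.reachable
  simp only [this]

lemma Cl.rot {p : V → Prop} (hp : Cl G p) {g : Perm V} (hg : Rot G g) (x : V) : p (g x) ↔ p x := by
  by_cases h : g x = x
  · rw [h]
  · exact (hp _ _ (hg x h).1).symm

lemma Cl.E {p : V → Prop} (hp : Cl G p) {S : Finset V} {δ : Perm V} {d : ℕ} (h : E G S δ d) (x : V) : p (δ x) ↔ p x := by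
  cases h with
  | sw a b hb ha =>
    rcases eq_or_ne x a with rfl | h1
    · rw [swap_apply_left]; exact (hp _ _ ha).symm
    rcases eq_or_ne x b with rfl | h2
    · rw [swap_apply_right]; exact hp _ _ ha
    rw [swap_apply_of_ne_of_ne h1 h2]
  | rot _ hr => exact hp.rot hr x

lemma Cl.M {p : V → Prop} (hp : Cl G p) {S : Finset V} {δ : Perm V} {d : ℕ} (h : M G S δ d) (x : V) : p (δ x) ↔ p x := by
  induction h with
  | nil => rfl
  | cons _ h2 ih => rw [Perm.mul_apply, hp.E h2]; exact ih

variable {p : V → Prop} [DecidablePred p]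

lemma rot_res {g : Perm V} (hg : Rot G g) (h : ∀ x, p (g x) ↔ p x) : Rot (sg G p) (g.subtypePerm h) := by
  intro v hv
  have hv' : g v ≠ v := fun e => hv (Subtype.ext e)
  exact ⟨(hg v hv').1, fun e => (hg v hv').2 (congrArg Subtype.val e)⟩

lemma cyc_res {g : Perm V} (hg : Cyc G g) (h : ∀ x, p (g x) ↔ p x) {u : V} (hu : u ∈ g.support) (pu : p u) :
    Cyc (sg G p) (g.subtypePerm h) := by
  have hu' := Equiv.Perm.mem_support.1 hu
  refine ⟨rot_res hg.1 h, ⟨u, pu⟩, fun e => hu' (congrArg Subtype.val e), fun y hy => ?_⟩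
  rw [sameCycle_subtypePerm]
  exact hg.2.sameCycle hu' (fun e => hy (Subtype.ext e))

lemma RES (hp : Cl G p) {S : Finset V} {γ : Perm V} {c : ℕ} (h : M G S γ c) (hh : ∀ x, p (γ x) ↔ p x) :
    M (sg G p) (S.subtype p) (γ.subtypePerm hh) c := by
  induction h with
  | nil => rw [show subtypePerm 1 hh = 1 from Equiv.ext fun _ => rfl]; exact M.nil _
  | @cons γ δ c d h1 h2 ih =>
    have a := hp.M h1
    have b := hp.E h2
    rw [← subtypePerm_mul _ _ b a]
    refine (ih a).trans ?_
    have e : (S.subtype p).image (γ.subtypePerm a) = (S.image γ).subtype p := by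
      ext v
      simp only [Finset.mem_image, Finset.mem_subtype]
      constructor
      · rintro ⟨x, hx, rfl⟩; exact ⟨x, hx, rfl⟩
      · rintro ⟨x, hx, e⟩; exact ⟨⟨x, (a x).1 (e ▸ v.2)⟩, hx, Subtype.ext e⟩
    rw [e]
    cases h2 with
    | sw x q hq ha =>
      by_cases hx : p x
      · have : (swap x q).subtypePerm b = swap ⟨x, hx⟩ ⟨q, (hp _ _ ha).1 hx⟩ := by
          ext v
          simp only [subtypePerm_apply, swap_apply_def]
          split_ifs <;> simp_all [Subtype.ext_iff]
        rw [this]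
        exact M.sw (by simpa using hq) ha
      · have : (swap x q).subtypePerm b = 1 := by
          ext v
          simp only [subtypePerm_apply, Perm.one_apply]
          exact swap_apply_of_ne_of_ne (fun e => hx (e ▸ v.2)) (fun e => hx ((hp _ _ ha).2 (e ▸ v.2)))
        rw [this]; exact M.nil _
    | rot _ hr =>
      refine (M.rot (rot_res hr b)).mono ?_
      rw [← Finset.card_map (Function.Embedding.subtype p)]
      refine Finset.card_le_card fun v hv => ?_
      obtain ⟨w, hw, rfl⟩ := Finset.mem_map.1 hv
      exact Equiv.Perm.mem_support.2 fun e => Equiv.Perm.mem_support.1 hw (Subtype.ext e)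

lemma LIFT {S' : Finset (Subtype p)} {γ : Perm (Subtype p)} {c : ℕ} (h : M (sg G p) S' γ c) {S : Finset V} (hS : S.subtype p = S') :
    M G S (ofSubtype γ) c := by
  induction h with
  | nil => rw [map_one]; exact M.nil _
  | @cons γ δ c d h1 h2 ih =>
    rw [map_mul]
    refine ih.trans ?_
    cases h2 with
    | sw x q hq ha =>
      rw [ofSubtype_swap_eq]
      refine M.sw ?_ ha
      obtain ⟨y, hy, rfl⟩ := Finset.mem_image.1 hq
      rw [← hS, Finset.mem_subtype] at hy
      exact Finset.mem_image.2 ⟨y, hy, ofSubtype_apply_coe _ _⟩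
    | rot _ hr =>
      have : δ.support.card = (ofSubtype δ).support.card := by rw [support_ofSubtype, Finset.card_map]
      rw [this]
      refine M.rot fun v hv => ?_
      have hpv : p v := by
        by_contra h; exact hv (ofSubtype_apply_of_not_mem _ h)
      lift v to Subtype p using hpv
      rw [ofSubtype_apply_coe] at hv ⊢
      rw [ofSubtype_apply_coe]
      have := hr v (fun e => hv (by rw [e]))
      exact ⟨this.1, fun e => this.2 (Subtype.ext e)⟩

open Classical in
lemma COMP (C : ℕ) {S : Finset V} {γ : Perm V} {c : ℕ} (hM : M G S γ c)
    (H : ∀ K : G.ConnectedComponent, ∀ γ' c', M (sg G (fun v => G.connectedComponentMk v = K)) (S.subtype _) γ' c' →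
      ∃ γ'', (∀ v, v ∉ S.subtype _ → γ'' v = γ' v) ∧ M (sg G (fun v => G.connectedComponentMk v = K)) (S.subtype _) γ''
        (C * Fintype.card {v // G.connectedComponentMk v = K} ^ 3)) :
    ∃ γ' : Perm V, (∀ v, v ∉ S → γ' v = γ v) ∧ M G S γ' (C * Fintype.card V ^ 3) := by
  have hcl : ∀ K, Cl G (fun v => G.connectedComponentMk v = K) := fun K => Cl.mk K
  have key : ∀ T : Finset G.ConnectedComponent, ∃ γ' : Perm V, (∀ v, v ∉ S → G.connectedComponentMk v ∈ T → γ' v = γ v) ∧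
      (∀ v, G.connectedComponentMk v ∉ T → γ' v = v) ∧
      M G S γ' (∑ K ∈ T, C * Fintype.card {v // G.connectedComponentMk v = K} ^ 3) := by
    intro T
    induction T using Finset.induction_on with
    | empty => exact ⟨1, by simp, by simp, M.nil _⟩
    | insert K T hK ih =>
      obtain ⟨γ', h1, h2, h3⟩ := ih
      obtain ⟨β, h4, h5⟩ := H K _ _ (RES (hcl K) hM ((hcl K).M hM))
      have hfix : ∀ v, G.connectedComponentMk v = K → γ' v = v := fun v hv => h2 v (hv ▸ hK)
      have hcomp : ∀ v, G.connectedComponentMk (γ' v) = G.connectedComponentMk v := fun v => ((hcl _).M h3 v).2 rfl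
      refine ⟨ofSubtype β * γ', fun v hv hT => ?_, fun v hT => ?_, ?_⟩
      · rw [Perm.mul_apply]
        by_cases e : G.connectedComponentMk v = K
        · rw [hfix v e, ofSubtype_apply_of_mem β e, h4 _ (by simpa using hv)]; rfl
        · rw [ofSubtype_apply_of_not_mem]
          · exact h1 v hv ((Finset.mem_insert.1 hT).resolve_left e)
          · rw [hcomp]; exact e
      · rw [Finset.mem_insert, not_or] at hT
        rw [Perm.mul_apply, h2 v hT.2]
        exact ofSubtype_apply_of_not_mem (p := fun v => G.connectedComponentMk v = K) β hT.1
      · rw [Finset.sum_insert hK, add_comm]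
        refine h3.trans (LIFT h5 ?_)
        ext v
        simp only [Finset.mem_subtype, Finset.mem_image]
        constructor
        · rintro ⟨x, hx, e⟩
          have : G.connectedComponentMk x = K := by rw [← hcomp, e]; exact v.2
          rw [hfix x this] at e; exact e ▸ hx
        · exact fun h => ⟨v, h, hfix v v.2⟩
  obtain ⟨γ', h1, -, h3⟩ := key Finset.univ
  refine ⟨γ', fun v hv => h1 v hv (Finset.mem_univ _), h3.mono ?_⟩
  rw [← Finset.mul_sum]
  refine Nat.mul_le_mul_left _ ?_
  have h4 : ∑ K : G.ConnectedComponent, Fintype.card {v // G.connectedComponentMk v = K} ≤ Fintype.card V := by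
    have := disj_sum (V := V) Finset.univ (fun K : G.ConnectedComponent => Finset.univ.filter fun v => G.connectedComponentMk v = K)
      (fun i _ j _ hij => Finset.disjoint_left.2 fun v h1 h2 => hij (by
        rw [← (Finset.mem_filter.1 h1).2, (Finset.mem_filter.1 h2).2]))
    refine le_trans (Finset.sum_le_sum fun K _ => ?_) this
    rw [Fintype.card_subtype]
  calc _ ≤ ∑ K : G.ConnectedComponent, Fintype.card {v // G.connectedComponentMk v = K} * Fintype.card V ^ 2 := by
        refine Finset.sum_le_sum fun K _ => ?_
        rw [pow_succ' _ 2]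
        exact Nat.mul_le_mul_left _ (Nat.pow_le_pow_left (Fintype.card_subtype_le _) 2)
    _ ≤ _ := by
        rw [← Finset.sum_mul, pow_succ' _ 2]; exact Nat.mul_le_mul_right _ h4

lemma sg_conn (K : G.ConnectedComponent) : (sg G (fun v => G.connectedComponentMk v = K)).Connected :=
  K.connected_toSimpleGraph

def deb (G : SimpleGraph V) : SimpleGraph V where
  Adj u v := G.Adj u v ∧ ∃ g, Cyc G g ∧ u ∈ g.support ∧ v ∈ g.support
  symm := ⟨fun _ _ ⟨a, g, b, c, d⟩ => ⟨a.symm, g, b, d, c⟩⟩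
  loopless := ⟨fun _ h => h.1.ne rfl⟩

lemma rot_deb {g : Perm V} (hg : Rot G g) : Rot (deb G) g := fun v hv =>
  ⟨⟨(hg v hv).1, _, rot_cyc hg hv⟩, (hg v hv).2⟩

lemma M_graph {G H : SimpleGraph V} (h : ∀ g, Rot G g → Rot H g) {S : Finset V} {γ : Perm V} {c : ℕ} (hM : M G S γ c) :
    S = ∅ → M H S γ c := by
  rintro rfl
  induction hM with
  | nil => exact M.nil _
  | @cons γ δ c d _ h2 ih =>
    cases h2 with
    | sw p q hq ha => simp at hq
    | rot _ hr => exact M.cons ih (E.rot _ (h _ hr))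

lemma emptyAny {γ : Perm V} {c : ℕ} (hM : M G ∅ γ c) :
    ∃ γ' : Perm V, (∀ v, v ∉ (∅ : Finset V) → γ' v = γ v) ∧ M G ∅ γ' (1122 * Fintype.card V ^ 3) := by
  classical
  obtain ⟨γ', h1, h2⟩ := COMP 1122 (M_graph (H := deb G) (fun g => rot_deb) hM rfl) (fun K γ' c' hK => by
    by_cases hP : Pure (sg (deb G) (fun v => (deb G).connectedComponentMk v = K))
    · exact pureCase hP hK
    · have e : Finset.subtype (fun v => (deb G).connectedComponentMk v = K) ∅ = ∅ := by ext; simp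
      rw [e] at hK ⊢
      refine ⟨γ', fun _ _ => rfl, emptyCase (sg_conn K) ?_ hP hK⟩
      intro u v huv
      obtain ⟨g, hg, hu, hv⟩ := (show (deb G).Adj u v from huv).2
      have hcl : Cl (deb G) (fun v => (deb G).connectedComponentMk v = K) := Cl.mk K
      have hr := hcl.rot (rot_deb hg.1)
      refine ⟨g.subtypePerm hr, cyc_res ⟨rot_deb hg.1, hg.2⟩ hr hu u.2, ?_, ?_⟩
      · exact Equiv.Perm.mem_support.2 fun e => Equiv.Perm.mem_support.1 hu (congrArg Subtype.val e)
      · exact Equiv.Perm.mem_support.2 fun e => Equiv.Perm.mem_support.1 hv (congrArg Subtype.val e))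
  exact ⟨γ', h1, M_graph (G := deb G) (fun g hg v hv => ⟨(hg v hv).1.1, (hg v hv).2⟩) h2 rfl⟩

lemma mainAll (V : Type) [Fintype V] [DecidableEq V] (G : SimpleGraph V) (S : Finset V) (γ : Perm V) (c : ℕ) (hM : M G S γ c) :
    ∃ γ' : Perm V, (∀ v, v ∉ S → γ' v = γ v) ∧ M G S γ' (1122 * Fintype.card V ^ 3) := by
  classical
  refine COMP 1122 hM fun K γ' c' hK => ?_
  by_cases hP : Pure (sg G (fun v => G.connectedComponentMk v = K))
  · exact pureCase hP hK
  · rcases (S.subtype fun v => G.connectedComponentMk v = K).eq_empty_or_nonempty with e | hS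
    · rw [e] at hK ⊢
      exact emptyAny hK
    · exact general (sg_conn K) hP hS hK

end P8
end CM

/-- There is a universal constant `c > 0` such that every feasible GCMP
instance on a (finite) graph `G` admits a schedule of total traveled length at most
`c * |V(G)| ^ 3`. -/
theorem feasible_cubic_schedule :
    ∃ c : ℕ, 0 < c ∧
      ∀ (V : Type) [Fintype V] (G : SimpleGraph V) (k : ℕ) (I : Inst V G k),
        Nonempty (Sched I) →
        ∃ S : Sched I, totalLength S ≤ c * (Fintype.card V) ^ 3 := by
  
  exact CM.final_reduction 1122 (by norm_num) CM.mainAll
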